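/- arXiv:1504.02899 — 11 statements merged into one kernel-verified Lean document; each statement's English description precedes it below -/
import Mathlib

section
/- Let A be a semigroup, let B be a subsemigroup of A, and suppose B ⊴ A, witnessed by an absorbing term t of length k. Then k > 1 is impossible to avoid being useful: one has a^k = a for every a ∈ A, and moreover ab ∈ B and ba ∈ B for every a ∈ A and b ∈ B. -/
/-- The product of the nonempty word `a :: l` in a semigroup (left-to-right). -/
def sprod {A : Type*} [Mul A] (a : A) (l : List A) : A :=
  l.foldl (· * ·) a

lemma abs_eval {M : Type*} [Monoid M] {m : ℕ} (c e : M) (hce : c * e = c) (j : Fin m)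
    (w : List (Fin m)) (r : ℕ) :
    c ^ (r + 1) * (w.map (Function.update (fun _ => e) j c)).prod
      = c ^ (r + 1 + w.count j) := by
  induction w generalizing r with
  | nil => simp
  | cons h t ih =>
    rw [List.map_cons, List.prod_cons, ← mul_assoc]
    by_cases hj : h = j
    · subst hj
      rw [Function.update_self, ← pow_succ, ih, List.count_cons_self]
      congr 1
      omega
    · rw [Function.update_of_ne hj, pow_succ, mul_assoc (c ^ r), hce, ← pow_succ, ih,
        List.count_cons_of_ne hj]

lemma abs_right {M : Type*} [Monoid M] (S B : Set M) (hS : ∀ x ∈ S, ∀ y ∈ S, x * y ∈ S)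
    (hBS : B ⊆ S) (hB : ∀ x ∈ B, ∀ y ∈ B, x * y ∈ B) (m : ℕ) (w : List (Fin m)) (hw : w ≠ [])
    (hid : ∀ a ∈ S, a ^ w.length = a)
    (habs : ∀ a ∈ S, ∀ b : Fin m → M, (∀ i, b i ∈ B) → ∀ j : Fin m,
      (w.map (Function.update b j a)).prod ∈ B) :
    ∀ a ∈ S, ∀ b ∈ B, a * b ∈ B := by
  intro a ha b hb
  obtain ⟨hd, tl, rfl⟩ := List.exists_cons_of_ne_nil hw
  have hc : a * b ∈ S := hS a ha b (hBS hb)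
  rcases Nat.eq_zero_or_pos tl.length with h0 | hpos
  · have := List.length_eq_zero_iff.mp h0
    subst this
    have := habs (a * b) hc (fun _ => b) (fun _ => hb) hd
    simpa using this
  · obtain ⟨n, hn⟩ : ∃ n, tl.length = n + 1 := ⟨tl.length - 1, by omega⟩
    have hpowB : ∀ n : ℕ, b ^ (n + 1) ∈ B := by
      intro n
      induction n with
      | zero => simpa using hb
      | succ n ih => rw [pow_succ]; exact hB _ ih _ hb
    have hbe : b * b ^ (n + 1) = b := by
      rw [← pow_succ']
      have := hid b (hBS hb)
      rwa [List.length_cons, hn] at this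
    have hce : (a * b) * b ^ (n + 1) = a * b := by rw [mul_assoc, hbe]
    have hcid := hid _ hc
    generalize a * b = c at *
    have hP := fun j => habs c hc (fun _ => b ^ (n + 1)) (fun _ => hpowB n) j
    have h1 : c ^ (1 + tl.count hd) ∈ B := by
      have h := hP hd
      have h2 := abs_eval c _ hce hd tl 0
      rw [List.map_cons, List.prod_cons, Function.update_self] at h
      simp only [zero_add, pow_one] at h2
      rwa [h2] at h
    have key : ∀ s : Finset (Fin m), hd ∉ s →
        c ^ (1 + tl.count hd + ∑ j ∈ s, (hd :: tl).count j) ∈ B := by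
      intro s
      induction s using Finset.induction_on with
      | empty => intro _; simpa using h1
      | insert j s hj ih =>
        intro hs
        have h3 := hB _ (ih (fun h => hs (Finset.mem_insert_of_mem h))) _ (hP j)
        have h4 := abs_eval c _ hce j (hd :: tl)
          (tl.count hd + ∑ j ∈ s, (hd :: tl).count j)
        rw [show 1 + tl.count hd + ∑ j ∈ s, (hd :: tl).count j
          = tl.count hd + ∑ j ∈ s, (hd :: tl).count j + 1 by omega, h4] at h3
        rw [Finset.sum_insert hj]
        convert h3 using 2
        omega
    have h5 := key (Finset.univ.erase hd) (by simp)
    have h6 : ∑ j, (hd :: tl).count j = (hd :: tl).length := by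
      have := Multiset.sum_count_eq_card (s := Finset.univ) (m := ((hd :: tl : List (Fin m)) : Multiset (Fin m))) (by simp)
      simpa only [Multiset.coe_count, Multiset.coe_card] using this
    rw [← Finset.add_sum_erase _ _ (Finset.mem_univ hd), List.count_cons_self,
      add_comm (List.count hd tl) 1] at h6
    rw [h6, hcid] at h5
    exact h5

lemma sprod_coe {A : Type*} [Semigroup A] (a : A) (l : List A) :
    ((sprod a l : A) : WithOne A) = ((a :: l).map (fun x : A => (x : WithOne A))).prod := by
  induction l generalizing a with
  | nil => simp [sprod]
  | cons h t ih =>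
    have := ih (a * h)
    simp only [sprod, List.foldl_cons, List.map_cons, List.prod_cons, WithOne.coe_mul] at this ⊢
    rw [this, mul_assoc]

/-- Let `A` be a semigroup, `B` a subsemigroup of `A`, and suppose
`B ⊴ A` is witnessed by an absorbing term `t` (the word `hd :: tl` in `m` variables)
of length `k = tl.length + 1`. Then `a^k = a` for every `a ∈ A`, and moreover
`a*b ∈ B` and `b*a ∈ B` for every `a ∈ A` and `b ∈ B`. -/
theorem absorbing_term_consequences {A : Type*} [Semigroup A] (B : Set A)
    (hne : B.Nonempty) (hcl : ∀ x ∈ B, ∀ y ∈ B, x * y ∈ B)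
    (m : ℕ) (hd : Fin m) (tl : List (Fin m))
    (hidem : ∀ a : A, sprod a (tl.map fun _ => a) = a)
    (habs : ∀ (a : A) (b : Fin m → A), (∀ i, b i ∈ B) → ∀ j : Fin m,
      sprod (Function.update b j a hd) (tl.map (Function.update b j a)) ∈ B) :
    (∀ a : A, sprod a (List.replicate (tl.length + 1 - 1) a) = a) ∧
    ∀ a : A, ∀ b ∈ B, a * b ∈ B ∧ b * a ∈ B := by
  refine ⟨fun a => ?_, ?_⟩
  · have := hidem a
    rwa [List.map_const'] at this
  let S : Set (WithOne A) := Set.range (fun x : A => (x : WithOne A))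
  let BB : Set (WithOne A) := Set.image (fun x : A => (x : WithOne A)) B
  have hS : ∀ x ∈ S, ∀ y ∈ S, x * y ∈ S := by
    rintro _ ⟨x, rfl⟩ _ ⟨y, rfl⟩
    exact ⟨x * y, by simp⟩
  have hBS : BB ⊆ S := by
    rintro _ ⟨x, _, rfl⟩
    exact ⟨x, rfl⟩
  have hB : ∀ x ∈ BB, ∀ y ∈ BB, x * y ∈ BB := by
    rintro _ ⟨x, hx, rfl⟩ _ ⟨y, hy, rfl⟩
    exact ⟨x * y, hcl x hx y hy, by simp⟩
  have hid : ∀ a ∈ S, a ^ (hd :: tl).length = a := by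
    rintro _ ⟨a, rfl⟩
    have := sprod_coe a (tl.map fun _ => a)
    rw [hidem] at this
    simp only [List.map_cons, List.prod_cons, List.map_replicate,
      List.map_const', List.prod_replicate, ← pow_succ'] at this
    exact this.symm
  have hab : ∀ a ∈ S, ∀ b : Fin m → WithOne A, (∀ i, b i ∈ BB) → ∀ j : Fin m,
      ((hd :: tl).map (Function.update b j a)).prod ∈ BB := by
    rintro _ ⟨a, rfl⟩ b hb j
    choose f hf hfb using hb
    have h := habs a f hf j
    refine ⟨_, h, ?_⟩
    have hu : Function.update b j (a : WithOne A)
        = fun i => ((Function.update f j a i : A) : WithOne A) := by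
      funext i
      by_cases hi : i = j
      · subst hi; simp
      · simp only [Function.update_of_ne hi]; exact (hfb i).symm
    simp only [hu, sprod_coe, List.map_cons, List.map_map, Function.comp_def]
  have hback : ∀ x : A, (x : WithOne A) ∈ BB → x ∈ B := by
    rintro x ⟨y, hy, h⟩
    have : y = x := WithOne.coe_injective h
    exact this ▸ hy
  intro a b hb
  constructor
  · apply hback
    rw [WithOne.coe_mul]
    exact abs_right S BB hS hBS hB m (hd :: tl) (by simp) hid hab _ ⟨a, rfl⟩ _ ⟨b, hb, rfl⟩
  · apply hback
    rw [WithOne.coe_mul]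
    have := abs_right (M := (WithOne A)ᵐᵒᵖ) {x | x.unop ∈ S} {x | x.unop ∈ BB}
      (fun x hx y hy => hS _ hy _ hx) (fun x hx => hBS hx) (fun x hx y hy => hB _ hy _ hx)
      m (hd :: tl).reverse (by simp)
      (fun x hx => MulOpposite.unop_injective (by
        rw [MulOpposite.unop_pow, List.length_reverse]; exact hid _ hx))
      (fun x hx f hf j => by
        have h := hab _ hx (fun i => (f i).unop) hf j
        have hu : Function.update (fun i => (f i).unop) j x.unop
            = fun i => (Function.update f j x i).unop := by
          funext i
          by_cases hi : i = j
          · subst hi; simp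
          · simp only [Function.update_of_ne hi]
        rw [hu] at h
        rw [Set.mem_setOf_eq, MulOpposite.unop_list_prod, List.map_map, ← List.map_reverse,
          List.reverse_reverse]
        exact h)
      (MulOpposite.op (a : WithOne A)) ⟨a, rfl⟩ (MulOpposite.op (b : WithOne A)) ⟨b, hb, rfl⟩
    exact this
end

section
/- Let n ≥ 2, let A be an n-ary semigroup and let B be an n-ary subsemigroup of A. Suppose that ab^{n−1} ∈ B and b^{n−1}a ∈ B for every a ∈ A and b ∈ B, and that there exists an integer k > 1 with k ≡ 1 (mod n−1) such that a^k = a for every a ∈ A. Then f(a_1,a_2,…,a_n) ∈ B whenever a_1,…,a_n ∈ A and at least one of a_1,…,a_n belongs to B. -/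
/-- Auxiliary fuelled evaluator: repeatedly replace the first `n` elements of the
list by their image under the `n`-ary operation `f`, until a single element remains. -/
def naryProdAux {A : Type*} (f : List A → A) (n : ℕ) : ℕ → List A → A
  | 0, l => f l
  | _ + 1, [a] => a
  | fuel + 1, l => naryProdAux f n fuel (f (l.take n) :: l.drop n)

/-- The product of a word `l` in an `n`-ary semigroup (well-behaved when
`l.length ≡ 1 (mod n-1)`). -/
def naryProd {A : Type*} (f : List A → A) (n : ℕ) (l : List A) : A :=
  naryProdAux f n l.length l

/-- `n`-ary associativity: evaluating an inner block of `n` consecutive letters of a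
word of length `2n-1` gives the same result no matter where the block is placed. -/
def NAssoc {A : Type*} (n : ℕ) (f : List A → A) : Prop :=
  ∀ u₁ v₁ w₁ u₂ v₂ w₂ : List A,
    v₁.length = n → v₂.length = n →
    u₁ ++ v₁ ++ w₁ = u₂ ++ v₂ ++ w₂ →
    (u₁ ++ v₁ ++ w₁).length = 2 * n - 1 →
    f (u₁ ++ f v₁ :: w₁) = f (u₂ ++ f v₂ :: w₂)

/-- The word `w` in `m` variables is an idempotent absorbing term for `B` in the
`n`-ary semigroup `(A, f)`. -/
def IsAbsTerm {A : Type*} (n : ℕ) (f : List A → A) (B : Set A) {m : ℕ}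
    (w : List (Fin m)) : Prop :=
  (∀ a : A, naryProd f n (w.map fun _ => a) = a) ∧
  ∀ (a : A) (b : Fin m → A), (∀ i, b i ∈ B) → ∀ j : Fin m,
    naryProd f n (w.map (Function.update b j a)) ∈ B

/-- `B` absorbs the `n`-ary semigroup `(A, f)`. -/
def NAbsorbs {A : Type*} (n : ℕ) (f : List A → A) (B : Set A) : Prop :=
  ∃ (m : ℕ) (w : List (Fin m)), w ≠ [] ∧ w.length % (n - 1) = 1 % (n - 1) ∧
    IsAbsTerm n f B w


section Helpers

variable {A : Type*} {f : List A → A} {m : ℕ}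

theorem aux_fuel (hm : 0 < m) : ∀ (q : ℕ) (l : List A) (F G : ℕ), l.length = 1 + m * q →
    q < F → q < G → naryProdAux f (m+1) F l = naryProdAux f (m+1) G l := by
  intro q
  induction q with
  | zero =>
    intro l F G hl hF hG
    obtain ⟨a, rfl⟩ := List.length_eq_one_iff.mp (by simpa using hl)
    obtain ⟨F, rfl⟩ := Nat.exists_eq_succ_of_ne_zero (by omega : F ≠ 0)
    obtain ⟨G, rfl⟩ := Nat.exists_eq_succ_of_ne_zero (by omega : G ≠ 0)
    simp [naryProdAux]
  | succ q ih =>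
    intro l F G hl hF hG
    rw [Nat.mul_succ] at hl
    obtain ⟨F, rfl⟩ := Nat.exists_eq_succ_of_ne_zero (by omega : F ≠ 0)
    obtain ⟨G, rfl⟩ := Nat.exists_eq_succ_of_ne_zero (by omega : G ≠ 0)
    match l, hl with
    | [], hl => simp at hl; omega
    | [a], hl => simp at hl; omega
    | a :: b :: l, hl =>
      simp only [naryProdAux]
      apply ih _ _ _ _ (by omega) (by omega)
      simp only [List.length_cons, List.length_drop] at hl ⊢
      omega

theorem P_single (a : A) : naryProd f (m+1) [a] = a := by
  simp [naryProd, naryProdAux]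

theorem P_step (hm : 0 < m) (q : ℕ) (w v : List A) (hw : w.length = m + 1)
    (hv : v.length = m * q) :
    naryProd f (m+1) (w ++ v) = naryProd f (m+1) (f w :: v) := by
  unfold naryProd
  have hq : q ≤ m * q := Nat.le_mul_of_pos_left q hm
  have h1 : naryProdAux f (m+1) (w ++ v).length (w ++ v)
      = naryProdAux f (m+1) ((v.length + 1) + 1) (w ++ v) := by
    apply aux_fuel hm (q+1)
    · simp [hw, hv, Nat.mul_succ]; omega
    · simp [hw, hv]; omega
    · omega
  rw [h1]
  match w, hw with
  | [], hw => simp at hw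
  | [a], hw => simp at hw; omega
  | a :: b :: w, hw =>
    have ht : (a :: b :: w ++ v).take (m+1) = a :: b :: w := by rw [← hw]; exact List.take_left
    have hd : (a :: b :: w ++ v).drop (m+1) = v := by rw [← hw]; exact List.drop_left
    have : naryProdAux f (m+1) ((v.length + 1) + 1) (a :: b :: w ++ v)
      = naryProdAux f (m+1) (v.length + 1) (f ((a :: b :: w ++ v).take (m+1)) ::
          (a :: b :: w ++ v).drop (m+1)) := by
      simp only [List.cons_append, naryProdAux]
    rw [this, ht, hd]
    rfl

theorem P_f (hm : 0 < m) (l : List A) (hl : l.length = m + 1) : naryProd f (m+1) l = f l := by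
  have := P_step (f := f) hm 0 l [] hl (by simp)
  simpa [P_single] using this

theorem P_assoc1 (hm : 0 < m) (hassoc : NAssoc (m+1) f) : ∀ (q : ℕ) (u w v : List A),
    w.length = m + 1 → u.length + v.length = m * q →
    naryProd f (m+1) (u ++ f w :: v) = naryProd f (m+1) (u ++ w ++ v) := by
  intro q
  induction q with
  | zero =>
    intro u w v hw h
    have hu : u = [] := List.length_eq_zero_iff.mp (by simp at h; simp [h])
    have hv : v = [] := List.length_eq_zero_iff.mp (by simp at h; simp [h])
    subst hu hv
    simpa using (P_step (f := f) hm 0 w [] hw (by simp)).symm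
  | succ q ih =>
    intro u w v hw h
    have h' := h
    rw [Nat.mul_succ] at h'
    by_cases hu : m + 1 ≤ u.length
    · obtain ⟨u1, u2, rfl, h1⟩ : ∃ u1 u2, u = u1 ++ u2 ∧ u1.length = m + 1 :=
        ⟨u.take (m+1), u.drop (m+1), (List.take_append_drop _ _).symm, by simp; omega⟩
      simp only [List.length_append] at h'
      have e1 := P_step (f := f) hm q u1 (u2 ++ f w :: v) h1
        (by simp; omega)
      have e2 := P_step (f := f) hm (q+1) u1 (u2 ++ w ++ v) h1
        (by simp [Nat.mul_succ]; omega)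
      have e3 := ih (f u1 :: u2) w v hw (by simp; omega)
      simp only [List.append_assoc, List.cons_append] at e1 e2 e3 ⊢
      rw [e1, e2, e3]
    · obtain ⟨v1, v2, rfl, h1⟩ : ∃ v1 v2, v = v1 ++ v2 ∧ u.length + v1.length = m :=
        ⟨v.take (m - u.length), v.drop (m - u.length), (List.take_append_drop _ _).symm,
          by simp; omega⟩
      simp only [List.length_append] at h'
      have e1 := P_step (f := f) hm q (u ++ f w :: v1) v2 (by simp; omega) (by omega)
      obtain ⟨w', z, hz, h2⟩ : ∃ w' z, u ++ w ++ v1 = w' ++ z ∧ w'.length = m + 1 :=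
        ⟨(u ++ w ++ v1).take (m+1), (u ++ w ++ v1).drop (m+1),
          (List.take_append_drop _ _).symm, by simp; omega⟩
      have hlen := congrArg List.length hz
      simp only [List.length_append] at hlen
      have e2 := P_step (f := f) hm (q+1) w' (z ++ v2) h2 (by simp [Nat.mul_succ]; omega)
      have e3 := P_step (f := f) hm q (f w' :: z) v2 (by simp; omega) (by omega)
      have e4 := hassoc u w v1 [] w' z hw h2 (by simpa using hz) (by simp; omega)
      have e5 : u ++ w ++ (v1 ++ v2) = w' ++ (z ++ v2) := by
        rw [← List.append_assoc, hz, List.append_assoc]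
      rw [e5, e2]
      simp only [List.append_assoc, List.cons_append, List.nil_append] at e1 e3 e4 ⊢
      rw [e1, e3, e4]

theorem P_assoc (hm : 0 < m) (hassoc : NAssoc (m+1) f) (r : ℕ) : ∀ (q : ℕ) (u w v : List A),
    w.length = 1 + m * q → u.length + v.length = m * r →
    naryProd f (m+1) (u ++ naryProd f (m+1) w :: v) = naryProd f (m+1) (u ++ w ++ v) := by
  intro q
  induction q with
  | zero =>
    intro u w v hw h
    obtain ⟨a, rfl⟩ := List.length_eq_one_iff.mp (by simpa using hw)
    simp [P_single]
  | succ q ih =>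
    intro u w v hw h
    rw [Nat.mul_succ] at hw
    obtain ⟨w1, w2, rfl, h1⟩ : ∃ w1 w2, w = w1 ++ w2 ∧ w1.length = m + 1 :=
        ⟨w.take (m+1), w.drop (m+1), (List.take_append_drop _ _).symm, by simp; omega⟩
    simp only [List.length_append] at hw
    rw [P_step hm q w1 w2 h1 (by omega), ih u (f w1 :: w2) v (by simp; omega) h]
    have := P_assoc1 (f := f) hm hassoc (r + q) u w1 (w2 ++ v) h1
      (by simp [Nat.mul_add]; omega)
    simpa using this

end Helpers

/-- In an `n`-ary semigroup `(A,f)` with subsemigroup `B`, if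
`a·b^(n-1) ∈ B` and `b^(n-1)·a ∈ B` for all `a ∈ A`, `b ∈ B`, and there is `k > 1`
with `k ≡ 1 (mod n-1)` and `a^k = a` for all `a`, then `f(a₁,…,aₙ) ∈ B` whenever at
least one of `a₁,…,aₙ` belongs to `B`. -/
theorem nary_two_implies_three {A : Type*} (n : ℕ) (hn : 2 ≤ n) (f : List A → A)
    (hassoc : NAssoc n f) (B : Set A) (hne : B.Nonempty)
    (hcl : ∀ l : List A, l.length = n → (∀ x ∈ l, x ∈ B) → f l ∈ B)
    (hBabs : ∀ a : A, ∀ b ∈ B,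
      naryProd f n (a :: List.replicate (n - 1) b) ∈ B ∧
      naryProd f n (List.replicate (n - 1) b ++ [a]) ∈ B)
    (k : ℕ) (hk : 1 < k) (hkd : (n - 1) ∣ (k - 1))
    (hpow : ∀ a : A, naryProd f n (List.replicate k a) = a) :
    ∀ l : List A, l.length = n → (∃ x ∈ l, x ∈ B) → f l ∈ B := by
  obtain ⟨m, rfl⟩ : ∃ m, n = m + 1 := ⟨n - 1, by omega⟩
  have hm : 0 < m := by omega
  simp only [Nat.add_sub_cancel] at hBabs hkd
  obtain ⟨t, ht⟩ := hkd
  have ht0 : t ≠ 0 := by rintro rfl; omega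
  have hkt : k = 1 + m * t := by omega
  -- powers of an element of `B` absorb on the left and on the right
  have hL : ∀ b ∈ B, ∀ s : ℕ, ∀ a : A,
      naryProd f (m+1) (List.replicate (m * (s+1)) b ++ [a]) ∈ B := by
    intro b hb s
    induction s with
    | zero => intro a; simpa using (hBabs a b hb).2
    | succ s ih =>
      intro a
      have e := P_assoc (f := f) hm hassoc (s+1) 1 (List.replicate (m * (s+1)) b)
        (List.replicate m b ++ [a]) [] (by simp; omega) (by simp)
      have h := ih (naryProd f (m+1) (List.replicate m b ++ [a]))
      rw [e] at h
      rw [Nat.mul_succ m (s+1), List.replicate_add]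
      simpa only [List.append_assoc, List.append_nil] using h
  have hR : ∀ b ∈ B, ∀ s : ℕ, ∀ a : A,
      naryProd f (m+1) (a :: List.replicate (m * (s+1)) b) ∈ B := by
    intro b hb s
    induction s with
    | zero => intro a; simpa using (hBabs a b hb).1
    | succ s ih =>
      intro a
      have e := P_assoc (f := f) hm hassoc (s+1) 1 []
        (a :: List.replicate m b) (List.replicate (m * (s+1)) b) (by simp; omega) (by simp)
      have h := ih (naryProd f (m+1) (a :: List.replicate m b))
      rw [List.nil_append] at e
      rw [e] at h
      rw [Nat.mul_succ m (s+1), Nat.add_comm (m * (s+1)) m, List.replicate_add]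
      simpa only [List.nil_append, List.cons_append] using h
  obtain ⟨s, rfl⟩ := Nat.exists_eq_succ_of_ne_zero ht0
  have hfirst : ∀ b ∈ B, ∀ (q : ℕ) (w : List A), w.length = m * q →
      naryProd f (m+1) (b :: w) ∈ B := by
    intro b hb q w hw
    have h := hL b hb s (naryProd f (m+1) (b :: w))
    rw [P_assoc hm hassoc (s+1) q _ (b :: w) [] (by simp; omega) (by simp)] at h
    have e := P_assoc (f := f) hm hassoc q (s+1) [] (List.replicate k b) w
      (by simp [hkt]) (by simpa using hw)
    rw [hpow b, hkt, Nat.add_comm 1, List.replicate_add] at e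
    simp only [List.nil_append] at e
    rw [e]
    simpa using h
  have hlast : ∀ b ∈ B, ∀ (q : ℕ) (w : List A), w.length = m * q →
      naryProd f (m+1) (w ++ [b]) ∈ B := by
    intro b hb q w hw
    have h := hR b hb s (naryProd f (m+1) (w ++ [b]))
    have e' := P_assoc (f := f) hm hassoc (s+1) q [] (w ++ [b]) (List.replicate (m * (s+1)) b)
      (by simp; omega) (by simp)
    rw [List.nil_append] at e'
    rw [e'] at h
    have e := P_assoc (f := f) hm hassoc q (s+1) w (List.replicate k b) []
      (by simp [hkt]) (by simpa using hw)
    rw [hpow b, hkt, List.replicate_add] at e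
    rw [e]
    simpa using h
  have hpow' : ∀ (x : A) (j : ℕ),
      naryProd f (m+1) (List.replicate (1 + m * (s+1) * j) x) = x := by
    intro x j
    induction j with
    | zero => simp [P_single]
    | succ j ih =>
      have e := P_assoc (f := f) hm hassoc (s+1) ((s+1)*j) []
        (List.replicate (1 + m * (s+1) * j) x) (List.replicate (m * (s+1)) x)
        (by simp [Nat.mul_assoc]) (by simp)
      rw [ih] at e
      have h2 := hpow x
      rw [hkt, List.replicate_add] at h2
      simp only [List.replicate_one, List.nil_append, List.cons_append] at e h2
      rw [h2] at e
      rw [Nat.mul_succ, ← Nat.add_assoc, List.replicate_add, ← e]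
  intro l hl ⟨b, hbl, hb⟩
  obtain ⟨u, v, rfl⟩ := List.append_of_mem hbl
  have hlen : u.length + v.length = m := by simp at hl; omega
  have hPf := P_f (f := f) hm _ hl
  generalize hx : f (u ++ b :: v) = x at *
  -- write `x = x^p (u b v) x^r` with `p = v.length`
  have hbig : m ≤ m * (s+1) * m := by nlinarith
  obtain ⟨r, hr⟩ : ∃ r, m * (s+1) * m = v.length + r := ⟨m * (s+1) * m - v.length, by omega⟩
  have hxx := hpow' x m
  have hsplit : List.replicate (1 + m * (s+1) * m) x
      = List.replicate v.length x ++ x :: List.replicate r x := by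
    rw [hr, show 1 + (v.length + r) = v.length + (r + 1) by omega, List.replicate_add,
      List.replicate_succ]
  rw [hsplit] at hxx
  have e1 := P_assoc (f := f) hm hassoc ((s+1)*m) 1 (List.replicate v.length x) (u ++ b :: v)
    (List.replicate r x) (by simp; omega) (by simp [← hr, Nat.mul_assoc])
  rw [hPf, hxx] at e1
  have hy := hlast b hb 1 (List.replicate v.length x ++ u) (by simp; omega)
  have e2 := P_assoc (f := f) hm hassoc ((s+1)*m) 1 [] (List.replicate v.length x ++ u ++ [b])
    (v ++ List.replicate r x) (by simp; omega) (by simp [← hr, Nat.mul_assoc])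
  have h := hfirst _ hy ((s+1)*m) (v ++ List.replicate r x) (by simp [← hr, Nat.mul_assoc])
  rw [List.nil_append] at e2
  rw [e2] at h
  rw [e1]
  simpa using h
end

section
/- Let n ≥ 2, let A be an n-ary semigroup and let B be an n-ary subsemigroup of A. Suppose that f(a_1,a_2,…,a_n) ∈ B whenever at least one of a_1,…,a_n belongs to B, and that there exists an integer k > 1 with k ≡ 1 (mod n−1) such that a^k = a for every a ∈ A. Then B ⊴ A; indeed, any term t(x,y) of length k containing at least one occurrence of each of the variables x and y is an absorbing term for B in A. -/
theorem naryProdAux_mem_aux {A : Type*} (n : ℕ) (hn : 2 ≤ n) (f : List A → A) (B : Set A)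
    (habs : ∀ l : List A, l.length = n → (∃ x ∈ l, x ∈ B) → f l ∈ B) (q : ℕ) :
    ∀ (fuel : ℕ) (l : List A), q < fuel → l.length = q * (n - 1) + 1 →
      (∃ x ∈ l, x ∈ B) → naryProdAux f n fuel l ∈ B := by
  induction q with
  | zero =>
    intro fuel l hf hl hx
    obtain ⟨a, rfl⟩ := List.length_eq_one_iff.mp (by simpa using hl)
    obtain ⟨g, rfl⟩ : ∃ g, fuel = g + 1 := ⟨fuel - 1, by omega⟩
    simpa [naryProdAux] using hx
  | succ q ih =>
    intro fuel l hf hl hx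
    obtain ⟨g, rfl⟩ : ∃ g, fuel = g + 1 := ⟨fuel - 1, by omega⟩
    have hl' : l.length = q * (n - 1) + n := by
      rw [hl, Nat.succ_mul]; omega
    have hstep : naryProdAux f n (g + 1) l
        = naryProdAux f n g (f (l.take n) :: l.drop n) := by
      match l, hl' with
      | [], _ => simp [naryProdAux]
      | [a], h => simp at h; omega
      | a :: b :: t, _ => simp [naryProdAux]
    rw [hstep]
    apply ih g _ (by omega)
    · simp [hl']
    · obtain ⟨x, hxl, hxB⟩ := hx
      rw [← List.take_append_drop n l, List.mem_append] at hxl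
      rcases hxl with h | h
      · exact ⟨_, List.mem_cons_self, habs _ (by simp [hl']) ⟨x, h, hxB⟩⟩
      · exact ⟨x, List.mem_cons_of_mem _ h, hxB⟩

/-- In an `n`-ary semigroup `(A,f)` with subsemigroup `B`, if
`f(a₁,…,aₙ) ∈ B` whenever at least one of the `aᵢ` lies in `B`, and there is `k > 1`
with `k ≡ 1 (mod n-1)` and `a^k = a` for all `a`, then `B ⊴ A`; indeed, any term in
two variables of length `k` containing at least one occurrence of each variable is an
absorbing term for `B` in `A`. -/
theorem nary_three_implies_one {A : Type*} (n : ℕ) (hn : 2 ≤ n) (f : List A → A)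
    (hassoc : NAssoc n f) (B : Set A) (hne : B.Nonempty)
    (hcl : ∀ l : List A, l.length = n → (∀ x ∈ l, x ∈ B) → f l ∈ B)
    (habs : ∀ l : List A, l.length = n → (∃ x ∈ l, x ∈ B) → f l ∈ B)
    (k : ℕ) (hk : 1 < k) (hkd : (n - 1) ∣ (k - 1))
    (hpow : ∀ a : A, naryProd f n (List.replicate k a) = a) :
    NAbsorbs n f B ∧
      ∀ w : List (Fin 2), w.length = k → (0 : Fin 2) ∈ w → (1 : Fin 2) ∈ w →
        IsAbsTerm n f B w := by
  have main : ∀ w : List (Fin 2), w.length = k → (0 : Fin 2) ∈ w → (1 : Fin 2) ∈ w →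
      IsAbsTerm n f B w := by
    intro w hw h0 h1
    refine ⟨fun a => ?_, fun a b hb j => ?_⟩
    · rw [List.map_const', hw]; exact hpow a
    · obtain ⟨q, hq⟩ := hkd
      have hk' : k = q * (n - 1) + 1 := by rw [Nat.mul_comm]; omega
      have hle : q * 1 ≤ q * (n - 1) := Nat.mul_le_mul_left q (by omega)
      apply naryProdAux_mem_aux n hn f B habs q
      · rw [List.length_map, hw]; omega
      · rw [List.length_map, hw]; exact hk'
      · obtain ⟨i, hi, hij⟩ : ∃ i ∈ w, i ≠ j := by
          by_cases hj : (0 : Fin 2) = j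
          · exact ⟨1, h1, by rw [← hj]; decide⟩
          · exact ⟨0, h0, hj⟩
        refine ⟨b i, List.mem_map.mpr ⟨i, hi, ?_⟩, hb i⟩
        exact Function.update_of_ne hij a b
  refine ⟨⟨2, 0 :: List.replicate (k - 1) 1, by simp, ?_, ?_⟩, main⟩
  · obtain ⟨q, hq⟩ := hkd
    simp [hq]
  · apply main
    · simp; omega
    · simp
    · simp; omega
end

section
/- Let n ≥ 2, let A be an n-ary semigroup and let B be an n-ary subsemigroup of A such that the complement A∖B consists of exactly one element. Then the following three conditions are equivalent: (1) B ⊴ A; (2) ab^{n−1} ∈ B and b^{n−1}a ∈ B for every a ∈ A and b ∈ B, and there exists an integer k > 1 with k ≡ 1 (mod n−1) such that a^k = a for every a ∈ A; (3) f(a_1,…,a_n) ∈ B whenever at least one of a_1,…,a_n belongs to B, and there exists an integer k > 1 with k ≡ 1 (mod n−1) such that a^k = a for every a ∈ A. -/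
namespace NaryHelp

section Abs
variable {M : Type*} [Monoid M]

/-- Abstract setting inside a monoid: `B` closed under products of `1 + sN` letters, and
words over `B ∪ {c}` of such lengths land in `B ∪ {c}`. -/
structure Setting (N : ℕ) (B : Set M) (c : M) : Prop where
  hN : 1 ≤ N
  hc : c ∉ B
  hB : ∀ (l : List M) (s : ℕ), l.length = 1 + s * N → (∀ x ∈ l, x ∈ B) → l.prod ∈ B
  hA : ∀ (l : List M) (s : ℕ), l.length = 1 + s * N → (∀ x ∈ l, x ∈ B ∨ x = c) →
    l.prod ∈ B ∨ l.prod = c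

variable {N : ℕ} {B : Set M} {c : M}

lemma right_pow {b x : M} (h : x * b ^ N = x) (q : ℕ) : x * b ^ (q * N) = x := by
  induction q with
  | zero => simp
  | succ q ih => rw [Nat.succ_mul, pow_add, ← mul_assoc, ih, h]

lemma word_prod {b : M} (hbc : b * c = c * b) {m : ℕ} (w : List (Fin m)) (j : Fin m) :
    (w.map (Function.update (fun _ => b) j c)).prod
      = c ^ (w.count j) * b ^ (w.length - w.count j) := by
  have hcom : Commute b c := hbc
  induction w with
  | nil => simp
  | cons i w ih =>
    rw [List.map_cons, List.prod_cons, ih]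
    have hle := List.count_le_length (a := j) (l := w)
    by_cases h : i = j
    · subst h
      simp [pow_succ', mul_assoc]
    · rw [Function.update_of_ne h, List.count_cons_of_ne h, List.length_cons,
        Nat.succ_sub hle, pow_succ' b, ← mul_assoc, ← mul_assoc, (hcom.pow_right _).eq]

lemma list_prod_comm {ι : Type*} {b : M} (hbc : b * c = c * b) (r s : ι → ℕ) (L : List ι) :
    (L.map fun j => c ^ r j * b ^ s j).prod = c ^ (L.map r).sum * b ^ (L.map s).sum := by
  have hcom : Commute b c := hbc
  induction L with
  | nil => simp
  | cons i L ih =>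
    simp only [List.map_cons, List.prod_cons, List.sum_cons, ih, pow_add]
    rw [mul_assoc, ← mul_assoc (b ^ s i), (hcom.pow_pow (s i) _).eq]
    simp only [mul_assoc]

lemma sum_count {m : ℕ} (w : List (Fin m)) :
    ((List.finRange m).map fun j => w.count j).sum = w.length := by
  induction w with
  | nil => simp
  | cons i w ih =>
    have : (fun j => (i :: w).count j) = fun j => w.count j + if i = j then 1 else 0 := by
      funext j; simp [List.count_cons]
    rw [this, List.sum_map_add, ih, ← List.ofFn_eq_map, List.sum_ofFn]
    simp

/-- the absorbing word hypothesis -/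
def AbsWord (B : Set M) (c : M) {m : ℕ} (w : List (Fin m)) : Prop :=
  ∀ b : Fin m → M, (∀ i, b i ∈ B) → ∀ j, (w.map (Function.update b j c)).prod ∈ B

lemma both (S : Setting N B c) {m : ℕ} (w : List (Fin m)) (s : ℕ) (hw : w.length = 1 + s * N)
    (ht : AbsWord B c w) (hck : c ^ w.length = c) {b : M} (hb : b ∈ B)
    (h1 : c * b ^ N = c) (h2 : b ^ N * c = c) : False := by
  obtain ⟨K, rfl⟩ : ∃ K, N = K + 1 := ⟨N - 1, by have := S.hN; omega⟩
  have hx : b * c * b ^ K = c := by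
    have := S.hA ([b, c] ++ List.replicate K b) 1 (by simp; omega) (by
      intro x hx
      simp only [List.mem_append, List.mem_cons, List.mem_replicate, List.not_mem_nil, or_false] at hx
      rcases hx with (rfl | rfl) | ⟨_, rfl⟩ <;> simp [hb])
    have e : ([b, c] ++ List.replicate K b).prod = b * c * b ^ K := by simp [mul_assoc]
    rw [e] at this
    refine this.resolve_left fun hin => S.hc ?_
    have := S.hB (List.replicate K b ++ [b * c * b ^ K, b]) 1 (by simp; omega) (by
      intro x hx
      simp only [List.mem_append, List.mem_cons, List.mem_replicate, List.not_mem_nil, or_false] at hx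
      rcases hx with ⟨_, rfl⟩ | rfl | rfl <;> assumption)
    have e : (List.replicate K b ++ [b * c * b ^ K, b]).prod = (b ^ (K+1) * c) * b ^ (K+1) := by
      simp [pow_succ, mul_assoc]
    rwa [e, h2, h1] at this
  have hbc : b * c = c * b := by
    calc b * c = b * (c * b ^ (K+1)) := by rw [h1]
      _ = (b * c * b ^ K) * b := by simp [pow_succ, mul_assoc]
      _ = c * b := by rw [hx]
  have hy : ∀ j, c ^ (w.count j) * b ^ (w.length - w.count j) ∈ B := fun j => by
    rw [← word_prod hbc]; exact ht _ (fun _ => hb) j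
  obtain ⟨m', rfl⟩ : ∃ m', m = m' + 1 := by
    cases m with
    | zero =>
      have : w = [] := by
        cases w with
        | nil => rfl
        | cons i _ => exact i.elim0
      rw [this] at hw; simp at hw; omega
    | succ m' => exact ⟨m', rfl⟩
  have hE : ((List.finRange (m'+1)).map fun j => w.length - w.count j).sum = m' * w.length := by
    have h3 : ((List.finRange (m'+1)).map fun j => (w.length - w.count j) + w.count j).sum
        = (m' + 1) * w.length := by
      have : (fun j : Fin (m'+1) => (w.length - w.count j) + w.count j) = fun _ => w.length := by
        funext j
        have := List.count_le_length (a := j) (l := w)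
        omega
      rw [this]; simp
    rw [List.sum_map_add, sum_count] at h3
    linarith
  have := S.hB (((List.finRange (m'+1)).map
      fun j => c ^ (w.count j) * b ^ (w.length - w.count j)) ++ List.replicate (m' * K) b) m'
      (by simp; ring) (by
        intro x hx
        simp only [List.mem_append, List.mem_map, List.mem_replicate] at hx
        rcases hx with ⟨j, _, rfl⟩ | ⟨_, rfl⟩
        · exact hy j
        · exact hb)
  rw [List.prod_append, list_prod_comm hbc, sum_count, hE, List.prod_replicate, hck, mul_assoc,
    ← pow_add, hw] at this
  have e : m' * (1 + s * (K+1)) + m' * K = (m' * (s + 1)) * (K+1) := by ring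
  rw [e, right_pow h1] at this
  exact S.hc this

lemma left_of_right (S : Setting N B c) {m : ℕ} (w : List (Fin m)) (s : ℕ)
    (hw : w.length = 1 + (s + 1) * N)
    (ht : AbsWord B c w) (hck : c ^ w.length = c) {b : M} (hb : b ∈ B)
    (h1 : c * b ^ N = c) : b ^ N * c = c := by
  obtain ⟨K, rfl⟩ : ∃ K, N = K + 1 := ⟨N - 1, by have := S.hN; omega⟩
  obtain ⟨k, hk⟩ : ∃ k, w.length = k + 2 := ⟨w.length - 2, by rw [hw, Nat.succ_mul]; omega⟩
  rw [hk] at hck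
  have hd : c ^ (k+1) * b ∈ B ∨ c ^ (k+1) * b = c := by
    have := S.hA (List.replicate (k+1) c ++ [b]) (s+1) (by simp; omega) (by
      intro x hx
      simp only [List.mem_append, List.mem_cons, List.mem_replicate, List.not_mem_nil, or_false] at hx
      rcases hx with ⟨_, rfl⟩ | rfl <;> simp [hb])
    simpa using this
  have hz : b ^ (K+1) * c ∈ B ∨ b ^ (K+1) * c = c := by
    have := S.hA (List.replicate (K+1) b ++ [c]) 1 (by simp; omega) (by
      intro x hx
      simp only [List.mem_append, List.mem_cons, List.mem_replicate, List.not_mem_nil, or_false] at hx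
      rcases hx with ⟨_, rfl⟩ | rfl <;> simp [hb])
    simpa using this
  rcases hd with hd | hd
  · refine hz.resolve_left fun hin => S.hc ?_
    have := S.hB ([c ^ (k+1) * b] ++ List.replicate K b ++ [b ^ (K+1) * c]) 1 (by simp; omega) (by
      intro x hx
      simp only [List.mem_append, List.mem_cons, List.mem_replicate, List.not_mem_nil, or_false] at hx
      rcases hx with (rfl | ⟨_, rfl⟩) | rfl <;> assumption)
    have e : ([c ^ (k+1) * b] ++ List.replicate K b ++ [b ^ (K+1) * c]).prod
        = c ^ k * (c * b ^ (K+1) * b ^ (K+1)) * c := by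
      simp only [List.prod_append, List.prod_cons, List.prod_nil, List.prod_replicate, mul_one]
      rw [pow_succ' b K, pow_succ c k]; simp only [mul_assoc]
    rw [e, h1, h1, ← pow_succ, ← pow_succ, hck] at this
    exact this
  · exfalso
    have hcb : c * b = c * c := by
      calc c * b = c ^ (k+2) * b := by rw [hck]
        _ = c * (c ^ (k+1) * b) := by rw [pow_succ' c (k+1), mul_assoc]
        _ = c * c := by rw [hd]
    cases w with
    | nil => simp at hk
    | cons j w =>
      have key : ∀ u : List (Fin m),
          c * (u.map (Function.update (fun _ => b) j c)).prod = c ^ (u.length + 1) := by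
        intro u
        induction u with
        | nil => simp
        | cons i u ih =>
          have : c * Function.update (fun _ => b) j c i = c * c := by
            by_cases h : i = j
            · subst h; simp
            · rw [Function.update_of_ne h, hcb]
          rw [List.map_cons, List.prod_cons, ← mul_assoc, this, mul_assoc, ih, List.length_cons,
            ← pow_succ']
      have h3 := ht (fun _ => b) (fun _ => hb) j
      rw [List.map_cons, List.prod_cons, Function.update_self, key] at h3
      rw [List.length_cons] at hk
      rw [hk, hck] at h3
      exact S.hc h3

lemma right_of_left (S : Setting N B c) {m : ℕ} (w : List (Fin m)) (s : ℕ)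
    (hw : w.length = 1 + (s + 1) * N)
    (ht : AbsWord B c w) (hck : c ^ w.length = c) {b : M} (hb : b ∈ B)
    (h1 : b ^ N * c = c) : c * b ^ N = c := by
  obtain ⟨K, rfl⟩ : ∃ K, N = K + 1 := ⟨N - 1, by have := S.hN; omega⟩
  obtain ⟨k, hk⟩ : ∃ k, w.length = k + 2 := ⟨w.length - 2, by rw [hw, Nat.succ_mul]; omega⟩
  rw [hk] at hck
  have hd : b * c ^ (k+1) ∈ B ∨ b * c ^ (k+1) = c := by
    have := S.hA ([b] ++ List.replicate (k+1) c) (s+1) (by simp; omega) (by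
      intro x hx
      simp only [List.mem_append, List.mem_cons, List.mem_replicate, List.not_mem_nil, or_false] at hx
      rcases hx with rfl | ⟨_, rfl⟩ <;> simp [hb])
    simpa using this
  have hz : c * b ^ (K+1) ∈ B ∨ c * b ^ (K+1) = c := by
    have := S.hA ([c] ++ List.replicate (K+1) b) 1 (by simp; omega) (by
      intro x hx
      simp only [List.mem_append, List.mem_cons, List.mem_replicate, List.not_mem_nil, or_false] at hx
      rcases hx with rfl | ⟨_, rfl⟩ <;> simp [hb])
    simpa using this
  rcases hd with hd | hd
  · refine hz.resolve_left fun hin => S.hc ?_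
    have := S.hB ([c * b ^ (K+1)] ++ List.replicate K b ++ [b * c ^ (k+1)]) 1 (by simp; omega) (by
      intro x hx
      simp only [List.mem_append, List.mem_cons, List.mem_replicate, List.not_mem_nil, or_false] at hx
      rcases hx with (rfl | ⟨_, rfl⟩) | rfl <;> assumption)
    have e : ([c * b ^ (K+1)] ++ List.replicate K b ++ [b * c ^ (k+1)]).prod
        = c * (b ^ (K+1) * (b ^ (K+1) * c)) * c ^ k := by
      simp only [List.prod_append, List.prod_cons, List.prod_nil, List.prod_replicate, mul_one]
      rw [pow_succ b K, pow_succ' c k]; simp only [mul_assoc]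
    rw [e, h1, h1, mul_assoc, ← pow_succ', ← pow_succ', hck] at this
    exact this
  · exfalso
    have hcb : b * c = c * c := by
      calc b * c = b * c ^ (k+2) := by rw [hck]
        _ = (b * c ^ (k+1)) * c := by rw [pow_succ c (k+1), mul_assoc]
        _ = c * c := by rw [hd]
    rcases List.eq_nil_or_concat' w with rfl | ⟨w, j, rfl⟩
    · simp at hk
    · have key : ∀ u : List (Fin m),
          (u.map (Function.update (fun _ => b) j c)).prod * c = c ^ (u.length + 1) := by
        intro u
        induction u with
        | nil => simp
        | cons i u ih =>
          have : Function.update (fun _ => b) j c i * c = c * c := by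
            by_cases h : i = j
            · subst h; simp
            · rw [Function.update_of_ne h, hcb]
          rw [List.map_cons, List.prod_cons, mul_assoc, ih, List.length_cons, pow_succ' c u.length,
            ← mul_assoc, this, mul_assoc, ← pow_succ', ← pow_succ']
      have h3 := ht (fun _ => b) (fun _ => hb) j
      rw [List.map_append, List.prod_append, List.map_singleton, List.prod_singleton,
        Function.update_self, key] at h3
      rw [List.length_append, List.length_singleton] at hk
      rw [hk, hck] at h3
      exact S.hc h3

lemma abs_one_two (S : Setting N B c) {m : ℕ} (w : List (Fin m)) (s : ℕ)
    (hw : w.length = 1 + (s + 1) * N)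
    (ht : AbsWord B c w) (hck : c ^ w.length = c) {b : M} (hb : b ∈ B) :
    c * b ^ N ∈ B ∧ b ^ N * c ∈ B := by
  have hz : b ^ N * c ∈ B ∨ b ^ N * c = c := by
    have := S.hA (List.replicate N b ++ [c]) 1 (by simp; omega) (by
      intro x hx
      simp only [List.mem_append, List.mem_cons, List.mem_replicate, List.not_mem_nil, or_false] at hx
      rcases hx with ⟨_, rfl⟩ | rfl <;> simp [hb])
    simpa using this
  have hz' : c * b ^ N ∈ B ∨ c * b ^ N = c := by
    have := S.hA ([c] ++ List.replicate N b) 1 (by simp; omega) (by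
      intro x hx
      simp only [List.mem_append, List.mem_cons, List.mem_replicate, List.not_mem_nil, or_false] at hx
      rcases hx with rfl | ⟨_, rfl⟩ <;> simp [hb])
    simpa using this
  constructor
  · refine hz'.resolve_right fun h => ?_
    exact both S w (s+1) hw ht hck hb h (left_of_right S w s hw ht hck hb h)
  · refine hz.resolve_right fun h => ?_
    exact both S w (s+1) hw ht hck hb (right_of_left S w s hw ht hck hb h) h

lemma start_mem (S : Setting N B c) (h : ∀ b ∈ B, b ^ N * c ∈ B) (s : ℕ)
    (hk : ∀ b ∈ B, b ^ (1 + (s+1) * N) = b) {b : M} (hb : b ∈ B) (l : List M) (t : ℕ)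
    (hl : l.length = t * N) (hlm : ∀ x ∈ l, x ∈ B ∨ x = c) : b * l.prod ∈ B := by
  have := S.hA (b :: l) t (by simp [hl]; omega) (by
    intro x hx
    rcases List.mem_cons.1 hx with rfl | hx
    · exact Or.inl hb
    · exact hlm x hx)
  rw [List.prod_cons] at this
  refine this.resolve_right fun he => S.hc ?_
  have h1 : b ^ ((s+1) * N) * c = c := by
    rw [← he, ← mul_assoc, ← pow_succ, add_comm, hk b hb]
  have h2 : ∀ q, b ^ ((q+1) * N) * c ∈ B := by
    intro q
    induction q with
    | zero => simpa using h b hb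
    | succ q ih =>
      have := S.hB (List.replicate N b ++ [b ^ ((q+1) * N) * c]) 1 (by simp; omega) (by
        intro x hx
        simp only [List.mem_append, List.mem_cons, List.mem_replicate, List.not_mem_nil, or_false] at hx
        rcases hx with ⟨_, rfl⟩ | rfl <;> assumption)
      rw [List.prod_append, List.prod_replicate, List.prod_singleton, ← mul_assoc, ← pow_add] at this
      rwa [show (q+1+1) * N = N + (q+1) * N by ring]
  have := h2 s
  rwa [h1] at this

lemma end_mem (S : Setting N B c) (h : ∀ b ∈ B, c * b ^ N ∈ B) (s : ℕ)
    (hk : ∀ b ∈ B, b ^ (1 + (s+1) * N) = b) {b : M} (hb : b ∈ B) (l : List M) (t : ℕ)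
    (hl : l.length = t * N) (hlm : ∀ x ∈ l, x ∈ B ∨ x = c) : l.prod * b ∈ B := by
  have := S.hA (l ++ [b]) t (by simp [hl]; omega) (by
    intro x hx
    rcases List.mem_append.1 hx with hx | hx
    · exact hlm x hx
    · rw [List.mem_singleton.1 hx]; exact Or.inl hb)
  rw [List.prod_append, List.prod_singleton] at this
  refine this.resolve_right fun he => S.hc ?_
  have h1 : c * b ^ ((s+1) * N) = c := by
    rw [← he, mul_assoc, ← pow_succ', add_comm, hk b hb]
  have h2 : ∀ q, c * b ^ ((q+1) * N) ∈ B := by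
    intro q
    induction q with
    | zero => simpa using h b hb
    | succ q ih =>
      have := S.hB ([c * b ^ ((q+1) * N)] ++ List.replicate N b) 1 (by simp; omega) (by
        intro x hx
        simp only [List.mem_append, List.mem_cons, List.mem_replicate, List.not_mem_nil, or_false] at hx
        rcases hx with rfl | ⟨_, rfl⟩ <;> assumption)
      rw [List.prod_append, List.prod_replicate, List.prod_singleton, mul_assoc, ← pow_add] at this
      rwa [show (q+1+1) * N = (q+1) * N + N by ring]
  have := h2 s
  rwa [h1] at this

lemma abs_two_three (S : Setting N B c) (h : ∀ b ∈ B, c * b ^ N ∈ B ∧ b ^ N * c ∈ B) (s : ℕ)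
    (hk : ∀ b ∈ B, b ^ (1 + (s+1) * N) = b) (hck : c ^ (1 + (s+1) * N) = c)
    (l : List M) (hl : l.length = N + 1) (hlm : ∀ x ∈ l, x ∈ B ∨ x = c)
    (hx : ∃ x ∈ l, x ∈ B) : l.prod ∈ B := by
  have h0 := S.hA l 1 (by omega) hlm
  refine h0.resolve_right fun he => S.hc ?_
  obtain ⟨b, hbl, hb⟩ := hx
  obtain ⟨l1, l2, rfl⟩ := List.append_of_mem hbl
  simp only [List.length_append, List.length_cons] at hl
  have hd := end_mem S (fun b hb => (h b hb).1) s hk hb (List.replicate l2.length c ++ l1) 1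
    (by simp; omega) (by
      intro x hx
      rcases List.mem_append.1 hx with hx | hx
      · exact Or.inr (List.eq_of_mem_replicate hx)
      · exact hlm x (by simp [hx]))
  have hd2 := start_mem S (fun b hb => (h b hb).2) s hk hd (l2 ++ List.replicate l1.length c) 1
    (by simp; omega) (by
      intro x hx
      rcases List.mem_append.1 hx with hx | hx
      · exact hlm x (by simp [hx])
      · exact Or.inr (List.eq_of_mem_replicate hx))
  have e : (List.replicate l2.length c ++ l1).prod * b * (l2 ++ List.replicate l1.length c).prod
      = c ^ (N + 1) := by
    have : N + 1 = l2.length + 1 + l1.length := by omega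
    rw [this, pow_add, pow_succ]
    rw [List.prod_append, List.prod_cons] at he
    calc _ = c ^ l2.length * (l1.prod * (b * l2.prod)) * c ^ l1.length := by simp [mul_assoc]
      _ = _ := by rw [he]
  rw [e] at hd2
  have hd3 := start_mem S (fun b hb => (h b hb).2) s hk hd2 (List.replicate (s * N) c) s
    (by simp) (fun x hx => Or.inr (List.eq_of_mem_replicate hx))
  rw [List.prod_replicate, ← pow_add, show N + 1 + s * N = 1 + (s+1) * N by ring, hck] at hd3
  exact hd3

end Abs

section Eval
variable {A : Type*} {f : List A → A} {N : ℕ}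

lemma aux_fuel (hN : 1 ≤ N) (s : ℕ) : ∀ (l : List A) (fuel : ℕ), l.length = 1 + s * N → s < fuel →
    naryProdAux f (N+1) fuel l = naryProdAux f (N+1) (s+1) l := by
  induction s with
  | zero =>
    intro l fuel hl hf
    obtain ⟨a, rfl⟩ := List.length_eq_one_iff.1 (by simpa using hl)
    obtain ⟨g, rfl⟩ : ∃ g, fuel = g + 1 := ⟨fuel - 1, by omega⟩
    simp [naryProdAux]
  | succ s ih =>
    intro l fuel hl hf
    obtain ⟨g, rfl⟩ : ∃ g, fuel = g + 1 := ⟨fuel - 1, by omega⟩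
    rw [Nat.succ_mul] at hl
    match l, hl with
    | [], hl => simp at hl; omega
    | [a], hl => simp at hl; omega
    | a :: b :: l, hl =>
      rw [naryProdAux, naryProdAux]
      · apply ih
        · simp at hl ⊢; omega
        · omega
      · simp
      · simp

lemma prod_single (a : A) : naryProd f (N+1) [a] = a := by simp [naryProd, naryProdAux]

lemma prod_rec (hN : 1 ≤ N) (s : ℕ) (u v : List A) (hu : u.length = N + 1) (hv : v.length = s * N) :
    naryProd f (N+1) (u ++ v) = naryProd f (N+1) (f u :: v) := by
  have hs : s ≤ s * N := Nat.le_mul_of_pos_right s hN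
  unfold naryProd
  rw [aux_fuel hN (s+1) (u ++ v) _ (by simp [hu, hv]; ring) (by simp [hu, hv]; omega),
    aux_fuel hN s (f u :: v) _ (by simp [hv]; ring) (by simp [hv]; omega)]
  have e1 : (u ++ v).take (N+1) = u := by rw [← hu]; simp
  have e2 : (u ++ v).drop (N+1) = v := by rw [← hu]; simp
  rw [naryProdAux, e1, e2]
  intro a h
  have := congrArg List.length h
  simp [hu] at this
  omega

lemma gen_assoc (hN : 1 ≤ N) (hassoc : NAssoc (N+1) f) (t : ℕ) : ∀ p u s : List A,
    u.length = N + 1 → p.length + s.length = t * N →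
    naryProd f (N+1) (p ++ u ++ s) = naryProd f (N+1) (p ++ [f u] ++ s) := by
  induction t with
  | zero =>
    intro p u s hu h
    obtain rfl : p = [] := List.length_eq_zero_iff.1 (by omega)
    have := prod_rec (f := f) hN 0 u s hu (by simp at h ⊢; simp [h])
    simpa using this
  | succ t ih =>
    intro p u s hu h
    rw [Nat.succ_mul] at h
    by_cases hp : N + 1 ≤ p.length
    · obtain ⟨p1, p2, rfl, hp1⟩ : ∃ p1 p2, p = p1 ++ p2 ∧ p1.length = N + 1 :=
        ⟨p.take (N+1), p.drop (N+1), by simp, by simp [hp]⟩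
      rw [List.length_append] at h
      have h1 := prod_rec (f := f) hN (t+1) p1 (p2 ++ u ++ s) hp1
        (by simp [Nat.succ_mul]; omega)
      have h2 := prod_rec (f := f) hN t p1 (p2 ++ [f u] ++ s) hp1 (by simp; omega)
      have h3 := ih (f p1 :: p2) u s hu (by simp; omega)
      simp only [List.append_assoc, List.cons_append, List.nil_append] at h1 h2 h3 ⊢
      rw [h1, h2, h3]
    · obtain ⟨s1, s2, rfl, hs1⟩ : ∃ s1 s2, s = s1 ++ s2 ∧ s1.length = N - p.length :=
        ⟨s.take (N - p.length), s.drop (N - p.length), by simp, by simp; omega⟩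
      rw [List.length_append] at h
      obtain ⟨x, y, hxy, hx⟩ : ∃ x y, p ++ u ++ s1 = x ++ y ∧ x.length = N + 1 :=
        ⟨(p ++ u ++ s1).take (N+1), (p ++ u ++ s1).drop (N+1), by simp, by simp; omega⟩
      have hy : y.length = N := by
        have := congrArg List.length hxy
        simp at this; omega
      have e : f (p ++ f u :: s1) = f ([] ++ f x :: y) :=
        hassoc p u s1 [] x y hu hx (by simpa using hxy) (by simp; omega)
      have h1 := prod_rec (f := f) hN (t+1) x (y ++ s2) hx (by simp [Nat.succ_mul]; omega)
      have h2 := prod_rec (f := f) hN t (f x :: y) s2 (by simp [hy]) (by omega)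
      have h3 := prod_rec (f := f) hN t (p ++ f u :: s1) s2 (by simp; omega) (by omega)
      have e0 : p ++ u ++ (s1 ++ s2) = x ++ (y ++ s2) := by
        rw [← List.append_assoc, hxy, List.append_assoc]
      rw [e0, h1, ← List.cons_append, h2]
      rw [e] at h3
      simp only [List.append_assoc, List.cons_append, List.nil_append] at h3 ⊢
      rw [h3]

open Classical in
/-- partial product -/
noncomputable def pp (f : List A → A) (N : ℕ) (l : List A) : Option A :=
  if ∃ t, l.length = 1 + t * N then some (naryProd f (N+1) l) else none

/-- syntactic congruence -/
noncomputable def synCon (f : List A → A) (N : ℕ) : Con (FreeMonoid A) where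
  r u v := ∀ p s : List A,
    pp f N (p ++ FreeMonoid.toList u ++ s) = pp f N (p ++ FreeMonoid.toList v ++ s)
  iseqv := ⟨fun _ _ _ => rfl, fun h p s => (h p s).symm, fun h g p s => (h p s).trans (g p s)⟩
  mul' := by
    intro w x y z h g p s
    have h1 := h p (FreeMonoid.toList y ++ s)
    have h2 := g (p ++ FreeMonoid.toList x) s
    simp only [FreeMonoid.toList_mul, List.append_assoc] at h1 h2 ⊢
    rw [h1, h2]

/-- the embedding into the covering monoid -/
noncomputable def emb (f : List A → A) (N : ℕ) (a : A) : (synCon f N).Quotient :=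
  ((FreeMonoid.of a : FreeMonoid A) : (synCon f N).Quotient)

lemma emb_inj : Function.Injective (emb f N) := by
  intro a b h
  have := ((synCon f N).eq.1 h) [] []
  simp only [FreeMonoid.toList_of, List.nil_append, List.append_nil] at this
  have h1 : ∃ t, 1 = 1 + t * N := ⟨0, by simp⟩
  simpa [pp, prod_single] using this

lemma emb_prod (l : List A) :
    (l.map (emb f N)).prod = ((FreeMonoid.ofList l : FreeMonoid A) : (synCon f N).Quotient) := by
  induction l with
  | nil => rfl
  | cons a l ih =>
    rw [List.map_cons, List.prod_cons, ih, FreeMonoid.ofList_cons, Con.coe_mul]; rfl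

lemma emb_f (hN : 1 ≤ N) (hassoc : NAssoc (N+1) f) (u : List A) (hu : u.length = N + 1) :
    (u.map (emb f N)).prod = emb f N (f u) := by
  rw [emb_prod]
  refine (synCon f N).eq.2 fun p s => ?_
  simp only [FreeMonoid.toList_of, FreeMonoid.toList_ofList]
  by_cases h : ∃ t, p.length + s.length = t * N
  · obtain ⟨t, ht⟩ := h
    have h1 : ∃ t, (p ++ u ++ s).length = 1 + t * N := ⟨t+1, by
      simp only [List.length_append, Nat.succ_mul]; omega⟩
    have h2 : ∃ t, (p ++ [f u] ++ s).length = 1 + t * N := ⟨t, by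
      simp only [List.length_append, List.length_singleton]; omega⟩
    rw [pp, pp, if_pos h1, if_pos h2, gen_assoc hN hassoc t p u s hu ht]
  · have h1 : ¬ ∃ t, (p ++ u ++ s).length = 1 + t * N := by
      rintro ⟨t, ht⟩
      simp only [List.length_append] at ht
      cases t with
      | zero => omega
      | succ t => rw [Nat.succ_mul] at ht; exact h ⟨t, by omega⟩
    have h2 : ¬ ∃ t, (p ++ [f u] ++ s).length = 1 + t * N := by
      rintro ⟨t, ht⟩
      simp only [List.length_append, List.length_singleton] at ht
      exact h ⟨t, by omega⟩
    rw [pp, pp, if_neg h1, if_neg h2]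

lemma split_word (s : ℕ) (l : List A) (hl : l.length = 1 + (s+1) * N) :
    ∃ u v, l = u ++ v ∧ u.length = N + 1 ∧ v.length = s * N := by
  rw [Nat.succ_mul] at hl
  exact ⟨l.take (N+1), l.drop (N+1), by simp, by simp; omega, by simp; omega⟩

lemma emb_word (hN : 1 ≤ N) (hassoc : NAssoc (N+1) f) (s : ℕ) : ∀ l : List A,
    l.length = 1 + s * N → (l.map (emb f N)).prod = emb f N (naryProd f (N+1) l) := by
  induction s with
  | zero =>
    intro l hl
    obtain ⟨a, rfl⟩ := List.length_eq_one_iff.1 (by simpa using hl)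
    simp [prod_single]
  | succ s ih =>
    intro l hl
    obtain ⟨u, v, rfl, hu, hv⟩ := split_word s l hl
    rw [prod_rec hN s u v hu hv, ← ih _ (by simp [hv]; omega), List.map_append, List.prod_append,
      emb_f hN hassoc u hu, List.map_cons, List.prod_cons]

lemma prod_n (hN : 1 ≤ N) (l : List A) (hl : l.length = N + 1) : naryProd f (N+1) l = f l := by
  have := prod_rec (f := f) hN 0 l [] hl (by simp)
  simpa [prod_single] using this

lemma closed_word (hN : 1 ≤ N) {B : Set A}
    (hcl : ∀ l : List A, l.length = N + 1 → (∀ x ∈ l, x ∈ B) → f l ∈ B) (s : ℕ) : ∀ l : List A,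
    l.length = 1 + s * N → (∀ x ∈ l, x ∈ B) → naryProd f (N+1) l ∈ B := by
  induction s with
  | zero =>
    intro l hl h
    obtain ⟨a, rfl⟩ := List.length_eq_one_iff.1 (by simpa using hl)
    simpa [prod_single] using h
  | succ s ih =>
    intro l hl h
    obtain ⟨u, v, rfl, hu, hv⟩ := split_word s l hl
    rw [prod_rec hN s u v hu hv]
    refine ih _ (by simp [hv]; omega) fun x hx => ?_
    rcases List.mem_cons.1 hx with rfl | hx
    · exact hcl u hu fun y hy => h y (by simp [hy])
    · exact h x (by simp [hx])

lemma ideal_word (hN : 1 ≤ N) {B : Set A}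
    (hcl : ∀ l : List A, l.length = N + 1 → (∃ x ∈ l, x ∈ B) → f l ∈ B) (s : ℕ) : ∀ l : List A,
    l.length = 1 + s * N → (∃ x ∈ l, x ∈ B) → naryProd f (N+1) l ∈ B := by
  induction s with
  | zero =>
    intro l hl h
    obtain ⟨a, rfl⟩ := List.length_eq_one_iff.1 (by simpa using hl)
    simpa [prod_single] using h
  | succ s ih =>
    intro l hl h
    obtain ⟨u, v, rfl, hu, hv⟩ := split_word s l hl
    rw [prod_rec hN s u v hu hv]
    refine ih _ (by simp [hv]; omega) ?_
    obtain ⟨x, hx, hxB⟩ := h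
    rcases List.mem_append.1 hx with hx | hx
    · exact ⟨f u, by simp, hcl u hu ⟨x, hx, hxB⟩⟩
    · exact ⟨x, by simp [hx], hxB⟩

lemma lift_list {C : Set A} (l : List ((synCon f N).Quotient))
    (h : ∀ x ∈ l, x ∈ emb f N '' C) : ∃ l' : List A, l'.map (emb f N) = l ∧ ∀ x ∈ l', x ∈ C := by
  induction l with
  | nil => exact ⟨[], by simp⟩
  | cons x l ih =>
    obtain ⟨l', h1, h2⟩ := ih fun y hy => h y (by simp [hy])
    obtain ⟨a, ha, hx⟩ := h x (by simp)
    exact ⟨a :: l', by simp [h1, hx], by simpa [ha] using h2⟩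

lemma setting (hN : 1 ≤ N) (hassoc : NAssoc (N+1) f) {B : Set A} {c : A} (hB : Bᶜ = {c})
    (hcl : ∀ l : List A, l.length = N + 1 → (∀ x ∈ l, x ∈ B) → f l ∈ B) :
    Setting N (emb f N '' B) (emb f N c) where
  hN := hN
  hc := by
    rintro ⟨b, hb, h⟩
    have : c ∈ Bᶜ := by rw [hB]; rfl
    exact this (emb_inj h ▸ hb)
  hB := by
    intro l s hl h
    obtain ⟨l', rfl, h'⟩ := lift_list l h
    rw [List.length_map] at hl
    rw [emb_word hN hassoc s l' hl]
    exact ⟨_, closed_word hN hcl s l' hl h', rfl⟩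
  hA := by
    intro l s hl h
    obtain ⟨l', rfl, h'⟩ := lift_list (f := f) (N := N) (C := Set.univ) l (by
      intro x hx
      rcases h x hx with ⟨b, _, rfl⟩ | rfl
      · exact ⟨b, trivial, rfl⟩
      · exact ⟨c, trivial, rfl⟩)
    rw [List.length_map] at hl
    rw [emb_word hN hassoc s l' hl]
    by_cases hm : naryProd f (N+1) l' ∈ B
    · exact Or.inl ⟨_, hm, rfl⟩
    · right
      have : naryProd f (N+1) l' ∈ Bᶜ := hm
      rw [hB] at this
      rw [Set.mem_singleton_iff.1 this]

end Eval
end NaryHelp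

/-- For an `n`-ary semigroup `(A,f)` and an `n`-ary subsemigroup `B`
whose complement `A∖B` consists of exactly one element, the following are equivalent:
(1) `B ⊴ A`;
(2) `a·b^(n-1) ∈ B` and `b^(n-1)·a ∈ B` for all `a ∈ A`, `b ∈ B`, and there is
`k > 1` with `k ≡ 1 (mod n-1)` and `a^k = a` for all `a`;
(3) `f(a₁,…,aₙ) ∈ B` whenever some `aᵢ ∈ B`, and there is `k > 1` with
`k ≡ 1 (mod n-1)` and `a^k = a` for all `a`. -/
theorem nary_absorption_complement_singleton {A : Type*} (n : ℕ) (hn : 2 ≤ n)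
    (f : List A → A) (hassoc : NAssoc n f)
    (B : Set A) (hne : B.Nonempty)
    (hcl : ∀ l : List A, l.length = n → (∀ x ∈ l, x ∈ B) → f l ∈ B)
    (hcompl : ∃ c : A, Bᶜ = {c}) :
    (NAbsorbs n f B ↔
      ((∀ a : A, ∀ b ∈ B,
          naryProd f n (a :: List.replicate (n - 1) b) ∈ B ∧
          naryProd f n (List.replicate (n - 1) b ++ [a]) ∈ B) ∧
        ∃ k : ℕ, 1 < k ∧ (n - 1) ∣ (k - 1) ∧
          ∀ a : A, naryProd f n (List.replicate k a) = a)) ∧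
    (((∀ a : A, ∀ b ∈ B,
          naryProd f n (a :: List.replicate (n - 1) b) ∈ B ∧
          naryProd f n (List.replicate (n - 1) b ++ [a]) ∈ B) ∧
        ∃ k : ℕ, 1 < k ∧ (n - 1) ∣ (k - 1) ∧
          ∀ a : A, naryProd f n (List.replicate k a) = a) ↔
      ((∀ l : List A, l.length = n → (∃ x ∈ l, x ∈ B) → f l ∈ B) ∧
        ∃ k : ℕ, 1 < k ∧ (n - 1) ∣ (k - 1) ∧
          ∀ a : A, naryProd f n (List.replicate k a) = a)) := by
  classical
  obtain ⟨N, rfl⟩ : ∃ N, n = N + 1 := ⟨n - 1, by omega⟩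
  have hN : 1 ≤ N := by omega
  obtain ⟨c, hc⟩ := hcompl
  have S := NaryHelp.setting hN hassoc hc hcl
  have hcB : c ∉ B := by
    have : c ∈ Bᶜ := by rw [hc]; rfl
    exact this
  have hor : ∀ a, a ∈ B ∨ a = c := by
    intro a
    by_cases h : a ∈ B
    · exact Or.inl h
    · right
      have h' : a ∈ Bᶜ := h
      rw [hc] at h'
      exact h'
  have hmem : ∀ a, NaryHelp.emb f N a ∈ NaryHelp.emb f N '' B → a ∈ B := by
    rintro a ⟨b, hb, h⟩
    exact NaryHelp.emb_inj h ▸ hb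
  simp only [Nat.add_sub_cancel]
  have hkk : ∀ k, 1 < k → N ∣ k - 1 → ∃ s, k = 1 + (s + 1) * N := by
    rintro k hk ⟨q, hq⟩
    cases q with
    | zero => simp at hq; omega
    | succ q => exact ⟨q, by rw [mul_comm (q+1), ← hq]; omega⟩
  have hpow : ∀ s a, naryProd f (N+1) (List.replicate (1 + s * N) a) = a →
      NaryHelp.emb f N a ^ (1 + s * N) = NaryHelp.emb f N a := by
    intro s a h
    have := NaryHelp.emb_word hN hassoc s (List.replicate (1 + s * N) a) (by simp)
    rw [h] at this
    simpa using this
  have e1 : ∀ a b, NaryHelp.emb f N (naryProd f (N+1) (a :: List.replicate N b))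
      = NaryHelp.emb f N a * NaryHelp.emb f N b ^ N := by
    intro a b
    rw [← NaryHelp.emb_word hN hassoc 1 _ (by simp; omega)]
    simp
  have e2 : ∀ a b, NaryHelp.emb f N (naryProd f (N+1) (List.replicate N b ++ [a]))
      = NaryHelp.emb f N b ^ N * NaryHelp.emb f N a := by
    intro a b
    rw [← NaryHelp.emb_word hN hassoc 1 _ (by simp; omega)]
    simp
  have h32 : (∀ l : List A, l.length = N + 1 → (∃ x ∈ l, x ∈ B) → f l ∈ B) →
      (∀ a : A, ∀ b ∈ B,
          naryProd f (N+1) (a :: List.replicate N b) ∈ B ∧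
          naryProd f (N+1) (List.replicate N b ++ [a]) ∈ B) := by
    intro h a b hb
    have hr : b ∈ List.replicate N b := by simp; omega
    exact ⟨NaryHelp.ideal_word hN h 1 _ (by simp; omega) ⟨b, by simp; omega, hb⟩,
      NaryHelp.ideal_word hN h 1 _ (by simp; omega) ⟨b, by simp; omega, hb⟩⟩
  have h23 : ((∀ a : A, ∀ b ∈ B,
          naryProd f (N+1) (a :: List.replicate N b) ∈ B ∧
          naryProd f (N+1) (List.replicate N b ++ [a]) ∈ B) ∧
        ∃ k : ℕ, 1 < k ∧ N ∣ (k - 1) ∧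
          ∀ a : A, naryProd f (N+1) (List.replicate k a) = a) →
      (∀ l : List A, l.length = N + 1 → (∃ x ∈ l, x ∈ B) → f l ∈ B) := by
    rintro ⟨h, k, hk1, hk2, hk⟩ l hl ⟨x, hxl, hxB⟩
    obtain ⟨s, rfl⟩ := hkk k hk1 hk2
    apply hmem
    rw [← NaryHelp.emb_f hN hassoc l hl]
    refine NaryHelp.abs_two_three S ?_ s ?_ (hpow _ _ (hk c)) _ (by simpa using hl) ?_ ?_
    · rintro _ ⟨b, hb, rfl⟩
      exact ⟨⟨_, (h c b hb).1, e1 _ _⟩, ⟨_, (h c b hb).2, e2 _ _⟩⟩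
    · rintro _ ⟨b, hb, rfl⟩
      exact hpow _ _ (hk b)
    · intro y hy
      obtain ⟨a, _, rfl⟩ := List.mem_map.1 hy
      rcases hor a with h | h
      · exact Or.inl ⟨a, h, rfl⟩
      · exact Or.inr (by rw [h])
    · exact ⟨_, List.mem_map.2 ⟨x, hxl, rfl⟩, x, hxB, rfl⟩
  refine ⟨⟨?_, ?_⟩, ⟨fun h => ⟨h23 h, h.2⟩, fun h => ⟨h32 h.1, h.2⟩⟩⟩
  · rintro ⟨m, w, hw0, hwl, hid, habs⟩
    simp only [Nat.add_sub_cancel] at hwl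
    have hpos : 1 ≤ w.length := List.length_pos_iff.2 hw0
    have hdvd : N ∣ w.length - 1 := (Nat.modEq_iff_dvd' hpos).1 hwl.symm
    obtain ⟨b0, hb0⟩ := hne
    have hgt : 1 < w.length := by
      by_contra hle
      obtain ⟨j, rfl⟩ := List.length_eq_one_iff.1 (show w.length = 1 by omega)
      have := habs c (fun _ => b0) (fun _ => hb0) j
      simp [NaryHelp.prod_single] at this
      exact hcB this
    have hid' : ∀ a, naryProd f (N+1) (List.replicate w.length a) = a := by
      intro a
      have := hid a
      rwa [List.map_const'] at this
    refine ⟨?_, w.length, hgt, hdvd, hid'⟩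
    obtain ⟨s, hs⟩ := hkk _ hgt hdvd
    have ht : NaryHelp.AbsWord (NaryHelp.emb f N '' B) (NaryHelp.emb f N c) w := by
      intro b hb j
      choose b' hb' hbb using hb
      refine ⟨_, habs c b' hb' j, ?_⟩
      rw [← NaryHelp.emb_word hN hassoc (s+1) _ (by simpa using hs), List.map_map]
      congr 2
      funext i
      by_cases h : i = j
      · subst h; simp
      · simp [Function.update_of_ne h, hbb]
    intro a b hb
    rcases hor a with ha | rfl
    · have hm : ∀ l : List A, (∀ x ∈ l, x = a ∨ x = b) → ∀ x ∈ l, x ∈ B := by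
        intro l h x hx
        rcases h x hx with rfl | rfl <;> assumption
      refine ⟨NaryHelp.closed_word hN hcl 1 _ (by simp; omega) (hm _ ?_),
        NaryHelp.closed_word hN hcl 1 _ (by simp; omega) (hm _ ?_)⟩
      · intro x hx
        simp only [List.mem_cons, List.mem_replicate] at hx
        tauto
      · intro x hx
        simp only [List.mem_append, List.mem_singleton, List.mem_replicate] at hx
        tauto
    · have hck := hid' a
      rw [hs] at hck
      have := NaryHelp.abs_one_two S w s hs ht (by rw [hs]; exact hpow _ _ hck)
        (Set.mem_image_of_mem _ hb)
      exact ⟨hmem _ (by rw [e1]; exact this.1), hmem _ (by rw [e2]; exact this.2)⟩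
  · intro h2
    have h3 := h23 h2
    obtain ⟨_, k, hk1, hk2, hk⟩ := h2
    obtain ⟨s, rfl⟩ := hkk k hk1 hk2
    have hpos : 1 ≤ (s+1) * N := Nat.mul_pos (Nat.succ_pos s) hN
    refine ⟨2, (0 : Fin 2) :: List.replicate ((s+1) * N) 1, by simp, by simp [Nat.add_mod],
      ?_, ?_⟩
    · intro a
      rw [List.map_const']
      simpa [add_comm] using hk a
    · intro a b hb j
      refine NaryHelp.ideal_word hN h3 (s+1) _ (by simp; omega) ?_
      by_cases hj : j = 0
      · refine ⟨b 1, ?_, hb 1⟩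
        subst hj
        simp
        omega
      · refine ⟨b 0, ?_, hb 0⟩
        rw [List.map_cons, Function.update_of_ne (Ne.symm hj)]
        simp
end

section
/- Let n ≥ 2, let A be an n-ary semigroup and let B be an n-ary subsemigroup of A such that A∖B = {c} for a single element c. Suppose t is an absorbing term for B in A, of length k. Then c^{k−1}b ∈ B and bc^{k−1} ∈ B for every b ∈ B. -/
theorem naux_fuel {A : Type*} (f : List A → A) (d : ℕ) (hd : 1 ≤ d) :
    ∀ (q : ℕ) (l : List A) (k : ℕ), l.length = 1 + q * d → q + 1 ≤ k →
      naryProdAux f (d + 1) k l = naryProdAux f (d + 1) (q + 1) l := by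
  intro q
  induction q with
  | zero =>
    intro l k hl hk
    obtain ⟨k, rfl⟩ : ∃ k', k = k' + 1 := ⟨k - 1, by omega⟩
    obtain ⟨a, rfl⟩ := List.length_eq_one_iff.mp (by simpa using hl)
    simp [naryProdAux]
  | succ q ih =>
    intro l k hl hk
    obtain ⟨k, rfl⟩ : ∃ k', k = k' + 1 := ⟨k - 1, by omega⟩
    have e : (q + 1) * d = q * d + d := by ring
    match l, hl with
    | [], hl => simp at hl; omega
    | [a], hl => simp at hl; omega
    | a :: b :: l, hl =>
      simp only [naryProdAux]
      apply ih
      · simp only [List.length_cons, List.length_drop] at hl ⊢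
        omega
      · omega

theorem nprod_single {A : Type*} (f : List A → A) (n : ℕ) (a : A) :
    naryProd f n [a] = a := by
  simp [naryProd, naryProdAux]

theorem nprod_step {A : Type*} (f : List A → A) (d : ℕ) (hd : 1 ≤ d) (q : ℕ)
    (v w : List A) (hv : v.length = d + 1) (hl : (v ++ w).length = 1 + q * d) :
    naryProd f (d + 1) (v ++ w) = naryProd f (d + 1) (f v :: w) := by
  rw [List.length_append] at hl
  obtain ⟨q, rfl⟩ : ∃ q', q = q' + 1 := by
    rcases q with _ | q
    · simp at hl; omega
    · exact ⟨q, rfl⟩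
  have e : (q + 1) * d = q * d + d := by ring
  have e2 : q * 1 ≤ q * d := Nat.mul_le_mul_left q hd
  unfold naryProd
  rw [naux_fuel f d hd (q + 1) (v ++ w) _ (by simp; omega) (by simp; omega),
    naux_fuel f d hd q (f v :: w) _ (by simp; omega) (by simp; omega)]
  match v, hv with
  | [], hv => simp at hv
  | [a], hv => simp at hv; omega
  | a :: b :: v, hv =>
    have h1 : (a :: b :: v ++ w).take (d + 1) = a :: b :: v := by
      rw [← hv]; exact List.take_left
    have h2 : (a :: b :: v ++ w).drop (d + 1) = w := by
      rw [← hv]; exact List.drop_left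
    conv_lhs => simp only [List.cons_append, naryProdAux]
    simp only [List.cons_append] at h1 h2
    rw [h1, h2]

theorem nprod_inner {A : Type*} (f : List A → A) (d : ℕ) (hd : 1 ≤ d)
    (ha : NAssoc (d + 1) f) :
    ∀ (q : ℕ) (u v w : List A), v.length = d + 1 → (u ++ v ++ w).length = 1 + q * d →
      naryProd f (d + 1) (u ++ f v :: w) = naryProd f (d + 1) (u ++ v ++ w) := by
  intro q
  induction q with
  | zero => intro u v w hv hl; simp at hl; omega
  | succ q ih =>
    intro u v w hv hl
    have e : (q + 1) * d = q * d + d := by ring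
    rcases Nat.lt_or_ge u.length (d + 1) with hu | hu
    · rcases Nat.eq_zero_or_pos u.length with h0 | h0
      · obtain rfl := List.length_eq_zero_iff.mp h0
        simp only [List.nil_append] at hl ⊢
        exact (nprod_step f d hd _ v w hv hl).symm
      · obtain ⟨q, rfl⟩ : ∃ q', q = q' + 1 := by
          rcases q with _ | q
          · simp at hl; omega
          · exact ⟨q, rfl⟩
        have e3 : (q + 1) * d = q * d + d := by ring
        have hl' := hl
        simp only [List.length_append] at hl'
        obtain ⟨w1, w2, rfl, hw1⟩ : ∃ w1 w2, w = w1 ++ w2 ∧ w1.length = d - u.length :=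
          ⟨w.take (d - u.length), w.drop (d - u.length), by simp, by simp; omega⟩
        simp only [List.length_append] at hl'
        obtain ⟨x, y, hxy, hx⟩ : ∃ x y, u ++ v ++ w1 = x ++ y ∧ x.length = d + 1 :=
          ⟨(u ++ v ++ w1).take (d + 1), (u ++ v ++ w1).drop (d + 1),
            (List.take_append_drop _ _).symm, by
              simp only [List.length_take, List.length_append]; omega⟩
        have hlen := congrArg List.length hxy
        simp only [List.length_append] at hlen
        have E1 : u ++ f v :: (w1 ++ w2) = (u ++ f v :: w1) ++ w2 := by simp
        have E2 : u ++ v ++ (w1 ++ w2) = x ++ (y ++ w2) := by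
          rw [← List.append_assoc, hxy, List.append_assoc]
        have E3 : f x :: (y ++ w2) = (f x :: y) ++ w2 := by simp
        rw [E1, E2,
          nprod_step f d hd (q + 1) (u ++ f v :: w1) w2 (by simp; omega) (by simp; omega),
          nprod_step f d hd (q + 1 + 1) x (y ++ w2) hx (by simp; omega), E3,
          nprod_step f d hd (q + 1) (f x :: y) w2 (by simp; omega) (by simp; omega)]
        have := ha u v w1 [] x y hv hx (by simpa using hxy)
          (by simp only [List.length_append]; omega)
        rw [this]; simp
    · obtain ⟨u1, u2, rfl, hu1⟩ : ∃ u1 u2, u = u1 ++ u2 ∧ u1.length = d + 1 :=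
        ⟨u.take (d + 1), u.drop (d + 1), by simp, by simp; omega⟩
      simp only [List.length_append] at hl
      have := ih (f u1 :: u2) v w hv (by simp; omega)
      simp only [List.append_assoc, List.cons_append] at this ⊢
      simp only [List.length_append] at hu
      rw [nprod_step f d hd q u1 (u2 ++ f v :: w) hu1 (by simp; omega),
        nprod_step f d hd (q + 1) u1 (u2 ++ (v ++ w)) hu1 (by simp; omega), this]

theorem nprod_assoc {A : Type*} (f : List A → A) (d : ℕ) (hd : 1 ≤ d)
    (ha : NAssoc (d + 1) f) :
    ∀ (q p : ℕ) (u v w : List A), v.length = 1 + q * d →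
      (u ++ v ++ w).length = 1 + p * d →
      naryProd f (d + 1) (u ++ naryProd f (d + 1) v :: w) =
        naryProd f (d + 1) (u ++ v ++ w) := by
  intro q
  induction q with
  | zero =>
    intro p u v w hv hl
    obtain ⟨a, rfl⟩ := List.length_eq_one_iff.mp (by simpa using hv)
    simp [nprod_single]
  | succ q ih =>
    intro p u v w hv hl
    have e : (q + 1) * d = q * d + d := by ring
    obtain ⟨v1, v2, rfl, hv1⟩ : ∃ v1 v2, v = v1 ++ v2 ∧ v1.length = d + 1 :=
      ⟨v.take (d + 1), v.drop (d + 1), by simp, by simp; omega⟩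
    have hl' := hl
    simp only [List.length_append] at hl hv
    obtain ⟨p, rfl⟩ : ∃ p', p = p' + 1 := by
      rcases p with _ | p
      · simp at hl; omega
      · exact ⟨p, rfl⟩
    have e3 : (p + 1) * d = p * d + d := by ring
    rw [nprod_step f d hd (q + 1) v1 v2 hv1 (by simp; omega),
      ih p u (f v1 :: v2) w (by simp; omega) (by simp; omega)]
    have := nprod_inner f d hd ha (p + 1) u v1 (v2 ++ w) hv1 (by simp; omega)
    simpa using this

theorem nprod_left {A : Type*} (f : List A → A) (d : ℕ) (hd : 1 ≤ d)
    (ha : NAssoc (d + 1) f) (q : ℕ) (b c : A)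
    (hc : naryProd f (d + 1) (List.replicate (q * d + 1) c) = c)
    (hb : naryProd f (d + 1) (List.replicate (q * d) c ++ [b]) = c) :
    ∀ (x : List A) (i p : ℕ), (∀ y ∈ x, y = c ∨ y = b) → i + 1 + x.length = 1 + p * d →
      naryProd f (d + 1) (List.replicate (i + 1) c ++ x) =
        naryProd f (d + 1) (List.replicate (i + 1 + x.length) c) := by
  intro x
  induction x with
  | nil => intro i p _ _; simp
  | cons y x ih =>
    intro i p hy hl
    simp only [List.length_cons] at hl
    have key := ih (i + 1) p (fun z hz => hy z (List.mem_cons_of_mem _ hz)) (by omega)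
    have e0 : i + 1 + (y :: x).length = i + 1 + 1 + x.length := by simp; omega
    rw [e0, ← key]
    rcases hy y (by simp) with rfl | rfl
    · rw [List.replicate_succ' (n := i + 1)]; simp
    · have e : (p + q) * d = p * d + q * d := by ring
      have h1 := nprod_assoc f d hd ha q (p + q) (List.replicate i c)
        (List.replicate (q * d + 1) c) (y :: x) (by simp; omega) (by simp; omega)
      have h2 := nprod_assoc f d hd ha q (p + q) (List.replicate (i + 1) c)
        (List.replicate (q * d) c ++ [y]) x (by simp; omega) (by simp; omega)
      rw [hc] at h1
      rw [hb] at h2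
      have E1 : List.replicate (i + 1) c ++ y :: x = List.replicate i c ++ c :: y :: x := by
        rw [List.replicate_succ']; simp
      have E2 : List.replicate (i + 1 + 1) c ++ x = List.replicate (i + 1) c ++ c :: x := by
        rw [List.replicate_succ' (n := i + 1)]; simp
      rw [E1, E2, h1, h2]
      congr 1
      rw [← List.append_assoc, List.replicate_append_replicate,
        List.replicate_append_replicate,
        show i + (q * d + 1) = i + 1 + q * d by omega]
      simp

theorem nprod_right {A : Type*} (f : List A → A) (d : ℕ) (hd : 1 ≤ d)
    (ha : NAssoc (d + 1) f) (q : ℕ) (b c : A)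
    (hc : naryProd f (d + 1) (List.replicate (q * d + 1) c) = c)
    (hb : naryProd f (d + 1) (b :: List.replicate (q * d) c) = c) :
    ∀ (x : List A) (i p : ℕ), (∀ y ∈ x, y = c ∨ y = b) → i + 1 + x.length = 1 + p * d →
      naryProd f (d + 1) (x ++ List.replicate (i + 1) c) =
        naryProd f (d + 1) (List.replicate (i + 1 + x.length) c) := by
  intro x
  induction x using List.reverseRecOn with
  | nil => intro i p _ _; simp
  | append_singleton x y ih =>
    intro i p hy hl
    simp only [List.length_append, List.length_singleton] at hl
    have key := ih (i + 1) p (fun z hz => hy z (by simp [hz])) (by omega)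
    have e0 : i + 1 + (x ++ [y]).length = i + 1 + 1 + x.length := by simp; omega
    rw [e0, ← key]
    rcases hy y (by simp) with rfl | rfl
    · rw [List.replicate_succ (n := i + 1)]; simp
    · have e : (p + q) * d = p * d + q * d := by ring
      have h1 := nprod_assoc f d hd ha q (p + q) (x ++ [y])
        (List.replicate (q * d + 1) c) (List.replicate i c) (by simp; omega) (by simp; omega)
      have h2 := nprod_assoc f d hd ha q (p + q) x
        (y :: List.replicate (q * d) c) (List.replicate (i + 1) c)
        (by simp; omega) (by simp; omega)
      rw [hc] at h1
      rw [hb] at h2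
      rw [List.replicate_succ (n := i + 1), h2, List.replicate_succ (n := i), h1,
        ← List.replicate_succ (n := i)]
      congr 1
      rw [List.append_assoc, List.append_assoc, List.append_assoc,
        List.replicate_append_replicate, List.cons_append, List.cons_append,
        List.replicate_append_replicate, show q * d + 1 + i = q * d + (i + 1) by omega]
      simp

/-- Let `(A,f)` be an `n`-ary semigroup and `B` an `n`-ary
subsemigroup with `A∖B = {c}`. If `w` is an absorbing term for `B` in `A` of
length `k`, then `c^(k-1)·b ∈ B` and `b·c^(k-1) ∈ B` for every `b ∈ B`. -/
theorem nary_complement_singleton_powers {A : Type*} (n : ℕ) (hn : 2 ≤ n)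
    (f : List A → A) (hassoc : NAssoc n f)
    (B : Set A) (hne : B.Nonempty)
    (hcl : ∀ l : List A, l.length = n → (∀ x ∈ l, x ∈ B) → f l ∈ B)
    (c : A) (hcompl : Bᶜ = {c})
    (m : ℕ) (w : List (Fin m)) (hw0 : w ≠ [])
    (hwlen : w.length % (n - 1) = 1 % (n - 1))
    (ht : IsAbsTerm n f B w) :
    ∀ b ∈ B,
      naryProd f n (List.replicate (w.length - 1) c ++ [b]) ∈ B ∧
      naryProd f n (b :: List.replicate (w.length - 1) c) ∈ B := by
  intro b hb
  have hcB : c ∉ B := by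
    have : c ∈ Bᶜ := by rw [hcompl]; rfl
    exact this
  have hout : ∀ x, x ∉ B → x = c := fun x hx => by
    have : x ∈ Bᶜ := hx
    rw [hcompl] at this
    exact this
  obtain ⟨d, rfl⟩ : ∃ d, n = d + 1 := ⟨n - 1, by omega⟩
  have hd : 1 ≤ d := by omega
  have hpos : 0 < w.length := List.length_pos_iff.mpr hw0
  obtain ⟨q, hq⟩ : ∃ q, w.length = q * d + 1 := by
    have h1 : 1 ≡ w.length [MOD d] := by
      simp only [Nat.add_sub_cancel] at hwlen
      exact hwlen.symm
    obtain ⟨q, hq⟩ := (Nat.modEq_iff_dvd' hpos).mp h1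
    exact ⟨q, by rw [mul_comm]; omega⟩
  have hc : naryProd f (d + 1) (List.replicate (q * d + 1) c) = c := by
    have := ht.1 c
    rwa [List.map_const', hq] at this
  have hval : ∀ (j : Fin m) (l : List (Fin m)),
      ∀ y ∈ l.map (Function.update (fun _ => b) j c), y = c ∨ y = b := by
    intro j l y hy
    obtain ⟨i, _, rfl⟩ := List.mem_map.mp hy
    by_cases h : i = j
    · left; subst h; simp
    · right; simp [h]
  have hk : w.length - 1 = q * d := by omega
  rw [hk]
  constructor
  · by_contra hcon
    have hb' := hout _ hcon
    obtain ⟨j, w', rfl⟩ := List.exists_cons_of_ne_nil hw0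
    have h1 := ht.2 c (fun _ => b) (fun _ => hb) j
    simp only [List.length_cons] at hq
    have h2 := nprod_left f d hd hassoc q b c hc hb'
      (w'.map (Function.update (fun _ => b) j c)) 0 q (hval j w') (by simp; omega)
    have h3 : (0 + 1 + (w'.map (Function.update (fun _ => b) j c)).length) = q * d + 1 := by
      simp; omega
    rw [h3, hc] at h2
    apply hcB
    rw [← h2]
    simpa using h1
  · by_contra hcon
    have hb' := hout _ hcon
    obtain ⟨w', j, rfl⟩ : ∃ w' j, w = w' ++ [j] :=
      ⟨w.dropLast, w.getLast hw0, (List.dropLast_append_getLast hw0).symm⟩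
    have h1 := ht.2 c (fun _ => b) (fun _ => hb) j
    simp only [List.length_append, List.length_singleton] at hq
    have h2 := nprod_right f d hd hassoc q b c hc hb'
      (w'.map (Function.update (fun _ => b) j c)) 0 q (hval j w') (by simp; omega)
    have h3 : (0 + 1 + (w'.map (Function.update (fun _ => b) j c)).length) = q * d + 1 := by
      simp; omega
    rw [h3, hc] at h2
    apply hcB
    rw [← h2]
    simpa using h1
end

section
/- Let A be an idempotent ternary semigroup and let B be a ternary subsemigroup of A. Then the following are equivalent: (1) B ⊴ A; (2) ab² ∈ B and b²a ∈ B for every a ∈ A and b ∈ B; (3) the product a₁a₂a₃ belongs to B whenever at least one of a₁, a₂, a₃ belongs to B. -/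
/-- The product of the word `a :: l` in a ternary semigroup, grouping from the left
(well-behaved when `l` has even length, i.e. the word `a :: l` has odd length). -/
def terProd {A : Type*} (f : A → A → A → A) : A → List A → A
  | a, [] => a
  | a, [_] => a
  | a, x :: y :: l => terProd f (f a x y) l

/-- Ternary associativity. -/
def TAssoc {A : Type*} (f : A → A → A → A) : Prop :=
  ∀ a₁ a₂ a₃ a₄ a₅ : A,
    f (f a₁ a₂ a₃) a₄ a₅ = f a₁ (f a₂ a₃ a₄) a₅ ∧
    f a₁ (f a₂ a₃ a₄) a₅ = f a₁ a₂ (f a₃ a₄ a₅)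

/-- `B` absorbs the ternary semigroup `(A, f)`: there is an idempotent term (a word
`hd :: tl` of odd length in `m` variables) such that substituting an arbitrary element
at any single coordinate and elements of `B` at all other coordinates yields a value
in `B`. -/
def TAbsorbs {A : Type*} (f : A → A → A → A) (B : Set A) : Prop :=
  ∃ (m : ℕ) (hd : Fin m) (tl : List (Fin m)), Even tl.length ∧
    (∀ a : A, terProd f a (tl.map fun _ => a) = a) ∧
    ∀ (a : A) (b : Fin m → A), (∀ i, b i ∈ B) → ∀ j : Fin m,
      terProd f (Function.update b j a hd) (tl.map (Function.update b j a)) ∈ B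

namespace TerAbs

/-- alternating sum -/
def asum : List ℤ → ℤ
  | [] => 0
  | x :: l => x - asum l

theorem asum_ones {ι : Type*} [Fintype ι] [DecidableEq ι] (l : List ι) :
    (∑ j : ι, asum (l.map fun i => if i = j then 1 else 0)) = if Even l.length then 0 else 1 := by
  induction l with
  | nil => simp [asum]
  | cons x l ih =>
    simp only [List.map_cons, asum, Finset.sum_sub_distrib, ih, List.length_cons,
      Nat.even_add_one]
    by_cases h : Even l.length <;> simp [h]

section group
variable {G : Type*} [Group G] (γ β : G) (hγ : γ * γ = 1) (hβ : β * β = 1)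
include hγ hβ

theorem conj_zpow' (s : ℤ) : β * (γ * β) ^ s = (γ * β) ^ (-s) * β := by
  have hb : β⁻¹ = β := inv_eq_of_mul_eq_one_left hβ
  have hg : γ⁻¹ = γ := inv_eq_of_mul_eq_one_left hγ
  have h : β * (γ * β) * β⁻¹ = (γ * β)⁻¹ := by
    rw [mul_inv_rev, hb, hg]
    simp only [mul_assoc, hβ, mul_one]
  have h2 : (β * (γ * β) * β⁻¹) ^ s = β * (γ * β) ^ s * β⁻¹ := conj_zpow
  rw [h, inv_zpow, ← zpow_neg] at h2
  rw [h2]; simp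

theorem word_dihedral {ι : Type*} (p : ι → Prop) [DecidablePred p] (l : List ι) :
    (l.map fun i => if p i then γ else β).prod =
      (γ * β) ^ asum (l.map fun i => if p i then 1 else 0) *
        (if Even l.length then 1 else β) := by
  induction l with
  | nil => simp [asum]
  | cons x l ih =>
    simp only [List.map_cons, List.prod_cons, ih, asum, List.length_cons, Nat.even_add_one]
    generalize asum (l.map fun i => if p i then 1 else 0) = s
    have hc := conj_zpow' γ β hγ hβ s
    have hγ' : γ = γ * β * β := by rw [mul_assoc, hβ, mul_one]
    have key : γ * (γ * β) ^ s = (γ * β) ^ (1 - s) * β := by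
      calc γ * (γ * β) ^ s = (γ * β) * (β * (γ * β) ^ s) := by
            rw [← mul_assoc (γ * β), ← hγ']
        _ = _ := by rw [hc, sub_eq_add_neg, zpow_add, zpow_one]; simp only [mul_assoc]
    by_cases hp : p x <;> by_cases h : Even l.length <;>
      simp only [hp, h, if_true, if_false, not_true, not_false_iff, mul_one, zero_sub]
    · exact key
    · rw [← mul_assoc, key, mul_assoc, hβ, mul_one]
    · exact hc
    · rw [← mul_assoc, hc, mul_assoc, hβ, mul_one]

theorem word_sq {ι : Type*} (p : ι → Prop) [DecidablePred p] (l : List ι)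
    (hl : ¬ Even l.length) :
    (l.map fun i => if p i then γ else β).prod * (l.map fun i => if p i then γ else β).prod
      = 1 := by
  rw [word_dihedral γ β hγ hβ, if_neg hl]
  generalize asum (l.map fun i => if p i then 1 else 0) = s
  rw [mul_assoc, ← mul_assoc β, conj_zpow' γ β hγ hβ, mul_assoc _ β β, hβ, mul_one, ← zpow_add]
  simp

theorem word_total {ι : Type*} [Fintype ι] [DecidableEq ι] (l : List ι)
    (hl : ¬ Even l.length) :
    (Finset.univ.toList.map fun j : ι =>
      (l.map fun i => if i = j then γ else β).prod * β).prod = γ * β := by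
  have : (fun j : ι => (l.map fun i => if i = j then γ else β).prod * β) =
      fun j => (γ * β) ^ asum (l.map fun i => if i = j then 1 else 0) := by
    funext j
    rw [word_dihedral γ β hγ hβ (fun i => i = j), if_neg hl, mul_assoc, hβ, mul_one]
  rw [this]
  have h2 : ∀ L : List ι, (L.map fun j =>
      (γ * β) ^ asum (l.map fun i => if i = j then 1 else 0)).prod =
      (γ * β) ^ (L.map fun j => asum (l.map fun i => if i = j then 1 else 0)).sum := by
    intro L
    induction L with
    | nil => simp
    | cons x L ih => simp [ih, zpow_add]
  rw [h2, Finset.sum_map_toList, asum_ones, if_neg hl, zpow_one]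
end group

/-- corner of a monoid at an idempotent -/
def Cor {M : Type*} [Monoid M] (e : M) : Type _ := {x : M // e * x = x ∧ x * e = x}

/-- corner monoid -/
@[reducible] def corMonoid {M : Type*} [Monoid M] (e : M) (he : e * e = e) : Monoid (Cor e) where
  mul x y := ⟨x.1 * y.1, by rw [← mul_assoc, x.2.1], by rw [mul_assoc, y.2.2]⟩
  one := ⟨e, he, he⟩
  mul_assoc x y z := Subtype.ext (mul_assoc x.1 y.1 z.1)
  one_mul x := Subtype.ext x.2.1
  mul_one x := Subtype.ext x.2.2

/-- The group in which the words live. -/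
theorem exists_group.{u} {M : Type u} [Monoid M] (g b : M) (hg : g * g * g = g)
    (hbg : b * b * g = g) (hgb : g * b * b = g)
    (hgg : (g * g * b) * (g * g * b) * (g * g * b) = g * g * b) :
    ∃ (G : Type u) (_ : Group G) (v : G → M) (γ β : G),
      γ * γ = 1 ∧ β * β = 1 ∧ v γ = g ∧
      ∀ l : List Bool, g * g * (l.map fun i => if i then g else b).prod * (g * g) =
        v (l.map fun i => if i then γ else β).prod := by
  obtain ⟨e, he⟩ : ∃ e, e = g * g := ⟨_, rfl⟩
  have hee : e * e = e := by rw [he, ← mul_assoc, hg]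
  have heg : e * g = g := by rw [he, hg]
  have hge : g * e = g := by rw [he, ← mul_assoc, hg]
  have hebb : e * b * b = e := by rw [he, mul_assoc, mul_assoc, ← mul_assoc g b b, hgb]
  have hebebe : e * b * e * b * e = e := by
    rw [← he] at hgg
    calc e * b * e * b * e = e * b * e * b * (e * b * b) := by rw [hebb]
      _ = e * b * (e * b) * (e * b) * b := by simp only [mul_assoc]
      _ = e := by rw [hgg, hebb]
  let _ := corMonoid e hee
  let c : Cor e := ⟨g, heg, hge⟩
  let d : Cor e := ⟨e * b * e, by simp only [← mul_assoc, hee], by simp only [mul_assoc, hee]⟩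
  have hcc : c * c = 1 := Subtype.ext he.symm
  have hdd : d * d = 1 := Subtype.ext (by
    change e * b * e * (e * b * e) = e
    calc _ = e * b * (e * e) * b * e := by simp only [mul_assoc]
      _ = e := by rw [hee, hebebe])
  let γ : (Cor e)ˣ := ⟨c, c, hcc, hcc⟩
  let β : (Cor e)ˣ := ⟨d, d, hdd, hdd⟩
  refine ⟨(Cor e)ˣ, inferInstance, fun w => w.val.1, γ, β, Units.ext hcc, Units.ext hdd, rfl, ?_⟩
  rw [← he]
  have step : ∀ (l : List Bool) (x : Bool),
      e * (if x then g else b) * (l.map fun i => if i then g else b).prod * e =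
      (e * (if x then g else b) * e) * (e * (l.map fun i => if i then g else b).prod * e) := by
    intro l
    induction l with
    | nil => intro x; simp [mul_assoc, hee]
    | cons y l ih =>
      intro x
      have h1 : ∀ z, e * g * e * (e * z * e) = e * g * z * e := by
        intro z
        calc _ = e * (g * e * e) * z * e := by simp only [mul_assoc]
          _ = _ := by rw [hge, hge]
      cases x
      · cases y
        · have := ih false
          simp only [List.map_cons, List.prod_cons, Bool.false_eq_true, if_false] at this ⊢
          generalize (l.map fun i => if i then g else b).prod = z at *
          rw [← mul_assoc, hebb, ← mul_assoc e b z, this]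
          calc e * z * e = (e * b * e * b * e) * z * e := by rw [hebebe]
            _ = (e * b * (e * e) * b * (e * e)) * z * e := by rw [hee]
            _ = _ := by simp only [mul_assoc]
        · simp only [List.map_cons, List.prod_cons, Bool.false_eq_true, if_false, if_true]
          generalize (l.map fun i => if i then g else b).prod = z at *
          calc e * b * (g * z) * e = e * b * ((e * (e * g)) * z) * e := by rw [heg, heg]
            _ = _ := by simp only [mul_assoc]
      · simp only [if_true]
        rw [h1]
  intro l
  induction l with
  | nil => simp [hee]; rfl
  | cons x l ih =>
    simp only [List.map_cons, List.prod_cons, ← mul_assoc]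
    rw [step, ih]
    have : e * (if x then g else b) * e = (if x then γ else β).val.1 := by
      cases x
      · rfl
      · simp only [if_true, heg, hge]; rfl
    rw [this]; rfl

section mon
variable {M : Type*} [Monoid M] (O B : Set M) (hO3 : ∀ x ∈ O, x * x * x = x)
  (hOO : ∀ x ∈ O, ∀ y ∈ O, ∀ z ∈ O, x * y * z ∈ O) (hBO : B ⊆ O)
  (hBB : ∀ x ∈ B, ∀ y ∈ B, ∀ z ∈ B, x * y * z ∈ B)
  {ι : Type*} [Fintype ι] [DecidableEq ι] (l : List ι) (hl : ¬ Even l.length)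
  (habs : ∀ a ∈ O, ∀ b ∈ B, ∀ j, (l.map fun i => if i = j then a else b).prod ∈ B)

omit [DecidableEq ι] [Fintype ι] in
theorem map_bool {N : Type*} [Monoid N] (g b : N) (p : ι → Prop) [DecidablePred p] (l : List ι) :
    (l.map fun i => if p i then g else b).prod =
      ((l.map fun i => decide (p i)).map fun i => if i then g else b).prod := by
  simp [List.map_map, Function.comp_def]

include hBB in
theorem even_word (L : List M) (hL : ∀ x ∈ L, x ∈ B) (hev : Even L.length) (y : M) (hy : y ∈ B) :
    y * L.prod ∈ B := by
  induction L using List.twoStepInduction generalizing y with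
  | nil => simpa
  | singleton x => simp at hev
  | cons_cons x z L ih _ =>
    simp only [List.prod_cons, ← mul_assoc]
    apply ih
    · intro w hw; exact hL w (by simp [hw])
    · simpa [Nat.even_add_one] using hev
    · exact hBB _ hy _ (hL _ (by simp)) _ (hL _ (by simp))

include hO3 hOO hBO hBB hl habs

theorem core (g b : M) (hg : g ∈ O) (hb : b ∈ B) (hbg : b * b * g = g) (hgb : g * b * b = g) :
    g ∈ B := by
  have hg3 := hO3 g hg
  obtain ⟨G, _, v, γ, β, hγ, hβ, hvγ, hv⟩ := exists_group g b hg3 hbg hgb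
    (hO3 _ (hOO _ hg _ hg _ (hBO hb)))
  -- the words
  let W : ι → List Bool := fun j => l.map fun i => decide (i = j)
  let P : List Bool → M := fun L => (L.map fun i => if i then g else b).prod
  let Q : List Bool → G := fun L => (L.map fun i => if i then γ else β).prod
  have Papp : ∀ L L', P (L ++ L') = P L * P L' := by intro L L'; simp [P]
  have Qapp : ∀ L L', Q (L ++ L') = Q L * Q L' := by intro L L'; simp [Q]
  have hWB : ∀ j, P (W j) ∈ B := by
    intro j
    have := habs g hg b hb j
    rw [map_bool] at this
    exact this
  have hWsq : ∀ j, Q (W j) * Q (W j) = 1 := by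
    intro j
    have := word_sq γ β hγ hβ (fun i => i = j) l hl
    rw [map_bool] at this
    exact this
  -- total
  let Z : List Bool := (Finset.univ.toList.map fun j => W j ++ [false]).flatten ++ [false]
  have hZB : P Z ∈ B := by
    have : ∀ K : List ι, P ((K.map fun j => W j ++ [false]).flatten ++ [false]) ∈ B := by
      intro K
      induction K with
      | nil => simpa [P] using hb
      | cons j K ih =>
        simp only [List.map_cons, List.flatten_cons, List.append_assoc] at ih ⊢
        rw [Papp, Papp, ← mul_assoc]
        exact hBB _ (hWB j) _ (by simpa [P] using hb) _ ih
    exact this _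
  have hZQ : Q Z = γ := by
    have h1 : ∀ K : List ι, Q ((K.map fun j => W j ++ [false]).flatten) =
        (K.map fun j : ι => (l.map fun i => if i = j then γ else β).prod * β).prod := by
      intro K
      induction K with
      | nil => simp [Q]
      | cons j K ih =>
        simp only [List.map_cons, List.flatten_cons, List.prod_cons]
        rw [Qapp, Qapp, ih, map_bool]
        simp [Q, W]
    change Q (_ ++ _) = γ
    rw [Qapp, h1, word_total γ β hγ hβ l hl]
    simp [Q, mul_assoc, hβ]
  -- first and last letters
  have hne : l ≠ [] := by rintro rfl; simp at hl
  obtain ⟨j, l₁, hj⟩ := List.exists_cons_of_ne_nil hne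
  obtain ⟨l₂, k, hk⟩ : ∃ l₂ k, l = l₂ ++ [k] :=
    ⟨_, _, (List.dropLast_append_getLast hne).symm⟩
  have hstart : g * g * P (W j) = P (W j) := by
    simp only [W, P, hj, List.map_cons, List.prod_cons, decide_true, if_true, ← mul_assoc, hg3]
  have hend : P (W k) * (g * g) = P (W k) := by
    simp only [W, P, hk, List.map_append, List.prod_append, List.map_cons, List.map_nil,
      List.prod_cons, List.prod_nil, mul_one, decide_true, if_true, mul_assoc]
    rw [← mul_assoc g g g, hg3]
  have fin := hv (W j ++ W j ++ Z ++ W k ++ W k)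
  change g * g * P _ * _ = v (Q _) at fin
  simp only [Qapp, hZQ, hWsq, one_mul] at fin
  rw [mul_assoc γ, hWsq, mul_one, hvγ] at fin
  simp only [Papp] at fin
  have : P (W j) * P (W j) * P Z * P (W k) * P (W k) = g := by
    rw [← fin]
    simp only [mul_assoc, hend]
    simp only [← mul_assoc, hstart]
  rw [← this]
  exact hBB _ (hBB _ (hWB j) _ (hWB j) _ hZB) _ (hWB k) _ (hWB k)

theorem left_abs (a b : M) (ha : a ∈ O) (hb : b ∈ B) : a * b * b ∈ B := by
  have hbO := hBO hb
  have hb3 := hO3 b hbO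
  obtain ⟨e, he⟩ : ∃ e, e = a * b * b := ⟨_, rfl⟩
  have heO : e ∈ O := he ▸ hOO _ ha _ hbO _ hbO
  have hebb : e * b * b = e := by
    rw [he]
    calc _ = a * (b * b * b) * b := by simp only [mul_assoc]
      _ = _ := by rw [hb3]
  obtain ⟨g, hg⟩ : ∃ g, g = b * b * e := ⟨_, rfl⟩
  have hgO : g ∈ O := hg ▸ hOO _ hbO _ hbO _ heO
  have hbg : b * b * g = g := by
    rw [hg]
    calc _ = (b * b * b) * b * e := by simp only [mul_assoc]
      _ = _ := by rw [hb3]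
  have hgb : g * b * b = g := by
    rw [hg]
    calc _ = b * b * (e * b * b) := by simp only [mul_assoc]
      _ = _ := by rw [hebb]
  have hgB : g ∈ B := core O B hO3 hOO hBO hBB l hl habs g b hgO hb hbg hgb
  have hg3 := hO3 g hgO
  have heeg : ∀ x : M, x * b * b = x → x * e = x * g := by
    intro x hx
    rw [hg, ← mul_assoc, ← mul_assoc, hx]
  have hegg : e * g * g = e := by
    rw [← heeg e hebb, mul_assoc, ← heeg e hebb, ← mul_assoc, hO3 e heO]
  rw [← he]
  obtain ⟨G, _, v, γ, β, hγ, hβ, hvγ, hv⟩ := exists_group g b hg3 hbg hgb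
    (hO3 _ (hOO _ hgO _ hgO _ hbO))
  have hne : l ≠ [] := by rintro rfl; simp at hl
  obtain ⟨j, l₁, hj⟩ := List.exists_cons_of_ne_nil hne
  have hsub : ∀ (L : List ι) (x : M), x * b * b = x →
      x * (L.map fun i => if i = j then e else b).prod =
      x * (L.map fun i => if i = j then g else b).prod := by
    intro L
    induction L with
    | nil => intro x _; rfl
    | cons i L ih =>
      intro x hx
      simp only [List.map_cons, List.prod_cons, ← mul_assoc]
      by_cases h : i = j
      · simp only [h, if_true]
        rw [heeg x hx]
        apply ih
        rw [mul_assoc, mul_assoc, ← mul_assoc g, hgb]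
      · simp only [h, if_false]
        apply ih
        rw [mul_assoc, mul_assoc, ← mul_assoc b, hb3]
  obtain ⟨V, hV⟩ : ∃ V, V = (l₁.map fun i => if i = j then g else b).prod := ⟨_, rfl⟩
  have h1 : e * V ∈ B := by
    have := habs e heO b hb j
    rw [hj] at this
    simp only [List.map_cons, List.prod_cons, if_true] at this
    rwa [hsub _ _ hebb, ← hV] at this
  have hev : Even l₁.length := by
    rw [hj] at hl
    simpa [Nat.even_add_one] using hl
  have hmem : ∀ x ∈ (l₁.map fun i => if i = j then g else b), x ∈ B := by
    intro x hx
    simp only [List.mem_map] at hx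
    obtain ⟨i, _, rfl⟩ := hx
    split_ifs <;> assumption
  have h2 : g * V ∈ B := hV ▸ even_word B hBB _ hmem (by simpa using hev) g hgB
  have h3 := hBB _ h1 _ h2 _ hgB
  have h4 : g * V * (g * V) * g = g := by
    have := hv ((l.map fun i => decide (i = j)) ++ (l.map fun i => decide (i = j)) ++ [true])
    simp only [List.map_append, List.prod_append] at this
    rw [← map_bool, ← map_bool, word_sq γ β hγ hβ _ l hl] at this
    simp only [List.map_cons, List.map_nil, List.prod_cons, List.prod_nil, if_true, mul_one,
      one_mul, hvγ] at this
    rw [hj] at this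
    simp only [List.map_cons, List.prod_cons, if_true, ← hV] at this
    calc _ = (g * g * g) * V * (g * V) * (g * g * g) := by rw [hg3]
      _ = _ := by rw [← this]; simp only [mul_assoc]
      _ = g := this
  have h5 : e * V * (g * V) * g = e := by
    calc _ = (e * g * g) * V * (g * V) * g := by rw [hegg]
      _ = e * g * (g * V * (g * V) * g) := by simp only [mul_assoc]
      _ = e := by rw [h4, hegg]
  rwa [h5] at h3

theorem right_abs (a b : M) (ha : a ∈ O) (hb : b ∈ B) : b * b * a ∈ B := by
  have := left_abs (M := Mᵐᵒᵖ) (MulOpposite.unop ⁻¹' O) (MulOpposite.unop ⁻¹' B)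
    (by intro x hx; apply MulOpposite.unop_injective; simpa [mul_assoc] using hO3 _ hx)
    (by intro x hx y hy z hz; simpa [mul_assoc] using hOO _ hz _ hy _ hx)
    (fun x hx => hBO hx)
    (by intro x hx y hy z hz; simpa [mul_assoc] using hBB _ hz _ hy _ hx)
    l.reverse (by simpa using hl)
    (by
      intro a ha b hb j
      have := habs _ ha _ hb j
      simp only [Set.mem_preimage, MulOpposite.unop_list_prod]
      convert this using 2
      rw [← List.map_reverse, ← List.map_reverse, List.reverse_reverse, List.map_map]
      congr 1
      funext i
      by_cases h : i = j <;> simp [h])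
    (MulOpposite.op a) (MulOpposite.op b) ha hb
  simpa [mul_assoc] using this
end mon

section env
variable {A : Type*} (f : A → A → A → A)

/-- evaluation of words -/
def ev : List A → Option A
  | [] => none
  | a :: l => some (terProd f a l)

theorem terProd_mid (hassoc : TAssoc f) (x y z : A) (q : List A) (p : List A) (a : A)
    (h : Even (p.length + 1 + q.length)) :
    terProd f a (p ++ f x y z :: q) = terProd f a (p ++ x :: y :: z :: q) := by
  induction p using List.twoStepInduction generalizing a with
  | nil =>
    cases q with
    | nil => simp at h
    | cons c q =>
      simp only [List.nil_append, terProd]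
      rw [(hassoc a x y z c).1]
  | singleton c =>
    simp only [List.cons_append, List.nil_append, terProd]
    rw [← (hassoc a c x y z).2, ← (hassoc a c x y z).1]
  | cons_cons c d p ih _ =>
    simp only [List.cons_append, terProd]
    apply ih
    simp only [List.length_cons] at h
    grind

theorem ev_mid (hassoc : TAssoc f) (x y z : A) (p q : List A)
    (h : Odd (p.length + 1 + q.length)) :
    ev f (p ++ f x y z :: q) = ev f (p ++ x :: y :: z :: q) := by
  cases p with
  | nil => rfl
  | cons a p =>
    simp only [List.cons_append, ev]
    rw [terProd_mid f hassoc]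
    simp only [List.length_cons] at h
    grind

/-- the congruence defining the enveloping monoid -/
def envCon : Con (FreeMonoid A) where
  r u v := (Even u.toList.length ↔ Even v.toList.length) ∧
    ∀ p q : List A, Odd (p.length + u.toList.length + q.length) →
      ev f (p ++ u.toList ++ q) = ev f (p ++ v.toList ++ q)
  iseqv := {
    refl := fun u => ⟨Iff.rfl, fun _ _ _ => rfl⟩
    symm := fun {u v} h => ⟨h.1.symm, fun p q hpq => (h.2 p q (by have := h.1; grind)).symm⟩
    trans := fun {u v w} h h' => ⟨h.1.trans h'.1, fun p q hpq =>
      (h.2 p q hpq).trans (h'.2 p q (by have := h.1; grind))⟩ }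
  mul' := by
    intro u v u' v' h h'
    refine ⟨?_, ?_⟩
    · have h1 := h.1
      have h2 := h'.1
      simp only [FreeMonoid.toList_mul, List.length_append]
      grind
    · intro p q hpq
      simp only [FreeMonoid.toList_mul, List.length_append] at hpq ⊢
      have h1 := h.2 p (u'.toList ++ q) (by simp only [List.length_append]; grind)
      have h2 := h'.2 (p ++ v.toList) q (by
        have := h.1
        simp only [List.length_append]; grind)
      simp only [List.append_assoc] at h1 h2 ⊢
      rw [h1, h2]

/-- embedding in the enveloping monoid -/
def emb (a : A) : (envCon f).Quotient := ((FreeMonoid.of a : FreeMonoid A) : (envCon f).Quotient)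

theorem emb_inj : Function.Injective (emb f) := by
  intro a b h
  have h' : (envCon f) (FreeMonoid.of a) (FreeMonoid.of b) := (Con.eq _).1 h
  have := h'.2 [] [] (by simp)
  simpa [ev, terProd] using this

theorem emb_mul (hassoc : TAssoc f) (x y z : A) :
    emb f (f x y z) = emb f x * emb f y * emb f z := by
  refine (Con.eq (envCon f)
    (a := FreeMonoid.of (f x y z))
    (b := FreeMonoid.of x * FreeMonoid.of y * FreeMonoid.of z)).2 ⟨?_, ?_⟩
  · simp [FreeMonoid.toList_mul, Nat.even_add_one]
  · intro p q h
    simp only [FreeMonoid.toList_mul, FreeMonoid.toList_of, List.length_singleton] at h ⊢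
    simpa using ev_mid f hassoc x y z p q h

theorem emb_terProd (hassoc : TAssoc f) (l : List A) (a : A) (h : Even l.length) :
    emb f (terProd f a l) = emb f a * (l.map (emb f)).prod := by
  induction l using List.twoStepInduction generalizing a with
  | nil => simp [terProd]
  | singleton c => simp at h
  | cons_cons c d l ih _ =>
    simp only [terProd, List.map_cons, List.prod_cons]
    rw [ih _ (by simpa [Nat.even_add_one] using h), emb_mul f hassoc]
    simp only [mul_assoc]

end env

end TerAbs

/-- Let `(A,f)` be an idempotent ternary semigroup and `B` a ternary
subsemigroup. The following are equivalent: (1) `B ⊴ A`; (2) `a·b·b ∈ B` and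
`b·b·a ∈ B` for every `a ∈ A`, `b ∈ B`; (3) `a₁·a₂·a₃ ∈ B` whenever at least one of
`a₁, a₂, a₃` belongs to `B`. -/
theorem ternary_absorption_characterization {A : Type*} (f : A → A → A → A)
    (hidem : ∀ a : A, f a a a = a) (hassoc : TAssoc f)
    (B : Set A) (hne : B.Nonempty)
    (hcl : ∀ x ∈ B, ∀ y ∈ B, ∀ z ∈ B, f x y z ∈ B) :
    (TAbsorbs f B ↔ (∀ a : A, ∀ b ∈ B, f a b b ∈ B ∧ f b b a ∈ B)) ∧
    ((∀ a : A, ∀ b ∈ B, f a b b ∈ B ∧ f b b a ∈ B) ↔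
      (∀ a₁ a₂ a₃ : A, (a₁ ∈ B ∨ a₂ ∈ B ∨ a₃ ∈ B) → f a₁ a₂ a₃ ∈ B)) := by
  have h23 : (∀ a : A, ∀ b ∈ B, f a b b ∈ B ∧ f b b a ∈ B) →
      (∀ a₁ a₂ a₃ : A, (a₁ ∈ B ∨ a₂ ∈ B ∨ a₃ ∈ B) → f a₁ a₂ a₃ ∈ B) := by
    intro h
    have hL : ∀ b ∈ B, ∀ c d, f b c d ∈ B := by
      intro b hb c d
      have := (h (f b c d) b hb).2
      rwa [← (hassoc b b b c d).2, ← (hassoc b b b c d).1, hidem] at this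
    rintro x y z (hx | hy | hz)
    · exact hL x hx y z
    · have h1 : f y z x ∈ B := hL y hy z x
      have h2 := hL _ (h x _ h1).1 y z
      have h3 : f (f x (f y z x) (f y z x)) y z = f x y z := by
        apply TerAbs.emb_inj f
        conv_rhs => rw [← hidem (f x y z)]
        simp only [TerAbs.emb_mul f hassoc, mul_assoc]
      rwa [h3] at h2
    · have := (h (f x y z) z hz).1
      rwa [(hassoc x y z z z).1, (hassoc x y z z z).2, hidem] at this
  have h31 : (∀ a₁ a₂ a₃ : A, (a₁ ∈ B ∨ a₂ ∈ B ∨ a₃ ∈ B) → f a₁ a₂ a₃ ∈ B) → TAbsorbs f B := by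
    intro h
    refine ⟨3, 0, [1, 2], by decide, ?_, ?_⟩
    · intro a
      simpa [terProd] using hidem a
    · intro a b hb j
      simp only [List.map_cons, List.map_nil, terProd]
      apply h
      fin_cases j
      · right; left; simpa [Function.update] using hb 1
      · left; simpa [Function.update] using hb 0
      · left; simpa [Function.update] using hb 0
  have h12 : TAbsorbs f B → (∀ a : A, ∀ b ∈ B, f a b b ∈ B ∧ f b b a ∈ B) := by
    rintro ⟨m, hd, tl, hev, -, habs⟩ a b hb
    have hO3 : ∀ x ∈ Set.range (TerAbs.emb f), x * x * x = x := by
      rintro _ ⟨x, rfl⟩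
      rw [← TerAbs.emb_mul f hassoc, hidem]
    have hOO : ∀ x ∈ Set.range (TerAbs.emb f), ∀ y ∈ Set.range (TerAbs.emb f),
        ∀ z ∈ Set.range (TerAbs.emb f), x * y * z ∈ Set.range (TerAbs.emb f) := by
      rintro _ ⟨x, rfl⟩ _ ⟨y, rfl⟩ _ ⟨z, rfl⟩
      exact ⟨_, TerAbs.emb_mul f hassoc x y z⟩
    have hBO : TerAbs.emb f '' B ⊆ Set.range (TerAbs.emb f) := Set.image_subset_range _ _
    have hBB : ∀ x ∈ TerAbs.emb f '' B, ∀ y ∈ TerAbs.emb f '' B,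
        ∀ z ∈ TerAbs.emb f '' B, x * y * z ∈ TerAbs.emb f '' B := by
      rintro _ ⟨x, hx, rfl⟩ _ ⟨y, hy, rfl⟩ _ ⟨z, hz, rfl⟩
      exact ⟨_, hcl x hx y hy z hz, TerAbs.emb_mul f hassoc x y z⟩
    have hl : ¬ Even (hd :: tl).length := by simpa [Nat.even_add_one] using hev
    have hab : ∀ a ∈ Set.range (TerAbs.emb f), ∀ b ∈ TerAbs.emb f '' B, ∀ j,
        ((hd :: tl).map fun i => if i = j then a else b).prod ∈ TerAbs.emb f '' B := by
      rintro _ ⟨a, rfl⟩ _ ⟨b, hb, rfl⟩ j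
      refine ⟨_, habs a (fun _ => b) (fun _ => hb) j, ?_⟩
      rw [TerAbs.emb_terProd f hassoc _ _ (by simpa using hev)]
      have : (fun i => if i = j then TerAbs.emb f a else TerAbs.emb f b) =
          TerAbs.emb f ∘ Function.update (fun _ => b) j a := by
        funext i
        by_cases h : i = j <;> simp [Function.update, h]
      rw [this]
      simp
    have hmem : ∀ x, TerAbs.emb f x ∈ TerAbs.emb f '' B → x ∈ B := by
      rintro x ⟨y, hy, hxy⟩
      exact TerAbs.emb_inj f hxy ▸ hy
    constructor
    · apply hmem
      rw [TerAbs.emb_mul f hassoc]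
      exact TerAbs.left_abs _ _ hO3 hOO hBO hBB _ hl hab _ _ ⟨a, rfl⟩ ⟨b, hb, rfl⟩
    · apply hmem
      rw [TerAbs.emb_mul f hassoc]
      exact TerAbs.right_abs _ _ hO3 hOO hBO hBB _ hl hab _ _ ⟨a, rfl⟩ ⟨b, hb, rfl⟩
  exact ⟨⟨h12, fun h => h31 (h23 h)⟩, ⟨h23, fun h => h12 (h31 h)⟩⟩
end

section
/- Let A be an idempotent ternary semigroup, B a ternary subsemigroup of A with B ⊴ A. Let u be a word over A of odd length and v a nonempty word over A of even length. If the product u²vu belongs to B, then the product vu belongs to B; analogously, if the product uvu² belongs to B, then the product uv belongs to B. -/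
theorem terProd_append {A : Type*} (f : A → A → A → A) : ∀ (a : A) (l r : List A),
    Even l.length → terProd f a (l ++ r) = terProd f (terProd f a l) r
  | a, [], r, _ => by simp [terProd]
  | a, [_], r, h => by simp at h
  | a, p :: q :: l, r, h => by
    have h' : Even l.length := by simpa [Nat.even_add_one] using h
    simpa [terProd] using terProd_append f (f a p q) l r h'

theorem terProd_right {A : Type*} (f : A → A → A → A) (hassoc : TAssoc f) :
    ∀ (a b c : A) (l : List A),
    Even l.length → terProd f (f a b c) l = f a b (terProd f c l)
  | a, b, c, [], _ => by simp [terProd]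
  | a, b, c, [_], h => by simp at h
  | a, b, c, p :: q :: l, h => by
    have h' : Even l.length := by simpa [Nat.even_add_one] using h
    have := terProd_right f hassoc a b (f c p q) l h'
    simp only [terProd]
    rw [← this, (hassoc a b c p q).1, (hassoc a b c p q).2]

theorem terProd_mid {A : Type*} (f : A → A → A → A) (hassoc : TAssoc f) :
    ∀ (a c : A) (l : List A) (d : A) (r : List A),
    Even l.length → terProd f a (c :: (l ++ d :: r)) = terProd f (f a (terProd f c l) d) r
  | a, c, [], d, r, _ => by simp [terProd]
  | a, c, [_], d, r, h => by simp at h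
  | a, c, p :: q :: l, d, r, h => by
    have h' : Even l.length := by simpa [Nat.even_add_one] using h
    have := terProd_mid f hassoc (f a c p) q l d r h'
    simp only [terProd, List.cons_append]
    rw [this, terProd_right f hassoc c p q l h', (hassoc _ _ _ _ _).1]

theorem terProd_left_proj {A : Type*} (f : A → A → A → A) (S : Set A)
    (hS : ∀ p ∈ S, ∀ q ∈ S, ∀ r ∈ S, f p q r = p) :
    ∀ (a : A) (l : List A), a ∈ S → (∀ z ∈ l, z ∈ S) → terProd f a l = a
  | a, [], _, _ => by simp [terProd]
  | a, [_], _, _ => by simp [terProd]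
  | a, p :: q :: l, ha, hl => by
    simp only [terProd]
    rw [hS a ha p (hl p (by simp)) q (hl q (by simp))]
    exact terProd_left_proj f S hS a l ha (fun z hz => hl z (by simp [hz]))

theorem terProd_right_proj {A : Type*} (f : A → A → A → A) (S : Set A)
    (hS : ∀ p ∈ S, ∀ q ∈ S, ∀ r ∈ S, f p q r = r) :
    ∀ (a : A) (l : List A), Even l.length → a ∈ S → (∀ z ∈ l, z ∈ S) →
      terProd f a l = l.getLastD a
  | a, [], _, _, _ => by simp [terProd]
  | a, [_], h, _, _ => by simp at h
  | a, p :: q :: l, h, ha, hl => by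
    have h' : Even l.length := by simpa [Nat.even_add_one] using h
    simp only [terProd]
    rw [hS a ha p (hl p (by simp)) q (hl q (by simp)),
      terProd_right_proj f S hS q l h' (hl q (by simp)) (fun z hz => hl z (by simp [hz]))]
    simp only [List.getLastD_cons]

theorem getLastD_map_aux {α β : Type*} (g : α → β) : ∀ (a : α) (l : List α),
    (l.map g).getLastD (g a) = g (l.getLastD a)
  | a, [] => by simp
  | a, p :: l => by
    simp only [List.map_cons, List.getLastD_cons]
    exact getLastD_map_aux g p l

/-- If `B` absorbs `A`, `b ∈ B` and `f` is the left projection on `{b, c}`, then `c ∈ B`. -/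
theorem abs_left {A : Type*} (f : A → A → A → A) (B : Set A) (habs : TAbsorbs f B) (b c : A)
    (hb : b ∈ B)
    (hS : ∀ p ∈ ({b, c} : Set A), ∀ q ∈ ({b, c} : Set A), ∀ r ∈ ({b, c} : Set A), f p q r = p) :
    c ∈ B := by
  obtain ⟨m, hd, tl, -, -, h⟩ := habs
  have h1 := h c (fun _ => b) (fun _ => hb) hd
  have hm : ∀ i, Function.update (fun _ => b) hd c i ∈ ({b, c} : Set A) := by
    intro i
    by_cases hi : i = hd
    · subst hi; simp
    · simp [hi]
  rw [terProd_left_proj f _ hS _ _ (hm hd) (by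
    intro z hz
    obtain ⟨i, -, rfl⟩ := List.mem_map.1 hz
    exact hm i)] at h1
  simpa using h1

/-- If `B` absorbs `A`, `b ∈ B` and `f` is the right projection on `{b, c}`, then `c ∈ B`. -/
theorem abs_right_s9 {A : Type*} (f : A → A → A → A) (B : Set A) (habs : TAbsorbs f B) (b c : A)
    (hb : b ∈ B)
    (hS : ∀ p ∈ ({b, c} : Set A), ∀ q ∈ ({b, c} : Set A), ∀ r ∈ ({b, c} : Set A), f p q r = r) :
    c ∈ B := by
  obtain ⟨m, hd, tl, he, -, h⟩ := habs
  have h1 := h c (fun _ => b) (fun _ => hb) (tl.getLastD hd)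
  have hm : ∀ i, Function.update (fun _ => b) (tl.getLastD hd) c i ∈ ({b, c} : Set A) := by
    intro i
    by_cases hi : i = tl.getLastD hd
    · subst hi; rw [Function.update_self]; simp
    · rw [Function.update_of_ne hi]; simp
  rw [terProd_right_proj f _ hS _ _ (by simpa using he) (hm hd) (by
    intro z hz
    obtain ⟨i, -, rfl⟩ := List.mem_map.1 hz
    exact hm i), getLastD_map_aux] at h1
  simpa using h1

/-- Let `(A,f)` be an idempotent ternary semigroup, `B ⊴ A` a ternary
subsemigroup. Let `u = x :: u'` be a word of odd length and `v = y :: v'` a nonempty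
word of even length. If the product of `u·u·v·u` lies in `B`, then so does the product
of `v·u`; analogously if the product of `u·v·u·u` lies in `B`, then so does the product
of `u·v`. -/
theorem ternary_step1 {A : Type*} (f : A → A → A → A)
    (hidem : ∀ a : A, f a a a = a) (hassoc : TAssoc f)
    (B : Set A) (hne : B.Nonempty)
    (hcl : ∀ x ∈ B, ∀ y ∈ B, ∀ z ∈ B, f x y z ∈ B)
    (habs : TAbsorbs f B)
    (x : A) (u' : List A) (hu : Even u'.length)
    (y : A) (v' : List A) (hv : Odd v'.length) :
    (terProd f x (u' ++ (x :: u') ++ (y :: v') ++ (x :: u')) ∈ B →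
      terProd f y (v' ++ (x :: u')) ∈ B) ∧
    (terProd f x (u' ++ (y :: v') ++ (x :: u') ++ (x :: u')) ∈ B →
      terProd f x (u' ++ (y :: v')) ∈ B) := by
  have e1 : ∀ a b c d e, f (f a b c) d e = f a (f b c d) e := fun a b c d e =>
    (hassoc a b c d e).1
  have e2 : ∀ a b c d e, f a (f b c d) e = f a b (f c d e) := fun a b c d e =>
    (hassoc a b c d e).2
  obtain _ | ⟨w, w'⟩ := v'
  · simp at hv
  have hw : Even w'.length := by simpa [Nat.odd_add_one] using hv
  set U := terProd f x u' with hU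
  set W := terProd f w w' with hW
  have q1 : terProd f x (u' ++ (x :: u') ++ (y :: w :: w') ++ (x :: u'))
      = f (f U U y) W U := by
    simp only [List.append_assoc, List.cons_append]
    rw [terProd_append f _ _ _ hu, terProd_mid f hassoc _ _ _ _ _ hu, ← hU,
      terProd_mid f hassoc _ _ _ _ _ hw, terProd_right f hassoc _ _ _ _ hu]
  have q2 : terProd f y ((w :: w') ++ (x :: u')) = f y W U := by
    simp only [List.cons_append]
    rw [terProd_mid f hassoc _ _ _ _ _ hw, terProd_right f hassoc _ _ _ _ hu]
  have q4 : terProd f x (u' ++ (y :: w :: w')) = f U y W := by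
    rw [terProd_append f _ _ _ hu, ← hU]
    simp only [terProd]
    rw [terProd_right f hassoc _ _ _ _ hw]
  have q3 : terProd f x (u' ++ (y :: w :: w') ++ (x :: u') ++ (x :: u'))
      = f (f U y W) U U := by
    rw [List.append_assoc, terProd_append f, q4]
    · simp only [List.cons_append]
      rw [terProd_mid f hassoc _ _ _ _ _ hu, terProd_right f hassoc _ _ _ _ hu]
    · simp only [List.length_append, List.length_cons]
      exact hu.add (by simpa [Nat.even_add_one] using hw)
  rw [q1, q2, q3, q4]
  clear q1 q2 q3 q4
  constructor
  · intro hb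
    have hcU : f (f y W U) U U = f y W U := by rw [e1, e2, hidem]
    have hbe : f (f U U y) W U = f U U (f y W U) := by rw [e1, e2]
    rw [hbe] at hb
    generalize f y W U = c at *
    refine abs_left f B habs _ c hb ?_
    have k1 : ∀ z, f c (f U U c) z = f c c z := fun z => by rw [← e1, hcU]
    have k2 : f c c (f U U c) = c := by rw [← e2, hcU, hidem]
    have k : ∀ q ∈ ({f U U c, c} : Set A), ∀ r ∈ ({f U U c, c} : Set A), f c q r = c := by
      rintro q (rfl | rfl) r (rfl | rfl) <;> simp only [k1, k2, hidem]
    rintro p (rfl | rfl) q hq r hr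
    · rw [e1, e2, k q hq r hr]
    · exact k q hq r hr
  · intro hb
    have hcU : f U U (f U y W) = f U y W := by rw [← e2, ← e1, hidem]
    generalize f U y W = c at *
    refine abs_right_s9 f B habs _ c hb ?_
    have k1 : ∀ z, f z (f c U U) c = f z c c := fun z => by rw [e2, hcU]
    have k2 : f (f c U U) c c = c := by rw [e1, hcU, hidem]
    have k : ∀ p ∈ ({f c U U, c} : Set A), ∀ q ∈ ({f c U U, c} : Set A), f p q c = c := by
      rintro p (rfl | rfl) q (rfl | rfl) <;> simp only [k1, k2, hidem]
    rintro p hp q hq r (rfl | rfl)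
    · rw [← e2, ← e1, k p hp q hq]
    · exact k p hp q hq
end

section
/- Let A be an idempotent ternary semigroup, B a ternary subsemigroup of A with B ⊴ A. Let u be a nonempty word over A of even length and let b ∈ B. Then the product ub belongs to B if and only if the product bu belongs to B. -/
theorem tp_left {A : Type*} (f : A → A → A → A) (hassoc : TAssoc f) (p q : A) :
    ∀ (l : List A) (y : A), Even l.length → terProd f (f p q y) l = f p q (terProd f y l)
  | [], y, _ => rfl
  | [_], y, h => by simp at h
  | r :: s :: l, y, h => by
    have h' : Even l.length := by
      simp only [List.length_cons] at h; grind
    simp only [terProd]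
    rw [(hassoc p q y r s).1, (hassoc p q y r s).2]
    exact tp_left f hassoc p q l _ h'

theorem tp_right {A : Type*} (f : A → A → A → A) (hassoc : TAssoc f) (b : A) :
    ∀ (l : List A) (x y : A), Even l.length →
      terProd f x (y :: l ++ [b]) = f x (terProd f y l) b
  | [], x, y, _ => rfl
  | [_], x, y, h => by simp at h
  | r :: s :: l, x, y, h => by
    have h' : Even l.length := by
      simp only [List.length_cons] at h; grind
    have ih := tp_right f hassoc b l (f x y r) s h'
    simp only [terProd, List.cons_append] at ih ⊢
    rw [ih, tp_left f hassoc y r l s h', (hassoc x y r _ b).1]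

theorem tp_mem {A : Type*} (f : A → A → A → A) (C : Set A)
    (hC : ∀ x ∈ C, ∀ y ∈ C, ∀ z ∈ C, f x y z ∈ C) :
    ∀ (l : List A) (y : A), y ∈ C → (∀ z ∈ l, z ∈ C) → terProd f y l ∈ C
  | [], y, hy, _ => hy
  | [_], y, hy, _ => hy
  | r :: s :: l, y, hy, h => by
    simp only [terProd]
    exact tp_mem f C hC l _ (hC _ hy _ (h _ (by simp)) _ (h _ (by simp)))
      (fun z hz => h z (by simp [hz]))

/-- What absorption gives: elements of `B` in the subalgebra generated by `a, d`
that start (resp. end) with `a`. -/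
theorem abs_cons {A : Type*} (f : A → A → A → A)
    (hidem : ∀ a : A, f a a a = a) (hassoc : TAssoc f)
    (B : Set A) (habs : TAbsorbs f B) (a d : A) (hd : d ∈ B) :
    (∃ v ∈ B, (∀ C : Set A, (∀ x ∈ C, ∀ y ∈ C, ∀ z ∈ C, f x y z ∈ C) → a ∈ C → d ∈ C → v ∈ C)
      ∧ f v a a = v) ∧
    (∃ v ∈ B, (∀ C : Set A, (∀ x ∈ C, ∀ y ∈ C, ∀ z ∈ C, f x y z ∈ C) → a ∈ C → d ∈ C → v ∈ C)
      ∧ f a a v = v) := by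
  obtain ⟨m, h, tl, hev, -, H⟩ := habs
  have H' := H a (fun _ => d) (fun _ => hd)
  have gen : ∀ j : Fin m, ∀ C : Set A, (∀ x ∈ C, ∀ y ∈ C, ∀ z ∈ C, f x y z ∈ C) → a ∈ C → d ∈ C →
      terProd f (Function.update (fun _ => d) j a h)
        (tl.map (Function.update (fun _ => d) j a)) ∈ C := by
    intro j C hC ha hd
    have key : ∀ i, Function.update (fun _ : Fin m => d) j a i ∈ C := by
      intro i
      by_cases hi : i = j
      · subst hi; simpa using ha
      · simpa [Function.update_of_ne hi] using hd
    apply tp_mem f C hC _ _ (key h)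
    intro z hz
    obtain ⟨i, -, rfl⟩ := List.mem_map.1 hz
    exact key i
  constructor
  · rcases List.eq_nil_or_concat tl with rfl | ⟨l, k, rfl⟩
    · refine ⟨_, H' h, gen h, ?_⟩
      simp [terProd, hidem]
    · refine ⟨_, H' k, gen k, ?_⟩
      rcases l with _ | ⟨y, l⟩
      · simp at hev
      · have h2 : Even l.length := by
          simp at hev; grind
        have := tp_right f hassoc a (l.map (Function.update (fun _ => d) k a))
          (Function.update (fun _ => d) k a h) (Function.update (fun _ => d) k a y) (by simpa using h2)
        have e : List.map (Function.update (fun _ => d) k a) ((y :: l).concat k) =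
          Function.update (fun _ => d) k a y :: l.map (Function.update (fun _ => d) k a) ++ [a] := by
          simp
        rw [e, this, (hassoc _ _ _ _ _).1, (hassoc _ _ _ _ _).2, hidem]
  · refine ⟨_, H' h, gen h, ?_⟩
    rw [← tp_left f hassoc a a _ _ (by simpa using hev)]
    simp [hidem]

theorem step_core {A : Type*} (f : A → A → A → A)
    (hidem : ∀ a : A, f a a a = a) (hassoc : TAssoc f)
    (B : Set A) (hcl : ∀ x ∈ B, ∀ y ∈ B, ∀ z ∈ B, f x y z ∈ B)
    (H : ∀ a, ∀ d ∈ B, ∃ v ∈ B,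
      (∀ C : Set A, (∀ x ∈ C, ∀ y ∈ C, ∀ z ∈ C, f x y z ∈ C) → a ∈ C → d ∈ C → v ∈ C)
      ∧ f v a a = v)
    (x y b : A) (hb : b ∈ B) (hc : f x y b ∈ B) : f b x y ∈ B := by
  have n1 : ∀ p q r s t, f (f p q r) s t = f p q (f r s t) := fun p q r s t =>
    (hassoc p q r s t).1.trans (hassoc p q r s t).2
  have n2 : ∀ p q r s t, f p (f q r s) t = f p q (f r s t) := fun p q r s t =>
    (hassoc p q r s t).2
  have n3 : ∀ p s t, f p p (f p s t) = f p s t := fun p s t => by rw [← n1, hidem]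
  obtain ⟨c, hc'⟩ : ∃ c, c = f x y b := ⟨_, rfl⟩
  obtain ⟨a, ha⟩ : ∃ a, a = f b x y := ⟨_, rfl⟩
  obtain ⟨d, hd⟩ : ∃ d, d = f b c c := ⟨_, rfl⟩
  rw [← hc'] at hc
  rw [← ha]
  have hdB : d ∈ B := hd ▸ hcl _ hb _ hc _ hc
  have d1 : d = f a a b := by rw [hd, hc', ha]; simp only [n1, n2]
  have d2 : a = f d x y := by
    have := hidem a
    rw [hd, hc']
    nth_rewrite 1 [← this]
    rw [ha]; simp only [n1, n2]
  have gab : ∀ z w, (f a a z = z) → (f w w a = a) → f w w z = z := by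
    intro z w h1 h2
    rw [← h1, ← n1, h2]
  obtain ⟨v, hvB, hgen, hva⟩ := H a d hdB
  have hR := hgen {z | f a a z = z ∧ f z z a = a} (by
    rintro p ⟨p1, p2⟩ q ⟨q1, q2⟩ r ⟨r1, r2⟩
    refine ⟨by rw [← n1, p1], ?_⟩
    have e : a = f (f p q r) r (f q p a) := by
      rw [n1, ← n1 r r q, gab q r q1 r2, ← n2 p q q p a, gab p q p1 q2, p2]
    generalize f p q r = w at e ⊢
    rw [e, n3]) ⟨hidem a, hidem a⟩ ⟨by rw [d1, n3], by rw [d2]; exact n3 _ _ _⟩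
  obtain ⟨v1, v2⟩ := hR
  -- `a v v = a`
  have e1 : f a v v = a := by
    have : f a v v = f a (f v v a) a := by
      rw [n2, hva]
    rw [this, v2, hidem]
  have e2 : f b b v = v := by
    rw [← v1, ha]; simp only [n1, n2, n3]
  have e3 : f x y v = f c b v := by
    rw [hc', n1, e2]
  have e4 : a = f (f v v b) (f c b v) v := by
    rw [← e3]
    calc a = f v v (f a v v) := by rw [e1, v2]
      _ = _ := by rw [ha]; simp only [n1, n2]
  rw [e4]
  exact hcl _ (hcl _ hvB _ hvB _ hb) _ (hcl _ hc _ hb _ hvB) _ hvB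

/-- Let `(A,f)` be an idempotent ternary semigroup, `B ⊴ A` a
ternary subsemigroup. For a nonempty word `u = x :: u'` of even length and `b ∈ B`,
the product of `u·b` lies in `B` iff the product of `b·u` lies in `B`. -/
theorem ternary_step2 {A : Type*} (f : A → A → A → A)
    (hidem : ∀ a : A, f a a a = a) (hassoc : TAssoc f)
    (B : Set A) (hne : B.Nonempty)
    (hcl : ∀ x ∈ B, ∀ y ∈ B, ∀ z ∈ B, f x y z ∈ B)
    (habs : TAbsorbs f B)
    (x : A) (u' : List A) (hu : Odd u'.length) (b : A) (hb : b ∈ B) :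
    terProd f x (u' ++ [b]) ∈ B ↔ terProd f b (x :: u') ∈ B := by
  rcases u' with _ | ⟨y, l⟩
  · simp at hu
  · have hl : Even l.length := by
      simp only [List.length_cons] at hu; grind
    rw [tp_right f hassoc b l x y hl]
    have e : terProd f b (x :: y :: l) = f b x (terProd f y l) := tp_left f hassoc b x l y hl
    rw [e]
    constructor
    · exact step_core f hidem hassoc B hcl
        (fun a d hd => (abs_cons f hidem hassoc B habs a d hd).1) x _ b hb
    · refine step_core (fun p q r => f r q p) hidem ?_ B ?_ ?_ _ _ b hb
      · intro p q r s t
        exact ⟨(hassoc t s r q p).2.symm, (hassoc t s r q p).1.symm⟩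
      · exact fun p hp q hq r hr => hcl r hr q hq p hp
      · intro a d hd
        obtain ⟨v, hv, hg, hv'⟩ := (abs_cons f hidem hassoc B habs a d hd).2
        exact ⟨v, hv, fun C hC => hg C (fun p hp q hq r hr => hC r hr q hq p hp), hv'⟩
end

section
/- Let A be an idempotent ternary semigroup, B a ternary subsemigroup of A with B ⊴ A. Then for every a ∈ A and b ∈ B, the products abbab and babba belong to B. -/
theorem terProd_left {A : Type*} (f : A → A → A → A) (P S : A → Prop)
    (hS : ∀ s p q, S s → P p → P q → S (f s p q)) :
    ∀ (n : ℕ) (l : List A) (s : A), l.length = 2 * n → S s → (∀ x ∈ l, P x) →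
      S (terProd f s l) := by
  intro n
  induction n with
  | zero =>
    intro l s hl hs _
    have : l = [] := List.length_eq_zero_iff.mp (by omega)
    subst this
    simpa [terProd] using hs
  | succ n ih =>
    intro l s hl hs hP
    match l, hl, hP with
    | [], hl, _ => simp at hl
    | [_], hl, _ => simp at hl; omega
    | x :: y :: l, hl, hP =>
      simp only [terProd]
      refine ih l _ ?_ (hS _ _ _ hs (hP x (by simp)) (hP y (by simp))) ?_
      · simp at hl; omega
      · intro z hz; exact hP z (by simp [hz])

theorem terProd_cons {A : Type*} (f : A → A → A → A) (hassoc : TAssoc f) :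
    ∀ (n : ℕ) (l : List A) (a x y : A), l.length = 2 * n →
      terProd f (f a x y) l = f a x (terProd f y l) := by
  intro n
  induction n with
  | zero =>
    intro l a x y hl
    have : l = [] := List.length_eq_zero_iff.mp (by omega)
    subst this
    simp [terProd]
  | succ n ih =>
    intro l a x y hl
    match l, hl with
    | [], hl => simp at hl
    | [_], hl => simp at hl; omega
    | p :: q :: l, hl =>
      simp only [terProd]
      have h := hassoc a x y p q
      rw [h.1, h.2]
      exact ih l _ _ _ (by simp at hl; omega)

theorem terProd_right_s11 {A : Type*} (f : A → A → A → A) (hassoc : TAssoc f) (P S : A → Prop)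
    (hS : ∀ s p q, S s → P p → P q → S (f p q s)) :
    ∀ (n : ℕ) (l : List A) (a : A), l.length = 2 * n →
      S ((a :: l).getLast (by simp)) → (∀ x ∈ a :: l, P x) →
      S (terProd f a l) := by
  intro n
  induction n with
  | zero =>
    intro l s hl hs _
    have : l = [] := List.length_eq_zero_iff.mp (by omega)
    subst this
    simpa [terProd] using hs
  | succ n ih =>
    intro l a hl hs hP
    match l, hl, hs, hP with
    | [], hl, _, _ => simp at hl
    | [_], hl, _, _ => simp at hl; omega
    | x :: y :: l, hl, hs, hP =>
      simp only [terProd]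
      have hl' : l.length = 2 * n := by simp at hl; omega
      rw [terProd_cons f hassoc n l a x y hl']
      refine hS _ _ _ (ih l y hl' ?_ ?_) (hP a (by simp)) (hP x (by simp))
      · simpa using hs
      · intro z hz; exact hP z (by simp at hz ⊢; tauto)

/-- Substituting `y` for the first, resp. the last, variable. -/
theorem absorb_ends {A : Type*} (f : A → A → A → A) (hassoc : TAssoc f)
    (B : Set A) (habs : TAbsorbs f B) (y b : A) (hb : b ∈ B) (S T : A → Prop)
    (hSy : S y) (hTy : T y)
    (hS : ∀ s p q, S s → (p = y ∨ p = b) → (q = y ∨ q = b) → S (f s p q))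
    (hT : ∀ s p q, T s → (p = y ∨ p = b) → (q = y ∨ q = b) → T (f p q s)) :
    (∃ s ∈ B, S s) ∧ (∃ s ∈ B, T s) := by
  obtain ⟨m, hd, tl, ⟨n, hn⟩, -, h⟩ := habs
  have hP : ∀ j i : Fin m, Function.update (fun _ => b) j y i = y ∨
      Function.update (fun _ => b) j y i = b := by
    intro j i
    by_cases hij : i = j
    · subst hij; simp
    · simp [hij]
  constructor
  · refine ⟨_, h y (fun _ => b) (fun _ => hb) hd, ?_⟩
    refine terProd_left f (fun p => p = y ∨ p = b) S hS n _ _ (by simp; omega) (by simpa) ?_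
    intro x hx
    obtain ⟨i, -, rfl⟩ := List.mem_map.mp hx
    exact hP _ _
  · refine ⟨_, h y (fun _ => b) (fun _ => hb) ((hd :: tl).getLast (by simp)), ?_⟩
    refine terProd_right_s11 f hassoc (fun p => p = y ∨ p = b) T hT n _ _ (by simp; omega) ?_ ?_
    · simp only [← List.map_cons, List.getLast_map]
      simpa using hTy
    · intro x hx
      rw [← List.map_cons] at hx
      obtain ⟨i, -, rfl⟩ := List.mem_map.mp hx
      exact hP _ _

/-- The three ways in which a rule `u v w = z` is used on right-nested words. -/
theorem rules {A : Type*} (f : A → A → A → A) (hassoc : TAssoc f) (u v w z : A)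
    (h : f u v w = z) :
    (∀ p q, f u v (f w p q) = f z p q) ∧ (∀ p q, f p u (f v w q) = f p z q) := by
  refine ⟨fun p q => ?_, fun p q => ?_⟩
  · rw [← h, (hassoc u v w p q).1, (hassoc u v w p q).2]
  · rw [← h, (hassoc p u v w q).2]

theorem left_mem {A : Type*} (f : A → A → A → A)
    (hidem : ∀ a : A, f a a a = a) (hassoc : TAssoc f)
    (B : Set A) (hcl : ∀ x ∈ B, ∀ y ∈ B, ∀ z ∈ B, f x y z ∈ B)
    (habs : TAbsorbs f B) (y b : A) (hb : b ∈ B)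
    (h1 : f y b b = y) (h2 : f y b y = y) : y ∈ B := by
  have as1 : ∀ a b c d e, f (f a b c) d e = f a b (f c d e) := fun a b c d e =>
    (hassoc a b c d e).1.trans (hassoc a b c d e).2
  have as2 : ∀ a b c d e, f a (f b c d) e = f a b (f c d e) := fun a b c d e =>
    (hassoc a b c d e).2
  have h3 := hidem y
  have h4 := hidem b
  obtain ⟨r1, r1'⟩ := rules f hassoc _ _ _ _ h1
  obtain ⟨r2, r2'⟩ := rules f hassoc _ _ _ _ h2
  obtain ⟨r3, r3'⟩ := rules f hassoc _ _ _ _ h3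
  obtain ⟨r4, r4'⟩ := rules f hassoc _ _ _ _ h4
  obtain ⟨⟨s, hs, hS⟩, ⟨t, ht, hT⟩⟩ := absorb_ends f hassoc B habs y b hb
    (fun s => s = y ∨ s = f y y b) (fun s => s = y ∨ s = f b b y ∨ s = f b y y)
    (Or.inl rfl) (Or.inl rfl)
    (by
      rintro s p q (rfl | rfl) (rfl | rfl) (rfl | rfl) <;>
      simp [as1, as2, h1, h2, h3, h4, r1, r2, r3, r4, r1', r2', r3', r4'])
    (by
      rintro s p q (rfl | rfl | rfl) (rfl | rfl) (rfl | rfl) <;>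
      simp [as1, as2, h1, h2, h3, h4, r1, r2, r3, r4, r1', r2', r3', r4'])
  rcases hS with rfl | rfl
  · exact hs
  rcases hT with rfl | rfl | rfl
  · exact ht
  · have := hcl _ hs _ hs _ ht
    simpa [as1, as2, h1, h2, h3, h4, r1, r2, r3, r4, r1', r2', r3', r4'] using this
  · have := hcl _ hs _ hb _ ht
    simpa [as1, as2, h1, h2, h3, h4, r1, r2, r3, r4, r1', r2', r3', r4'] using this

theorem right_mem {A : Type*} (f : A → A → A → A)
    (hidem : ∀ a : A, f a a a = a) (hassoc : TAssoc f)
    (B : Set A) (hcl : ∀ x ∈ B, ∀ y ∈ B, ∀ z ∈ B, f x y z ∈ B)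
    (habs : TAbsorbs f B) (y b : A) (hb : b ∈ B)
    (h1 : f b b y = y) (h2 : f y b y = y) : y ∈ B := by
  have as1 : ∀ a b c d e, f (f a b c) d e = f a b (f c d e) := fun a b c d e =>
    (hassoc a b c d e).1.trans (hassoc a b c d e).2
  have as2 : ∀ a b c d e, f a (f b c d) e = f a b (f c d e) := fun a b c d e =>
    (hassoc a b c d e).2
  have h3 := hidem y
  have h4 := hidem b
  obtain ⟨r1, r1'⟩ := rules f hassoc _ _ _ _ h1
  obtain ⟨r2, r2'⟩ := rules f hassoc _ _ _ _ h2
  obtain ⟨r3, r3'⟩ := rules f hassoc _ _ _ _ h3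
  obtain ⟨r4, r4'⟩ := rules f hassoc _ _ _ _ h4
  obtain ⟨⟨t, ht, hT⟩, ⟨s, hs, hS⟩⟩ := absorb_ends f hassoc B habs y b hb
    (fun s => s = y ∨ s = f y b b ∨ s = f y y b) (fun s => s = y ∨ s = f b y y)
    (Or.inl rfl) (Or.inl rfl)
    (by
      rintro s p q (rfl | rfl | rfl) (rfl | rfl) (rfl | rfl) <;>
      simp [as1, as2, h1, h2, h3, h4, r1, r2, r3, r4, r1', r2', r3', r4'])
    (by
      rintro s p q (rfl | rfl) (rfl | rfl) (rfl | rfl) <;>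
      simp [as1, as2, h1, h2, h3, h4, r1, r2, r3, r4, r1', r2', r3', r4'])
  rcases hS with rfl | rfl
  · exact hs
  rcases hT with rfl | rfl | rfl
  · exact ht
  · have := hcl _ ht _ hs _ hs
    simpa [as1, as2, h1, h2, h3, h4, r1, r2, r3, r4, r1', r2', r3', r4'] using this
  · have := hcl _ ht _ hb _ hs
    simpa [as1, as2, h1, h2, h3, h4, r1, r2, r3, r4, r1', r2', r3', r4'] using this

/-- Let `(A,f)` be an idempotent ternary semigroup, `B ⊴ A` a
ternary subsemigroup. Then the products `a·b·b·a·b` and `b·a·b·b·a` belong to `B`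
for every `a ∈ A`, `b ∈ B`. -/
theorem ternary_step3 {A : Type*} (f : A → A → A → A)
    (hidem : ∀ a : A, f a a a = a) (hassoc : TAssoc f)
    (B : Set A) (hne : B.Nonempty)
    (hcl : ∀ x ∈ B, ∀ y ∈ B, ∀ z ∈ B, f x y z ∈ B)
    (habs : TAbsorbs f B) :
    ∀ a : A, ∀ b ∈ B, terProd f a [b, b, a, b] ∈ B ∧ terProd f b [a, b, b, a] ∈ B := by
  intro a b hb
  have as1 : ∀ a b c d e, f (f a b c) d e = f a b (f c d e) := fun a b c d e =>
    (hassoc a b c d e).1.trans (hassoc a b c d e).2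
  have as2 : ∀ a b c d e, f a (f b c d) e = f a b (f c d e) := fun a b c d e =>
    (hassoc a b c d e).2
  have h4 := hidem b
  obtain ⟨r4, r4'⟩ := rules f hassoc _ _ _ _ h4
  simp only [terProd]
  constructor
  · refine left_mem f hidem hassoc B hcl habs _ b hb ?_ ?_
    · simp only [as1, as2, h4, r4, r4']
    · have h := hidem (f a b b)
      have h' : f (f (f a b b) (f a b b) (f a b b)) a b = f (f a b b) a b := by rw [h]
      simp only [as1, as2, h4, r4, r4'] at h' ⊢
      exact h'
  · refine right_mem f hidem hassoc B hcl habs _ b hb ?_ ?_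
    · simp only [as1, as2, h4, r4, r4']
    · have h := hidem (f b b a)
      have h' : f b a (f (f b b a) (f b b a) (f b b a)) = f b a (f b b a) := by rw [h]
      simp only [as1, as2, h4, r4, r4'] at h' ⊢
      exact h'
end

section
/- Let A be an idempotent ternary semigroup, B a ternary subsemigroup of A with B ⊴ A. Then for every a ∈ A and b ∈ B, the products aab, baa and aabaa belong to B. -/
namespace TS4

/-- Evaluate a word in two letters. -/
def ev {N : Type*} [Monoid N] (q p : N) : List Bool → N
  | [] => 1
  | true :: l => q * ev q p l
  | false :: l => p * ev q p l

/-- Exponent sum of a word. -/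
def ex : List Bool → ℤ
  | [] => 0
  | true :: l => ex l + 1
  | false :: l => ex l - 1

/-- Swap the two letters. -/
def sw : List Bool → List Bool
  | [] => []
  | x :: l => (!x) :: sw l

theorem ev_append {N : Type*} [Monoid N] (q p : N) (u v : List Bool) :
    ev q p (u ++ v) = ev q p u * ev q p v := by
  induction u with
  | nil => simp [ev]
  | cons x u ih => cases x <;> simp [ev, ih, mul_assoc]

theorem ex_append (u v : List Bool) : ex (u ++ v) = ex u + ex v := by
  induction u with
  | nil => simp [ex]
  | cons x u ih => cases x <;> simp [ex, ih] <;> ring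

theorem ex_sw (u : List Bool) : ex (sw u) = - ex u := by
  induction u with
  | nil => simp [ex, sw]
  | cons x u ih => cases x <;> simp [ex, sw, ih] <;> ring

/-- Normal forms. -/
def Z {N : Type*} [Monoid N] (q g I : N) : ℤ → N
  | Int.ofNat n => q ^ n * I
  | Int.negSucc n => g ^ (n + 1) * I

section
variable {N : Type*} [Monoid N] {q g I : N}

theorem Z_up (hI : I * I = I) (hqg : q * g = I) (hIg : I * g = g) (n : ℤ) :
    q * Z q g I n = Z q g I (n + 1) := by
  rcases n with n | n
  · change q * (q ^ n * I) = q ^ (n + 1) * I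
    rw [pow_succ', mul_assoc]
  · rcases n with _ | n
    · change q * (g ^ (0 + 1) * I) = q ^ 0 * I
      rw [zero_add, pow_one, pow_zero, one_mul, ← mul_assoc, hqg, hI]
    · change q * (g ^ (n + 1 + 1) * I) = g ^ (n + 1) * I
      rw [pow_succ' g (n + 1), mul_assoc, ← mul_assoc q, hqg, pow_succ', mul_assoc, ← mul_assoc I,
        hIg]

theorem Z_down (hI : I * I = I) (hgq : g * q = I) (hIq : I * q = q) (n : ℤ) :
    g * Z q g I n = Z q g I (n - 1) := by
  rcases n with n | n
  · rcases n with _ | n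
    · change g * (q ^ 0 * I) = g ^ (0 + 1) * I
      simp
    · have : (Int.ofNat (n + 1)) - 1 = Int.ofNat n := by simp
      rw [this]
      change g * (q ^ (n + 1) * I) = q ^ n * I
      rw [pow_succ', mul_assoc, ← mul_assoc g, hgq]
      rcases n with _ | n
      · simp [hI]
      · rw [pow_succ', mul_assoc, ← mul_assoc I, hIq]
  · have : (Int.negSucc n) - 1 = Int.negSucc (n + 1) := by
      rw [Int.negSucc_eq, Int.negSucc_eq]; push_cast; ring
    rw [this]
    change g * (g ^ (n + 1) * I) = g ^ (n + 1 + 1) * I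
    rw [pow_succ' g (n + 1), mul_assoc]
end

section
variable {N : Type*} [Monoid N] {q p : N}

structure Rel (q p : N) : Prop where
  h1 : q * (p * q) = q
  h2 : p * (q * p) = p
  h3 : q * (p * (p * (q * (q * p)))) = q * p
  h4 : p * (q * (q * (p * (p * q)))) = p * q

theorem Rel.Iq (h : Rel q p) : (q * (p * (p * q))) * q = q := by
  calc (q * (p * (p * q))) * q = (q * (p * (p * q))) * (q * (p * q)) := by rw [h.h1]
    _ = (q * (p * (p * (q * (q * p))))) * q := by simp only [mul_assoc]
    _ = q := by rw [h.h3, mul_assoc, h.h1]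

theorem Rel.qI (h : Rel q p) : q * (q * (p * (p * q))) = q := by
  calc q * (q * (p * (p * q))) = (q * (p * q)) * (q * (p * (p * q))) := by rw [h.h1]
    _ = q * (p * (q * (q * (p * (p * q))))) := by simp only [mul_assoc]
    _ = q := by rw [h.h4, h.h1]

theorem Rel.II (h : Rel q p) : (q * (p * (p * q))) * (q * (p * (p * q))) = q * (p * (p * q)) := by
  rw [← mul_assoc _ q, h.Iq]

theorem Rel.pIp (h : Rel q p) : p * ((q * (p * (p * q))) * p) = p * p := by
  calc p * ((q * (p * (p * q))) * p) = (p * (q * p)) * (p * (q * p)) := by simp only [mul_assoc]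
    _ = _ := by rw [h.h2]

theorem Rel.norm (h : Rel q p) (w : List Bool) :
    (q * (p * (p * q))) * ev q p w * (q * (p * (p * q))) =
      Z q ((q * (p * (p * q))) * p * (q * (p * (p * q)))) (q * (p * (p * q))) (ex w) := by
  have hII := h.II
  have hIq := h.Iq
  have hqI := h.qI
  have hpIp := h.pIp
  have a1 : (q * (p * (p * q))) * (p * q) = q * (p * (p * q)) := by
    calc _ = q * (p * (p * (q * (p * q)))) := by simp only [mul_assoc]
      _ = _ := by rw [h.h1]
  have a2 : (q * p) * (q * (p * (p * q))) = q * (p * (p * q)) := by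
    calc _ = (q * (p * q)) * (p * (p * q)) := by simp only [mul_assoc]
      _ = _ := by rw [h.h1]
  generalize q * (p * (p * q)) = I at *
  have hqg : q * (I * p * I) = I := by
    rw [← mul_assoc, ← mul_assoc, hqI, a2]
  have hgq : (I * p * I) * q = I := by
    rw [mul_assoc, hIq, mul_assoc, a1]
  have hIg : I * (I * p * I) = I * p * I := by
    rw [← mul_assoc, ← mul_assoc, hII]
  induction w with
  | nil => simp [ev, ex, Z, hII]
  | cons x w ih =>
    cases x
    · have key : p * (ev q p w * I) = p * (I * (ev q p w * I)) := by
        rcases w with _ | ⟨_ | _, w⟩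
        · simp [ev, hII]
        · simp only [ev]
          rw [mul_assoc p (ev q p w), ← mul_assoc I p, ← mul_assoc p (I * p), hpIp, mul_assoc]
        · simp only [ev]
          rw [mul_assoc q (ev q p w), ← mul_assoc I q, hIq]
      change I * (p * ev q p w) * I = Z q (I * p * I) I (ex w - 1)
      rw [← Z_down hII hgq hIq, ← ih, mul_assoc I, mul_assoc p, key]
      have e : I * p * I * (I * ev q p w * I) = I * p * ((I * I) * ev q p w * I) := by
        simp only [mul_assoc]
      rw [e, hII]
      simp only [mul_assoc]
    · change I * (q * ev q p w) * I = Z q (I * p * I) I (ex w + 1)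
      rw [← Z_up hII hqg hIg, ← ih, ← mul_assoc I q, hIq, mul_assoc I, ← mul_assoc q I, hqI,
        mul_assoc]
end

/-- The word of occurrences of `j` in an even-length tail. -/
def pw {m : ℕ} (j : Fin m) : List (Fin m) → List Bool
  | [] => []
  | [_] => []
  | y :: z :: l => (if y = j then [false] else []) ++ ((if z = j then [true] else []) ++ pw j l)

theorem pw_sum {m : ℕ} : ∀ l : List (Fin m), ∑ j, ex (pw j l) = 0
  | [] => by simp [pw, ex]
  | [_] => by simp [pw, ex]
  | y :: z :: l => by
    have ih := pw_sum l
    have e : ∀ j, ex (pw j (y :: z :: l)) =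
        (if y = j then (-1 : ℤ) else 0) + ((if z = j then 1 else 0) + ex (pw j l)) := by
      intro j
      simp only [pw, ex_append]
      split_ifs <;> simp [ex]
    simp [e, Finset.sum_add_distrib, ih]

theorem pw_last {m : ℕ} : ∀ l : List (Fin m), Even l.length → l = [] ∨
    ∃ j s, pw j l = s ++ [true]
  | [], _ => Or.inl rfl
  | [_], h => by simp at h
  | y :: z :: l, h => by
    right
    have h' : Even l.length := by
      simp only [List.length_cons] at h
      rw [Nat.even_iff] at *; omega
    rcases pw_last l h' with rfl | ⟨j, s, hs⟩
    · exact ⟨z, if y = z then [false] else [], by simp [pw]⟩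
    · exact ⟨j, (if y = j then [false] else []) ++ ((if z = j then [true] else []) ++ s), by
        simp [pw, hs]⟩

section main
variable {A : Type*} (f : A → A → A → A)

def Mq (a b : A) : Function.End A := fun x => f b b (f a a (f b b x))
def Mp (a b : A) : Function.End A := fun x => f b a (f a b x)

variable {f}

theorem bbb
    (hidem : ∀ a : A, f a a a = a)
    (as1 : ∀ a b c d e, f (f a b c) d e = f a b (f c d e))
    (as2 : ∀ a b c d e, f a (f b c d) e = f a b (f c d e))
    (b x y : A) : f b b (f b x y) = f b x y := by
  rw [← as1, hidem]

theorem bbb2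
    (hidem : ∀ a : A, f a a a = a)
    (as1 : ∀ a b c d e, f (f a b c) d e = f a b (f c d e))
    (as2 : ∀ a b c d e, f a (f b c d) e = f a b (f c d e))
    (b x : A) : f b b (f b b x) = f b b x := by
  rw [← as1, hidem]

theorem ev_right
    (hidem : ∀ a : A, f a a a = a)
    (as1 : ∀ a b c d e, f (f a b c) d e = f a b (f c d e))
    (as2 : ∀ a b c d e, f a (f b c d) e = f a b (f c d e))
    (a b : A) (w : List Bool) (x y z : A) :
    f (ev (Mq f a b) (Mp f a b) w x) y z = ev (Mq f a b) (Mp f a b) w (f x y z) := by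
  induction w with
  | nil => rfl
  | cons t w ih =>
    cases t
    · change f (f b a (f a b _)) y z = f b a (f a b _)
      rw [as1, as1, ih]
    · change f (f b b (f a a (f b b _))) y z = f b b (f a a (f b b _))
      rw [as1, as1, as1, ih]

theorem ev_conj
    (hidem : ∀ a : A, f a a a = a)
    (as1 : ∀ a b c d e, f (f a b c) d e = f a b (f c d e))
    (as2 : ∀ a b c d e, f a (f b c d) e = f a b (f c d e))
    (a b : A) (w : List Bool) (x z : A) :
    f b (ev (Mq f a b) (Mp f a b) w x) z = ev (Mq f a b) (Mp f a b) (sw w) (f b x z) := by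
  induction w with
  | nil => rfl
  | cons t w ih =>
    cases t
    · change f b (f b a (f a b _)) z = f b b (f a a (f b b _))
      rw [← ih, bbb hidem as1 as2]
      simp only [as2]
    · change f b (f b b (f a a (f b b _))) z = f b a (f a b _)
      rw [← ih, as2, as2, bbb hidem as1 as2]
      simp only [as2]

theorem ev_left
    (hidem : ∀ a : A, f a a a = a)
    (as1 : ∀ a b c d e, f (f a b c) d e = f a b (f c d e))
    (as2 : ∀ a b c d e, f a (f b c d) e = f a b (f c d e))
    (a b : A) (w : List Bool) (hw : w ≠ []) (x : A) :
    f b b (ev (Mq f a b) (Mp f a b) w x) = ev (Mq f a b) (Mp f a b) w x := by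
  rcases w with _ | ⟨_ | _, w⟩
  · exact absurd rfl hw
  · exact bbb hidem as1 as2 _ _ _
  · exact bbb hidem as1 as2 _ _ _

theorem ev_leftb
    (hidem : ∀ a : A, f a a a = a)
    (as1 : ∀ a b c d e, f (f a b c) d e = f a b (f c d e))
    (as2 : ∀ a b c d e, f a (f b c d) e = f a b (f c d e))
    (a b : A) (w : List Bool) :
    f b b (ev (Mq f a b) (Mp f a b) w b) = ev (Mq f a b) (Mp f a b) w b := by
  rcases w with _ | ⟨x, w⟩
  · exact hidem b
  · exact ev_left hidem as1 as2 a b _ (by simp) b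

theorem cube
    (hidem : ∀ a : A, f a a a = a)
    (as1 : ∀ a b c d e, f (f a b c) d e = f a b (f c d e))
    (as2 : ∀ a b c d e, f a (f b c d) e = f a b (f c d e))
    (a b : A) (w : List Bool) :
    ev (Mq f a b) (Mp f a b) (w ++ (sw w ++ w)) b = ev (Mq f a b) (Mp f a b) w b := by
  have h := hidem (ev (Mq f a b) (Mp f a b) w b)
  rw [ev_right hidem as1 as2, ev_conj hidem as1 as2, ev_leftb hidem as1 as2] at h
  rw [ev_append, ev_append]
  exact h

theorem lastF
    (hidem : ∀ a : A, f a a a = a)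
    (as1 : ∀ a b c d e, f (f a b c) d e = f a b (f c d e))
    (as2 : ∀ a b c d e, f a (f b c d) e = f a b (f c d e))
    (a b : A) (w : List Bool) (t : Bool) (x : A) :
    ev (Mq f a b) (Mp f a b) (w ++ [t]) (f b b x) = ev (Mq f a b) (Mp f a b) (w ++ [t]) x := by
  rw [ev_append]
  change ev (Mq f a b) (Mp f a b) w (ev (Mq f a b) (Mp f a b) [t] _) =
    ev (Mq f a b) (Mp f a b) w (ev (Mq f a b) (Mp f a b) [t] _)
  refine congrArg (fun t : A => ev (Mq f a b) (Mp f a b) w t) ?_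
  cases t
  · change f b a (f a b (f b b x)) = f b a (f a b x)
    rw [← as2 a b b, hidem]
  · change f b b (f a a (f b b (f b b x))) = f b b (f a a (f b b x))
    rw [bbb2 hidem as1 as2]

theorem ev_ext
    (hidem : ∀ a : A, f a a a = a)
    (as1 : ∀ a b c d e, f (f a b c) d e = f a b (f c d e))
    (as2 : ∀ a b c d e, f a (f b c d) e = f a b (f c d e))
    (a b : A) (w v : List Bool) (s t : Bool)
    (h : ev (Mq f a b) (Mp f a b) (w ++ [s]) b = ev (Mq f a b) (Mp f a b) (v ++ [t]) b) :
    ev (Mq f a b) (Mp f a b) (w ++ [s]) = ev (Mq f a b) (Mp f a b) (v ++ [t]) := by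
  funext x
  rw [← lastF hidem as1 as2, ← ev_right hidem as1 as2, h, ev_right hidem as1 as2,
    lastF hidem as1 as2]

theorem rel
    (hidem : ∀ a : A, f a a a = a)
    (as1 : ∀ a b c d e, f (f a b c) d e = f a b (f c d e))
    (as2 : ∀ a b c d e, f a (f b c d) e = f a b (f c d e))
    (a b : A) : Rel (Mq f a b) (Mp f a b) := by
  have c := fun w => cube hidem as1 as2 a b w
  have e := fun w v s t => ev_ext hidem as1 as2 a b w v s t
  constructor
  · simpa [ev] using e [true, false] [] true true (c [true])
  · simpa [ev] using e [false, true] [] false false (c [false])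
  · simpa [ev] using e [true, false, false, true, true] [true] false false (c [true, false])
  · simpa [ev] using e [false, true, true, false, false] [false] true true (c [false, true])

theorem terProd_ev
    (hidem : ∀ a : A, f a a a = a)
    (as1 : ∀ a b c d e, f (f a b c) d e = f a b (f c d e))
    (as2 : ∀ a b c d e, f a (f b c d) e = f a b (f c d e))
    (a b : A) {m : ℕ} (j : Fin m) (σ : Fin m → A)
    (hj : σ j = f a a b) (hn : ∀ i, i ≠ j → σ i = b) (u : A → A)
    (hu : ∀ x y z, f (u x) y z = u (f x y z)) : ∀ (l : List (Fin m)) (w : List Bool),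
      Even l.length → 
      terProd f (u (ev (Mq f a b) (Mp f a b) w b)) (l.map σ) =
        u (ev (Mq f a b) (Mp f a b) (w ++ pw j l) b)
  | [], w, _ => by simp [pw, terProd]
  | [_], _, h => by simp at h
  | y :: z :: l, w, h => by
    have h' : Even l.length := by
      simp only [List.length_cons] at h
      rw [Nat.even_iff] at *; omega
    have ih := fun w => terProd_ev hidem as1 as2 a b j σ hj hn u hu l w h'
    simp only [List.map_cons, terProd, pw]
    rw [← List.append_assoc, ← List.append_assoc, ← ih, hu, ev_right hidem as1 as2]
    congr 2
    rw [List.append_assoc, ev_append]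
    change _ = ev (Mq f a b) (Mp f a b) w (ev (Mq f a b) (Mp f a b) _ b)
    refine congrArg (fun t : A => ev (Mq f a b) (Mp f a b) w t) ?_
    have eq1 : f b b (f a a b) = Mq f a b b := by
      change _ = f b b (f a a (f b b b)); rw [hidem]
    have ep1 : ∀ t, f b (f a a b) t = f b a (f a b t) := by
      intro t; rw [as2]
    by_cases hy : y = j <;> by_cases hz : z = j
    · simp only [hy, hz, if_true, hj]
      change _ = f b a (f a b (Mq f a b b))
      rw [← eq1, ep1, ← as2 a b b, hidem]
    · simp only [hy, hz, if_true, if_false, hj, hn z hz]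
      change _ = f b a (f a b b)
      rw [ep1]
    · simp only [hy, hz, if_true, if_false, hj, hn y hy]
      exact eq1
    · simp only [hy, hz, if_false, hn y hy, hn z hz]
      exact hidem b

theorem half
    (hidem : ∀ a : A, f a a a = a)
    (as1 : ∀ a b c d e, f (f a b c) d e = f a b (f c d e))
    (as2 : ∀ a b c d e, f a (f b c d) e = f a b (f c d e))
    (B : Set A) (hcl : ∀ x ∈ B, ∀ y ∈ B, ∀ z ∈ B, f x y z ∈ B)
    (habs : TAbsorbs f B) (a b : A) (hb : b ∈ B) : f a a b ∈ B := by
  obtain ⟨m, hd, tl, hev, -, ht⟩ := habs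
  have hR := rel hidem as1 as2 a b
  have hnorm := hR.norm
  have evr := ev_right hidem as1 as2 a b
  have evl := ev_leftb hidem as1 as2 a b
  have evl' := ev_left hidem as1 as2 a b
  have evc := ev_conj hidem as1 as2 a b
  have tp := fun j σ h1 h2 u hu l w h => terProd_ev hidem as1 as2 a b (m := m) j σ h1 h2 u hu l w h
  have hcube := hidem (f a a b)
  set q := Mq f a b with hq
  set p := Mp f a b with hp
  set I := q * (p * (p * q)) with hI
  have Kapp : ∀ u v, ev q p u b ∈ B → ev q p v b ∈ B → ev q p (u ++ v) b ∈ B := by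
    intro u v hu hv
    have := hcl _ hu _ hb _ hv
    rw [evr, evl] at this
    rw [ev_append]; exact this
  have Ksw : ∀ u, ev q p u b ∈ B → ev q p (sw u) b ∈ B := by
    intro u hu
    have := hcl _ hb _ hu _ hb
    rwa [evc, hidem] at this
  have E1 : f a a (ev q p (pw hd tl) b) ∈ B := by
    have h := ht (f a a b) (fun _ => b) (fun _ => hb) hd
    have := tp hd (Function.update (fun _ => b) hd (f a a b)) (by simp)
      (fun i hi => by simp [hi]) (fun x => f a a x) (fun x y z => as1 _ _ _ _ _) tl [] hev
    rw [Function.update_self] at h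
    exact this ▸ (show terProd f (f a a (ev q p [] b)) _ ∈ B from h)
  have KR : ∀ j, ev q p ((if j = hd then [true] else []) ++ pw j tl) b ∈ B := by
    intro j
    by_cases hj : j = hd
    · subst hj
      have := hcl _ hb _ hb _ E1
      rw [← evl] at this
      simp only [if_true]
      exact this
    · have h := ht (f a a b) (fun _ => b) (fun _ => hb) j
      have := tp j (Function.update (fun _ => b) j (f a a b)) (by simp)
        (fun i hi => by simp [hi]) (fun x => x) (fun x y z => rfl) tl [] hev
      rw [Function.update_of_ne (Ne.symm hj)] at h
      simp only [hj, if_false]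
      exact this ▸ (show terProd f (ev q p [] b) _ ∈ B from h)
  have Iq : I * q = q := hR.Iq
  have qI : q * I = q := hR.qI
  obtain ⟨j, s, hs⟩ : ∃ j s, (if j = hd then [true] else []) ++ pw j tl = s ++ [true] := by
    rcases pw_last tl hev with rfl | ⟨j, s, hs⟩
    · exact ⟨hd, [], by simp [pw]⟩
    · exact ⟨j, (if j = hd then [true] else []) ++ s, by simp [hs]⟩
  have KI : I b ∈ B := by
    have k1 := KR hd
    have k2 := KR j
    rw [hs] at k2
    simp only [if_true] at k1
    have k3 := Kapp _ _ (Kapp _ _ k1 (Ksw _ k1)) (Kapp _ _ (Ksw _ k2) k2)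
    set W := ([true] ++ pw hd tl ++ sw ([true] ++ pw hd tl) ++ (sw (s ++ [true]) ++ (s ++ [true])))
      with hW
    have e0 : ex W = 0 := by
      simp only [hW, ex_append, ex_sw]; ring
    have e1 : I * ev q p W * I = ev q p W := by
      have : ∃ X, W = true :: (X ++ [true]) :=
        ⟨pw hd tl ++ sw ([true] ++ pw hd tl) ++ (sw (s ++ [true]) ++ s), by simp [hW]⟩
      obtain ⟨X, hX⟩ := this
      rw [hX]
      simp only [ev, ev_append, mul_one]
      rw [← mul_assoc I, Iq, mul_assoc, mul_assoc _ q, qI]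
    have e2 := hnorm W
    rw [e1, e0] at e2
    have e3 : ev q p W = I := by rw [e2]; exact one_mul I
    rwa [e3] at k3
  have evI : ev q p [true, false, false, true] = I := by simp [ev, hI]
  have KIw : ev q p [true, false, false, true] b ∈ B := by rw [evI]; exact KI
  let H : AddSubmonoid ℤ :=
    { carrier := {n | ∃ u, ev q p u b ∈ B ∧ ex u = n}
      zero_mem' := ⟨[], hb, rfl⟩
      add_mem' := by
        rintro x y ⟨u, hu, rfl⟩ ⟨v, hv, rfl⟩
        exact ⟨u ++ v, Kapp _ _ hu hv, ex_append _ _⟩ }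
  have H1 : (1 : ℤ) ∈ H := by
    have h1 : ∑ j, ex ((if j = hd then [true] else []) ++ pw j tl) ∈ H :=
      sum_mem (fun j _ => ⟨_, KR j, rfl⟩)
    have h2 : ∑ j, ex ((if j = hd then [true] else []) ++ pw j tl) = 1 := by
      have : ∀ j, ex ((if j = hd then [true] else []) ++ pw j tl) =
          (if j = hd then (1 : ℤ) else 0) + ex (pw j tl) := by
        intro j
        rw [ex_append]
        split_ifs <;> simp [ex]
      simp [this, Finset.sum_add_distrib, pw_sum]
    rwa [h2] at h1
  obtain ⟨U, hU, hU1⟩ := H1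
  have Kq : ev q p [true] b ∈ B := by
    have k := Kapp _ _ (Kapp _ _ KIw hU) KIw
    have e : ev q p ([true, false, false, true] ++ U ++ [true, false, false, true]) =
        ev q p [true] := by
      rw [ev_append, ev_append, evI, hnorm U, hU1]
      have := hnorm [true]
      have e1 : ev q p [true] = q := by simp [ev]
      rw [e1, Iq, qI] at this
      rw [e1]; exact this.symm
    rwa [e] at k
  have Kp : ev q p [false] b ∈ B := Ksw _ Kq
  have Kall : ∀ w, ev q p w b ∈ B := by
    intro w
    induction w with
    | nil => exact hb
    | cons x w ih =>
      cases x
      · exact Kapp [false] w Kp ih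
      · exact Kapp [true] w Kq ih
  -- the final step
  have Epq : ∀ x, f a a (p (q x)) = f a a (f b b x) := by
    intro x
    have hb1 : f a a (p (q b)) = f a a b := by
      rw [as1, as2] at hcube
      have e : p (q b) = f b a (f a b (f a a b)) := by
        change f b a (f a b (f b b (f a a (f b b b)))) = _
        rw [hidem, ← as2 a b b, hidem]
      rw [e]; 
      simpa [as1, as2] using hcube
    have e2 : p (q x) = f (p (q b)) b x := by
      have := evr [false, true] b b x
      have l := lastF hidem as1 as2 a b [false] true x
      rw [← hq, ← hp] at l
      exact (this.trans l).symm
    rw [e2, ← as1, hb1, as1]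
  have hfin := hcl _ E1 _ hb _ (Kall (sw (pw hd tl) ++ [true, false, false, true]))
  rw [as1, evr, evl] at hfin
  set X := pw hd tl ++ sw (pw hd tl) with hX
  have e1 : ev q p (pw hd tl) (ev q p (sw (pw hd tl) ++ [true, false, false, true]) b) =
      ev q p (X ++ [true, false, false, true]) b := by
    rw [hX, List.append_assoc, ev_append q p (pw hd tl)]; rfl
  rw [e1, ← evl, ← Epq] at hfin
  have e2 : q * ev q p (X ++ [true, false, false, true]) = q := by
    rw [ev_append, evI]
    have h0 : ex X = 0 := by rw [hX, ex_append, ex_sw]; ring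
    have := hnorm X
    rw [h0] at this
    have h3 : I * ev q p X * I = I := this.trans (one_mul I)
    nth_rewrite 1 [← qI]
    rw [mul_assoc, ← mul_assoc I, h3, qI]
  have e3 : q (ev q p (X ++ [true, false, false, true]) b) = q b := congrFun e2 b
  rw [e3, Epq, hidem] at hfin
  exact hfin

end main

section rev
variable {A : Type*}

/-- Product of a list. -/
def T (f : A → A → A → A) (d : A) : List A → A
  | [] => d
  | a :: l => terProd f a l

theorem terProd_app (g : A → A → A → A)
    (as : ∀ a b c d e, g (g a b c) d e = g a b (g c d e)) (z y a : A) :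
    ∀ (M : List A) (m : A), Odd M.length →
      terProd g m (M ++ [z, y, a]) = terProd g m (M ++ [g z y a])
  | [], _, h => by simp at h
  | [k], m, _ => by simp [terProd, as]
  | k :: k2 :: M, m, h => by
    have h' : Odd M.length := by
      simp only [List.length_cons] at h
      rw [Nat.odd_iff] at *; omega
    simpa [terProd] using terProd_app g as z y a M (g m k k2) h'

theorem T_rev (f : A → A → A → A)
    (as : ∀ a b c d e, f a b (f c d e) = f (f a b c) d e) (d : A) :
    ∀ (l : List A) (a : A), Even l.length →
      T (fun x y z => f z y x) d (a :: l).reverse = terProd f a l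
  | [], a, _ => by simp [T, terProd]
  | [_], _, h => by simp at h
  | y :: z :: l, a, h => by
    have h' : Even l.length := by
      simp only [List.length_cons] at h
      rw [Nat.even_iff] at *; omega
    have ih := T_rev f as d l (f a y z) h'
    simp only [terProd]
    rw [← ih]
    simp only [List.reverse_cons, List.append_assoc, List.cons_append, List.nil_append]
    have hl : Even l.reverse.length := by simpa using h'
    rcases hM : l.reverse with _ | ⟨k, M⟩
    · simp [T, terProd]
    · rw [hM] at hl
      simp only [List.length_cons] at hl
      have hl' : Odd M.length := by
        rw [Nat.even_iff] at hl; rw [Nat.odd_iff]; omega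
      exact terProd_app (fun x y z => f z y x)
        (fun a b c d e => as e d c b a) z y a M k hl'

theorem abs_rev (f : A → A → A → A)
    (as : ∀ a b c d e, f a b (f c d e) = f (f a b c) d e) (B : Set A)
    (habs : TAbsorbs f B) : TAbsorbs (fun x y z => f z y x) B := by
  obtain ⟨m, hd, tl, hev, hid, ht⟩ := habs
  rcases hr : (hd :: tl).reverse with _ | ⟨hd', tl'⟩
  · simp at hr
  have key : ∀ σ : Fin m → A, terProd (fun x y z => f z y x) (σ hd') (tl'.map σ) =
      terProd f (σ hd) (tl.map σ) := by
    intro σ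
    rw [← T_rev f as (σ hd) (tl.map σ) (σ hd) (by simpa using hev), ← List.map_cons,
      ← List.map_reverse, hr]
    rfl
  refine ⟨m, hd', tl', ?_, fun a => ?_, fun a b hb j => ?_⟩
  · have := congrArg List.length hr
    simp at this
    rwa [← this]
  · exact (key (fun _ => a)).trans (hid a)
  · rw [key]; exact ht a b hb j
end rev

end TS4

/-- Let `(A,f)` be an idempotent ternary semigroup, `B ⊴ A` a
ternary subsemigroup. Then the products `a·a·b`, `b·a·a` and `a·a·b·a·a` belong to `B`
for every `a ∈ A`, `b ∈ B`. -/
theorem ternary_step4 {A : Type*} (f : A → A → A → A)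
    (hidem : ∀ a : A, f a a a = a) (hassoc : TAssoc f)
    (B : Set A) (hne : B.Nonempty)
    (hcl : ∀ x ∈ B, ∀ y ∈ B, ∀ z ∈ B, f x y z ∈ B)
    (habs : TAbsorbs f B) :
    ∀ a : A, ∀ b ∈ B, f a a b ∈ B ∧ f b a a ∈ B ∧ terProd f a [a, b, a, a] ∈ B := by
  have as1 : ∀ a b c d e, f (f a b c) d e = f a b (f c d e) := fun a b c d e =>
    (hassoc a b c d e).1.trans (hassoc a b c d e).2
  have as2 : ∀ a b c d e, f a (f b c d) e = f a b (f c d e) := fun a b c d e =>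
    (hassoc a b c d e).2
  have L : ∀ a : A, ∀ b ∈ B, f a a b ∈ B := fun a b hb =>
    TS4.half hidem as1 as2 B hcl habs a b hb
  have R : ∀ a : A, ∀ b ∈ B, f b a a ∈ B := fun a b hb =>
    TS4.half (f := fun x y z => f z y x) hidem
      (fun a b c d e => (as1 e d c b a).symm)
      (fun a b c d e => (hassoc e d c b a).1.symm) B
      (fun x hx y hy z hz => hcl z hz y hy x hx)
      (TS4.abs_rev f (fun a b c d e => (as1 a b c d e).symm) B habs) a b hb
  exact fun a b hb => ⟨L a b hb, R a b hb, R a _ (L a b hb)⟩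
end

section
/- Let A be an idempotent ternary semigroup, B a ternary subsemigroup of A with B ⊴ A. Let l > 1 be an integer, a ∈ A and b ∈ B. If b(ab)^l ∈ B, then (ab)^{l−1}a ∈ B. -/
section MonoidPart
variable {M : Type*} [Monoid M]

theorem t6_N (a b c q : M) (hq : a * b * q = c) (hcom : a * b * c = c * b * a)
    (hc : c * c * c = c)
    (h1 : (c * a * b) * (c * a * b) * (c * a * b) = c * a * b) :
    ∃ n, c * b * n = c := by
  have e1 : c * a * b * c * a * b * c = c := by
    calc c * a * b * c * a * b * c
        = (c * a * b) * (c * a * b) * (c * c * c) := by rw [hc]; simp only [mul_assoc]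
      _ = (c * a * b) * (c * a * b) * (c * (a * b * q) * c) := by rw [hq]
      _ = ((c * a * b) * (c * a * b) * (c * a * b)) * (q * c) := by simp only [mul_assoc]
      _ = c * (a * b * q) * c := by rw [h1]; simp only [mul_assoc]
      _ = c := by rw [hq, hc]
  have e2 : c * c * b * (a * a * b * c) = c := by
    calc c * c * b * (a * a * b * c) = c * (c * b * a) * (a * b * c) := by
          simp only [mul_assoc]
      _ = c * a * b * c * a * b * c := by rw [← hcom]; simp only [mul_assoc]
      _ = c := e1
  generalize a * a * b * c = y at e2
  refine ⟨y * b * y, ?_⟩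
  calc c * b * (y * b * y) = (c * c * c) * b * y * b * y := by rw [hc]; simp only [mul_assoc]
    _ = c * (c * c * b * y) * b * y := by simp only [mul_assoc]
    _ = c := by rw [e2]; exact e2

theorem t6_word (b c n : M) (hn : c * b * n = c) (hc : c * c * c = c) (hb : b * b * b = b)
    (k1 : c * b * c * c * b * c = c * c) (k2 : c * b * b * c * b * b * c = c)
    (L : List M) (hL : ∀ x ∈ L, x = c ∨ x = b) :
    (∃ s, c * L.prod * s = c) ∧ (∃ s, c * b * L.prod * s = c) ∧
      (∃ s, c * b * b * L.prod * s = c) := by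
  induction L with
  | nil =>
    refine ⟨⟨c * c, ?_⟩, ⟨n, ?_⟩, ⟨b * n, ?_⟩⟩
    · simpa [mul_assoc] using hc
    · simpa using hn
    · calc c * b * b * (List.prod []) * (b * n) = c * (b * b * b) * n := by simp [mul_assoc]
        _ = c := by rw [hb, hn]
  | cons x L ih =>
    obtain ⟨⟨s1, i1⟩, ⟨s2, i2⟩, ⟨s3, i3⟩⟩ := ih (fun y hy => hL y (List.mem_cons_of_mem _ hy))
    rw [List.prod_cons]
    rcases hL x List.mem_cons_self with rfl | rfl
    · refine ⟨⟨s1 * x, ?_⟩, ⟨s1 * x * b * x * x, ?_⟩, ⟨s1 * b * b * x, ?_⟩⟩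
      · calc x * (x * L.prod) * (s1 * x) = x * (x * L.prod * s1) * x := by simp only [mul_assoc]
          _ = x := by rw [i1, hc]
      · calc x * b * (x * L.prod) * (s1 * x * b * x * x)
            = x * b * (x * L.prod * s1) * x * b * x * x := by simp only [mul_assoc]
          _ = x := by rw [i1, k1, hc]
      · calc x * b * b * (x * L.prod) * (s1 * b * b * x)
            = x * b * b * (x * L.prod * s1) * b * b * x := by simp only [mul_assoc]
          _ = x := by rw [i1, k2]
    · refine ⟨⟨s2, ?_⟩, ⟨s3, ?_⟩, ⟨s2, ?_⟩⟩
      · rw [← mul_assoc]; exact i2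
      · rw [← mul_assoc]; exact i3
      · calc c * x * x * (x * L.prod) * s2 = c * (x * x * x) * L.prod * s2 := by
              simp only [mul_assoc]
          _ = c := by rw [hb, i2]

theorem t6_k0 (b c n : M) (hn : c * b * n = c) (hc : c * c * c = c)
    (h2 : (c * c * b) * (c * c * b) * (c * c * b) = c * c * b) :
    c * b * c * c * b * c = c * c := by
  have e : c * c * b * c * c * b * c = c := by
    calc c * c * b * c * c * b * c = c * c * b * c * c * b * (c * (c * b * n) * c) := by
          rw [hn, hc]
      _ = ((c * c * b) * (c * c * b) * (c * c * b)) * n * c := by simp only [mul_assoc]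
      _ = c * (c * b * n) * c := by rw [h2]; simp only [mul_assoc]
      _ = c := by rw [hn, hc]
  calc c * b * c * c * b * c = (c * c * c) * b * c * c * b * c := by rw [hc]
    _ = c * (c * c * b * c * c * b * c) := by simp only [mul_assoc]
    _ = c * c := by rw [e]

theorem t6_k2 (b c n : M) (hn : c * b * n = c) (hb : b * b * b = b)
    (h3 : (c * b * b) * (c * b * b) * (c * b * b) = c * b * b) :
    c * b * b * c * b * b * c = c := by
  have e : c * b * b * (b * n) = c := by
    calc c * b * b * (b * n) = c * (b * b * b) * n := by simp only [mul_assoc]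
      _ = c := by rw [hb, hn]
  calc c * b * b * c * b * b * c = c * b * b * c * b * b * (c * b * b * (b * n)) := by rw [e]
    _ = ((c * b * b) * (c * b * b) * (c * b * b)) * (b * n) := by simp only [mul_assoc]
    _ = c := by rw [h3, e]

theorem t6_final (b c : M) (hc : c * c * c = c) (k1 : c * b * c * c * b * c = c * c) :
    (c * c * b * (c * c)) * (c * c * (b * c * b) * (c * c)) * (c * c * b * (c * c)) = c := by
  have hc' : ∀ x, c * (c * (c * x)) = c * x := fun x => by
    rw [← mul_assoc, ← mul_assoc, hc]
  have hc3 : c * (c * c) = c := by rw [← mul_assoc, hc]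
  have k1' : ∀ x, c * (b * (c * (c * (b * (c * x))))) = c * (c * x) := fun x => by
    have := congrArg (· * x) k1
    simpa only [mul_assoc] using this
  simp only [mul_assoc, hc', hc3, k1']

end MonoidPart

section Rep
variable {A : Type*} (f : A → A → A → A)

def T6Phi : Type _ := {φ : A → A // ∀ a b c, f (φ a) b c = φ (f a b c)}

variable (hassoc : TAssoc f)

def t6act (a : A) : Option (A ⊕ T6Phi f) → Option (A ⊕ T6Phi f)
  | none => some (Sum.inl a)
  | some (Sum.inl x) => some (Sum.inr ⟨fun z => f x a z, fun p q r => by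
      rw [(hassoc x a p q r).1, (hassoc x a p q r).2]⟩)
  | some (Sum.inr φ) => some (Sum.inl (φ.1 a))

def t6rho (a : A) : (Function.End (Option (A ⊕ T6Phi f)))ᵐᵒᵖ :=
  MulOpposite.op (t6act f hassoc a)

theorem t6rho_inj (a b : A) (h : t6rho f hassoc a = t6rho f hassoc b) : a = b := by
  have h1 : t6act f hassoc a = t6act f hassoc b := MulOpposite.op_injective h
  have h2 := congrFun h1 none
  simpa [t6act] using h2

theorem t6rho_mul (a b c : A) :
    t6rho f hassoc a * t6rho f hassoc b * t6rho f hassoc c = t6rho f hassoc (f a b c) := by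
  apply MulOpposite.unop_injective
  funext x
  change t6act f hassoc c (t6act f hassoc b (t6act f hassoc a x)) = t6act f hassoc (f a b c) x
  rcases x with _ | x | φ
  · rfl
  · simp only [t6act]
    congr 2
    apply Subtype.ext
    funext z
    exact (hassoc x a b c z).1
  · simp only [t6act]
    rw [φ.2]

theorem t6rho_prod (n : ℕ) : ∀ (a : A) (l : List A), l.length = 2 * n →
    t6rho f hassoc (terProd f a l) = t6rho f hassoc a * (l.map (t6rho f hassoc)).prod := by
  induction n with
  | zero =>
    intro a l hl
    have : l = [] := List.length_eq_zero_iff.mp (by omega)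
    subst this
    simp [terProd]
  | succ n ih =>
    intro a l hl
    match l, hl with
    | x :: y :: l, hl =>
      rw [terProd, ih _ _ (by simp at hl; omega), ← t6rho_mul]
      simp [mul_assoc]

end Rep

theorem t6_flat {A M : Type*} [Monoid M] (r : A → M) (x y : A) (n : ℕ) :
    (((List.replicate n [x, y]).flatten).map r).prod = (r x * r y) ^ n := by
  induction n with
  | zero => simp
  | succ n ih => rw [List.replicate_succ, List.flatten_cons, List.map_append, List.prod_append,
      ih, pow_succ']; simp

theorem t6_flat_len {A : Type*} (x y : A) (n : ℕ) :
    ((List.replicate n [x, y]).flatten).length = 2 * n := by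
  simp [mul_comm]

/-- Let `(A,f)` be an idempotent ternary semigroup, `B ⊴ A` a
ternary subsemigroup, `l > 1` an integer, `a ∈ A` and `b ∈ B`. If `b·(a·b)^l ∈ B`,
then `(a·b)^(l-1)·a ∈ B`. -/
theorem ternary_step6 {A : Type*} (f : A → A → A → A)
    (hidem : ∀ a : A, f a a a = a) (hassoc : TAssoc f)
    (B : Set A) (hne : B.Nonempty)
    (hcl : ∀ x ∈ B, ∀ y ∈ B, ∀ z ∈ B, f x y z ∈ B)
    (habs : TAbsorbs f B)
    (l : ℕ) (hl : 1 < l) (a : A) (b : A) (hb : b ∈ B)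
    (h : terProd f b ((List.replicate l [a, b]).flatten) ∈ B) :
    terProd f a ((List.replicate (l - 1) [b, a]).flatten) ∈ B := by
  obtain ⟨k, rfl⟩ : ∃ k, l = k + 2 := ⟨l - 2, by omega⟩
  have inj := t6rho_inj f hassoc
  have mul := t6rho_mul f hassoc
  have prd := t6rho_prod f hassoc
  obtain ⟨m, hd, tl, ⟨n0, hn0⟩, -, habs⟩ := habs
  generalize t6rho f hassoc = r at inj mul prd
  have cube : ∀ x, r x * r x * r x = r x := fun x => by rw [mul, hidem]
  have e1 := prd _ b _ (t6_flat_len a b (k + 2))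
  have e2 := prd _ a _ (t6_flat_len b a (k + 2 - 1))
  rw [t6_flat] at e1 e2
  generalize terProd f a ((List.replicate (k + 2 - 1) [b, a]).flatten) = c at e2 ⊢
  generalize terProd f b ((List.replicate (k + 2) [a, b]).flatten) = d at e1 h
  have hk : k + 2 - 1 = k + 1 := rfl
  rw [hk] at e2
  have hsw : ∀ n : ℕ, (r a * r b) ^ n * r a = r a * (r b * r a) ^ n := fun n => by
    induction n with
    | zero => simp
    | succ n ih => rw [pow_succ', pow_succ', mul_assoc, ih]; simp only [mul_assoc]
  have hq : r a * r b * (r a * (r b * r a) ^ k) = r c := by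
    rw [e2, pow_succ']; simp only [mul_assoc]
  have hcom : r a * r b * r c = r c * r b * r a := by
    rw [e2, mul_assoc _ (r b) (r a), mul_assoc (r a) ((r b * r a) ^ (k+1)), ← pow_succ,
      pow_succ' _ (k + 1)]
    simp only [mul_assoc]
  have hd1 : r d = r b * r c * r b := by
    rw [e1, e2, ← hsw, pow_succ]
    simp only [mul_assoc]
  obtain ⟨n, hn⟩ := t6_N (r a) (r b) (r c) _ hq hcom (cube c) (by rw [mul, cube])
  have k1 := t6_k0 (r b) (r c) n hn (cube c) (by rw [mul, cube])
  have k2 := t6_k2 (r b) (r c) n hn (cube b) (by rw [mul, cube])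
  have word := t6_word (r b) (r c) n hn (cube c) (cube b) k1 k2
  have fin := t6_final (r b) (r c) (cube c) k1
  -- the absorbing words
  have hw : ∀ j : Fin m, ∃ w ∈ B, r w =
      ((hd :: tl).map (fun i => if i = j then r c else r b)).prod := by
    intro j
    refine ⟨_, habs c (fun _ => b) (fun _ => hb) j, ?_⟩
    rw [prd n0 _ _ (by rw [List.length_map]; omega), List.map_map, List.map_cons, List.prod_cons]
    have : (r ∘ Function.update (fun _ => b) j c) = (fun i => if i = j then r c else r b) := by
      funext i
      simp only [Function.comp, Function.update_apply]
      split_ifs <;> rfl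
    rw [this]
    congr 1
    exact congrFun this hd
  have hmem : ∀ (j : Fin m) (t : List (Fin m)),
      ∀ x ∈ t.map (fun i => if i = j then r c else r b), x = r c ∨ x = r b := by
    intro j t x hx
    obtain ⟨i, -, rfl⟩ := List.mem_map.mp hx
    split_ifs <;> simp
  obtain ⟨w1, hw1, ew1⟩ := hw hd
  obtain ⟨w2, hw2, ew2⟩ := hw ((hd :: tl).getLast (by simp))
  have hu := hcl w1 hw1 b hb w2 hw2
  have eu := (mul w1 b w2).symm
  generalize f w1 b w2 = u at hu eu
  have hend : r u * r c * r c = r u := by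
    rw [eu, ew2]
    have hs := List.dropLast_append_getLast (l := hd :: tl) (by simp)
    generalize (hd :: tl).getLast _ = z at hs ⊢
    rw [← hs, List.map_append, List.prod_append]
    simp only [List.map_cons, List.map_nil, List.prod_cons, List.prod_nil, mul_one, if_true]
    have := cube c
    rw [mul_assoc] at this
    simp only [mul_assoc, this]
  have hstart : ∃ s, r u * s = r c := by
    obtain ⟨⟨s, hs⟩, -⟩ := word
      (tl.map (fun i => if i = hd then r c else r b) ++ r b ::
        (hd :: tl).map (fun i => if i = (hd :: tl).getLast (by simp) then r c else r b)) (by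
      intro x hx
      rcases List.mem_append.mp hx with hx | hx
      · exact hmem _ _ x hx
      · rcases List.mem_cons.mp hx with hx | hx
        · exact Or.inr hx
        · exact hmem _ _ x hx)
    refine ⟨s, ?_⟩
    rw [← hs, eu, ew1, ew2, List.prod_append, List.prod_cons, List.map_cons, List.prod_cons,
      if_pos rfl]
    simp only [mul_assoc]
  have huu : r u * r u = r c * r c := by
    obtain ⟨s, hs⟩ := hstart
    have h1 : r u * r u * r c = r c := by
      rw [← hs, ← mul_assoc, cube]
    calc r u * r u = r u * (r u * r c * r c) := by rw [hend]
      _ = (r u * r u * r c) * r c := by simp only [mul_assoc]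
      _ = r c * r c := by rw [h1]
  have hg : ∀ x ∈ B, ∃ y ∈ B, r y = r c * r c * r x * (r c * r c) := by
    intro x hx
    refine ⟨f (f u u x) u u, hcl _ (hcl _ hu _ hu _ hx) _ hu _ hu, ?_⟩
    rw [← mul, ← mul, ← huu]
    simp only [mul_assoc]
  obtain ⟨g, hgB, eg⟩ := hg b hb
  obtain ⟨g', hgB', eg'⟩ := hg d h
  have : f g g' g = c := by
    apply inj
    rw [← mul, eg, eg', hd1]
    exact fin
  rw [← this]
  exact hcl _ hgB _ hgB' _ hgB
end
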